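/- There exists a function D(k,d), independent of N and of K, such that for every algebraically closed field K, every N, and every regular sequence G_1,…,G_s in R = K[x_1,…,x_N] with s ≤ k consisting of forms of degree at most d, every minimal prime ideal of the ideal (G_1,…,G_s)R can be generated by at most D(k,d) elements. -/

import Mathlib

universe u v w

section

open Filter

/-- The ideal of sequences vanishing almost everywhere for a fixed nonprincipal ultrafilter. -/
def upIdeal (A : ℕ → Type u) [∀ n, CommRing (A n)] : Ideal (∀ n, A n) where
  carrier := {f | ∀ᶠ n in (hyperfilter ℕ : Filter ℕ), f n = 0}
  add_mem' {f g} hf hg := by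
    filter_upwards [hf, hg] with n h1 h2
    simp [h1, h2]
  zero_mem' := by simp
  smul_mem' c f hf := by
    filter_upwards [hf] with n h1
    simp [h1]

/-- The ultraproduct of a sequence of commutative rings. -/
def UP (A : ℕ → Type u) [∀ n, CommRing (A n)] : Type u := (∀ n, A n) ⧸ upIdeal A

noncomputable instance (A : ℕ → Type u) [∀ n, CommRing (A n)] : CommRing (UP A) :=
  inferInstanceAs (CommRing ((∀ n, A n) ⧸ upIdeal A))

namespace UP

section
variable {A : ℕ → Type u} [∀ n, CommRing (A n)] {B : ℕ → Type v} [∀ n, CommRing (B n)]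
  {C : ℕ → Type w} [∀ n, CommRing (C n)]

/-- The class of a sequence in the ultraproduct. -/
noncomputable def mk : (∀ n, A n) →+* UP A := Ideal.Quotient.mk (upIdeal A)

theorem mk_surj (x : UP A) : ∃ f : ∀ n, A n, mk f = x := Ideal.Quotient.mk_surjective x

theorem mk_eq {f g : ∀ n, A n} :
    mk f = mk g ↔ ∀ᶠ n in (hyperfilter ℕ : Filter ℕ), f n = g n := by
  refine Ideal.Quotient.eq.trans ?_
  change (∀ᶠ n in (hyperfilter ℕ : Filter ℕ), f n - g n = 0) ↔ _
  simp only [sub_eq_zero]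

theorem mk_eq_zero {f : ∀ n, A n} :
    mk f = 0 ↔ ∀ᶠ n in (hyperfilter ℕ : Filter ℕ), f n = 0 := by
  rw [← map_zero (mk (A := A)), mk_eq]; rfl

theorem mk_ne_zero {f : ∀ n, A n} :
    mk f ≠ 0 ↔ ∀ᶠ n in (hyperfilter ℕ : Filter ℕ), f n ≠ 0 := by
  rw [ne_eq, mk_eq_zero, ← Ultrafilter.eventually_not]

theorem mk_add (f g : ∀ n, A n) : mk (fun n => f n + g n) = mk f + mk g := map_add mk f g
theorem mk_sub (f g : ∀ n, A n) : mk (fun n => f n - g n) = mk f - mk g := map_sub mk f g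
theorem mk_mul (f g : ∀ n, A n) : mk (fun n => f n * g n) = mk f * mk g := map_mul mk f g
theorem mk_pow (f : ∀ n, A n) (k : ℕ) : mk (fun n => f n ^ k) = mk f ^ k := map_pow mk f k
theorem mk_zero : mk (fun n => (0 : A n)) = 0 := map_zero mk
theorem mk_one : mk (fun n => (1 : A n)) = 1 := map_one mk
theorem mk_natCast (k : ℕ) : mk (fun n => (k : A n)) = k := map_natCast mk k

theorem mk_sum {ι : Type*} (s : Finset ι) (f : ι → ∀ n, A n) :
    mk (fun n => ∑ i ∈ s, f i n) = ∑ i ∈ s, mk (f i) := by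
  rw [← map_sum]; congr 1; ext n; simp

/-- The map of ultraproducts induced by a sequence of functions. -/
noncomputable def map₀ (φ : ∀ n, A n → B n) : UP A → UP B :=
  fun x => mk fun n => φ n ((mk_surj x).choose n)

theorem map₀_mk (φ : ∀ n, A n → B n) (f : ∀ n, A n) :
    map₀ φ (mk f) = mk fun n => φ n (f n) := by
  refine mk_eq.2 ?_
  filter_upwards [mk_eq.1 (mk_surj (mk f)).choose_spec] with n hn
  rw [hn]

/-- The ring homomorphism of ultraproducts induced by a sequence of ring homomorphisms. -/
noncomputable def map (φ : ∀ n, A n →+* B n) : UP A →+* UP B where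
  toFun := map₀ fun n => φ n
  map_one' := by rw [← mk_one, map₀_mk]; simp [mk_one]
  map_zero' := by rw [← mk_zero, map₀_mk]; simp [mk_zero]
  map_add' x y := by
    obtain ⟨f, rfl⟩ := mk_surj x
    obtain ⟨g, rfl⟩ := mk_surj y
    rw [← mk_add, map₀_mk, map₀_mk, map₀_mk, ← mk_add]; simp only [map_add]
  map_mul' x y := by
    obtain ⟨f, rfl⟩ := mk_surj x
    obtain ⟨g, rfl⟩ := mk_surj y
    rw [← mk_mul, map₀_mk, map₀_mk, map₀_mk, ← mk_mul]; simp only [map_mul]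

theorem map_mk (φ : ∀ n, A n →+* B n) (f : ∀ n, A n) :
    map φ (mk f) = mk fun n => φ n (f n) := map₀_mk _ f

theorem map_injective (φ : ∀ n, A n →+* B n) (h : ∀ n, Function.Injective (φ n)) :
    Function.Injective (map φ) := by
  rw [injective_iff_map_eq_zero]
  intro x hx
  obtain ⟨f, rfl⟩ := mk_surj x
  rw [map_mk, mk_eq_zero] at hx
  rw [mk_eq_zero]
  filter_upwards [hx] with n hn
  exact (injective_iff_map_eq_zero _).1 (h n) _ hn

instance [∀ n, Nontrivial (A n)] : Nontrivial (UP A) := by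
  refine ⟨⟨0, 1, fun h => ?_⟩⟩
  rw [← mk_zero, ← mk_one, mk_eq] at h
  obtain ⟨n, hn⟩ := h.exists
  exact zero_ne_one hn

instance [∀ n, IsDomain (A n)] : IsDomain (UP A) := by
  have : NoZeroDivisors (UP A) := by
    refine ⟨fun {x y} h => ?_⟩
    obtain ⟨f, rfl⟩ := mk_surj x
    obtain ⟨g, rfl⟩ := mk_surj y
    rw [← mk_mul, mk_eq_zero] at h
    rw [mk_eq_zero, mk_eq_zero, ← Ultrafilter.eventually_or]
    filter_upwards [h] with n hn
    exact mul_eq_zero.1 hn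
  exact NoZeroDivisors.to_isDomain _

theorem mem_span_range {ι : Type*} [Finite ι] (y : ι → ∀ n, A n) (f : ∀ n, A n) :
    mk f ∈ Ideal.span (Set.range fun j => mk (y j)) ↔
      ∀ᶠ n in (hyperfilter ℕ : Filter ℕ), f n ∈ Ideal.span (Set.range fun j => y j n) := by
  cases nonempty_fintype ι
  simp only [Ideal.mem_span_range_iff_exists_fun]
  constructor
  · rintro ⟨c, hc⟩
    choose d hd using fun j => mk_surj (c j)
    simp only [← hd, ← mk_mul, ← mk_sum, mk_eq] at hc
    filter_upwards [hc] with n hn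
    exact ⟨fun j => d j n, hn⟩
  · intro h
    classical
    choose! c hc using fun n (hn : ∃ c : ι → A n, ∑ i, c i * y i n = f n) => hn
    refine ⟨fun j => mk fun n => c n j, ?_⟩
    simp only [← mk_mul, ← mk_sum, mk_eq]
    filter_upwards [h] with n hn
    exact hc n hn

end

section
variable (K : ℕ → Type u) [∀ n, Field (K n)]

noncomputable instance : Field (UP K) := by
  refine IsField.toField ⟨exists_pair_ne _, mul_comm, fun {a} ha => ?_⟩
  obtain ⟨f, rfl⟩ := mk_surj a
  refine ⟨mk fun n => (f n)⁻¹, ?_⟩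
  rw [← mk_mul, ← mk_one, mk_eq]
  filter_upwards [mk_ne_zero.1 ha] with n hn
  exact mul_inv_cancel₀ hn

instance [∀ n, IsAlgClosed (K n)] : IsAlgClosed (UP K) := by
  refine IsAlgClosed.of_exists_root _ fun p hp hirr => ?_
  choose c hc using fun k => mk_surj (p.coeff k)
  have h1 : ∀ n, ∃ z : K n, z ^ p.natDegree +
      ∑ k ∈ Finset.range p.natDegree, c k n * z ^ k = 0 := by
    intro n
    obtain ⟨z, hz⟩ := IsAlgClosed.exists_root (Polynomial.X ^ p.natDegree +
      ∑ k ∈ Finset.range p.natDegree, Polynomial.C (c k n) * Polynomial.X ^ k) (by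
        have hd : p.natDegree ≠ 0 := hirr.natDegree_pos.ne'
        have : (∑ k ∈ Finset.range p.natDegree, Polynomial.C (c k n) * Polynomial.X ^ k).degree
            < ((Polynomial.X : Polynomial (K n)) ^ p.natDegree).degree := by
          rw [Polynomial.degree_X_pow]
          refine (Polynomial.degree_sum_le _ _).trans_lt ?_
          rw [Finset.sup_lt_iff (WithBot.bot_lt_coe _)]
          intro k hk
          exact (Polynomial.degree_C_mul_X_pow_le _ _).trans_lt
            (by exact_mod_cast Finset.mem_range.1 hk)
        rw [Polynomial.degree_add_eq_left_of_degree_lt this, Polynomial.degree_X_pow]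
        exact_mod_cast hd)
    refine ⟨z, ?_⟩
    simpa [Polynomial.IsRoot, Polynomial.eval_finsetSum] using hz
  choose z hz using h1
  refine ⟨mk z, ?_⟩
  rw [Polynomial.eval_eq_sum_range, Finset.sum_range_succ]
  have hl : p.coeff p.natDegree = 1 := hp
  rw [hl, one_mul]
  simp only [← hc, ← mk_mul, ← mk_pow, ← mk_sum, ← mk_add]
  rw [mk_eq_zero]
  exact Eventually.of_forall fun n => by rw [add_comm]; exact hz n

end
end UP

end

section

/-- A grading of a `K`-algebra with constants in degree zero, given by its component maps, together
with families of algebra endomorphisms and of derivations that behave like the translations and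
directional derivatives of a polynomial ring. -/
structure GradedTranslation (K : Type u) (S : Type v) (W : Type w) (p : ℕ) [Field K] [CommRing S]
    [Algebra K S] where
  comp : ℕ → S →ₗ[K] S
  comp_comp : ∀ m n f, comp m (comp n f) = if m = n then comp n f else 0
  exists_bound : ∀ f, ∃ N, ∀ n ≥ N, comp n f = 0
  sum_comp : ∀ f N, (∀ n ≥ N, comp n f = 0) → ∑ n ∈ Finset.range N, comp n f = f
  hom_mul : ∀ a b f g, comp a f = f → comp b g = g → comp (a + b) (f * g) = f * g
  hom_zero : ∀ f, comp 0 f = f → ∃ c : K, algebraMap K S c = f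
  hom_one : comp 0 1 = 1
  τ : W → S →ₐ[K] S
  comp_τ : ∀ w n f, comp n f = f → comp n (τ w f) = f
  comp_τ_gt : ∀ w n m f, comp n f = f → n < m → comp m (τ w f) = 0
  eq_zero_of_τ : ∀ n f, comp n f = f → n ≠ 0 → (∀ w, τ w f = f) → f = 0
  D : W → Derivation K S S
  hom_D : ∀ w n f, comp (n + 1) f = f → comp n (D w f) = D w f
  exists_pow : ∀ f, (∀ w, D w f = 0) → ∃ u, u ^ p = f

namespace GradedTranslation

variable {K : Type u} {S : Type v} {W : Type w} {p : ℕ} [Field K] [CommRing S] [Algebra K S]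
  (G : GradedTranslation K S W p)

/-- All components of degree at least `n` vanish. -/
def Lt (n : ℕ) (f : S) : Prop := ∀ k, n ≤ k → G.comp k f = 0

theorem hom_comp (n : ℕ) (f : S) : G.comp n (G.comp n f) = G.comp n f := by
  rw [G.comp_comp, if_pos rfl]

theorem comp_of_hom {n m : ℕ} {f : S} (h : G.comp n f = f) (hne : m ≠ n) : G.comp m f = 0 := by
  rw [← h, G.comp_comp, if_neg hne]

theorem Lt.add {n : ℕ} {f g : S} (hf : G.Lt n f) (hg : G.Lt n g) : G.Lt n (f + g) := by
  intro k hk; rw [map_add, hf k hk, hg k hk, add_zero]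

theorem Lt.zero (n : ℕ) : G.Lt n 0 := fun _ _ => map_zero _

theorem Lt.sum {ι : Type*} (s : Finset ι) {n : ℕ} {f : ι → S} (hf : ∀ i ∈ s, G.Lt n (f i)) :
    G.Lt n (∑ i ∈ s, f i) := by
  intro k hk; rw [map_sum]; exact Finset.sum_eq_zero fun i hi => hf i hi k hk

theorem Lt.mono {n m : ℕ} {f : S} (hf : G.Lt n f) (h : n ≤ m) : G.Lt m f :=
  fun k hk => hf k (h.trans hk)

theorem lt_of_hom {n m : ℕ} {f : S} (h : G.comp n f = f) (hm : n < m) : G.Lt m f :=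
  fun _ hk => G.comp_of_hom h (by omega)

theorem Lt.mul {n m : ℕ} {f g : S} (hf : G.Lt n f) (hg : G.Lt m g) :
    G.Lt (n + m - 1) (f * g) := by
  rw [← G.sum_comp f n hf, ← G.sum_comp g m hg, Finset.sum_mul_sum]
  refine Lt.sum G _ fun i hi => Lt.sum G _ fun j hj => ?_
  have := Finset.mem_range.1 hi
  have := Finset.mem_range.1 hj
  exact G.lt_of_hom (G.hom_mul _ _ _ _ (G.hom_comp _ _) (G.hom_comp _ _)) (by omega)

theorem Lt.pow {n : ℕ} {f : S} (hf : G.Lt (n + 1) f) (k : ℕ) : G.Lt (n * k + 1) (f ^ k) := by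
  induction k with
  | zero => simpa using G.lt_of_hom G.hom_one (Nat.zero_lt_one)
  | succ k ih =>
    rw [pow_succ]
    exact (ih.mul G hf).mono G (by rw [Nat.mul_succ]; omega)

theorem eq_of_comp {f g : S} (h : ∀ n, G.comp n f = G.comp n g) : f = g := by
  obtain ⟨N, hN⟩ := G.exists_bound f
  rw [← G.sum_comp f N hN, ← G.sum_comp g N fun n hn => by rw [← h n, hN n hn]]
  exact Finset.sum_congr rfl fun n _ => h n

theorem comp_hom_mul {a : ℕ} {f : S} (hf : G.comp a f = f) (n : ℕ) (g : S) :
    G.comp (a + n) (f * g) = f * G.comp n g := by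
  obtain ⟨N, hN⟩ := G.exists_bound g
  conv_lhs => rw [← G.sum_comp g N hN]
  have h : ∀ k, G.comp (a + n) (f * G.comp k g) = if k = n then f * G.comp k g else 0 := by
    intro k
    have := G.hom_mul a k f _ hf (G.hom_comp k g)
    rw [← this, G.comp_comp]
    by_cases hk : k = n
    · simp [hk]
    · rw [if_neg (by omega), if_neg hk]
  rw [Finset.mul_sum, map_sum]
  simp only [h, Finset.sum_ite_eq', Finset.mem_range]
  split_ifs with h1
  · rfl
  · rw [hN n (by omega), mul_zero]

theorem comp_hom_mul_lt {a : ℕ} {f : S} (hf : G.comp a f = f) {n : ℕ} (hn : n < a) (g : S) :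
    G.comp n (f * g) = 0 := by
  obtain ⟨N, hN⟩ := G.exists_bound g
  rw [← G.sum_comp g N hN, Finset.mul_sum, map_sum]
  exact Finset.sum_eq_zero fun k _ =>
    G.comp_of_hom (G.hom_mul a k f _ hf (G.hom_comp k g)) (by omega)

theorem hom_pow {a : ℕ} {f : S} (hf : G.comp a f = f) (k : ℕ) :
    G.comp (k * a) (f ^ k) = f ^ k := by
  induction k with
  | zero => simpa using G.hom_one
  | succ k ih => rw [pow_succ, Nat.succ_mul]; exact G.hom_mul _ _ _ _ ih hf

theorem hom_algebraMap (c : K) : G.comp 0 (algebraMap K S c) = algebraMap K S c := by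
  rw [Algebra.algebraMap_eq_smul_one, map_smul, G.hom_one]

theorem pow_eq_sum [IsDomain S] [ExpChar S p] (f : S) (N : ℕ) (hN : ∀ n ≥ N, G.comp n f = 0) :
    f ^ p = ∑ n ∈ Finset.range N, G.comp n f ^ p := by
  conv_lhs => rw [← G.sum_comp f N hN]
  exact map_sum (frobenius S p) _ _

theorem comp_pow_char [IsDomain S] [ExpChar S p] (n : ℕ) (f : S) :
    ∃ s, G.comp n (f ^ p) = s ^ p ∧ ∃ k, p * k ≤ n ∧ G.comp k s = s := by
  have hp : 0 < p := expChar_pos S p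
  obtain ⟨N, hN⟩ := G.exists_bound f
  by_cases h : p ∣ n
  · obtain ⟨k, rfl⟩ := h
    refine ⟨G.comp k f, ?_, k, le_rfl, G.hom_comp _ _⟩
    rw [G.pow_eq_sum f N hN, map_sum]
    have h : ∀ m, G.comp (p * k) (G.comp m f ^ p) = if m = k then G.comp m f ^ p else 0 := by
      intro m
      rw [← G.hom_pow (G.hom_comp m f), G.comp_comp]
      by_cases hk : m = k
      · simp [hk]
      · rw [if_neg (fun h => hk (Nat.eq_of_mul_eq_mul_left hp h).symm), if_neg hk]
    simp only [h, Finset.sum_ite_eq', Finset.mem_range]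
    split_ifs with h1
    · rfl
    · rw [hN k (by omega), zero_pow hp.ne']
  · refine ⟨0, ?_, 0, by simp, map_zero _⟩
    rw [G.pow_eq_sum f N hN, map_sum, zero_pow hp.ne']
    exact Finset.sum_eq_zero fun m _ => G.comp_of_hom (G.hom_pow (G.hom_comp m f) p)
      (fun h' => h ⟨m, h'⟩)

end GradedTranslation

end

section

open Polynomial

theorem Polynomial.taylor_coeff_eq_sum {R : Type*} [CommRing R] (r : R) (f : R[X]) (l : ℕ) :
    (taylor r f).coeff l =
      ∑ j ∈ Finset.range (f.natDegree + 1), (j.choose l : R) * f.coeff j * r ^ (j - l) := by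
  rw [taylor_coeff, hasseDeriv_apply, sum_over_range]
  · simp [eval_finsetSum]
  · simp

namespace GradedTranslation

variable {K : Type u} {S : Type v} {W : Type w} {p : ℕ} [Field K] [CommRing S] [Algebra K S]
  (G : GradedTranslation K S W p)

/-- Weighted homogeneity of weight `m` when the variable has weight `E`. -/
def Wt (E m : ℕ) (H : S[X]) : Prop :=
  ∀ l, H.coeff l ≠ 0 → l * E ≤ m ∧ G.comp (m - l * E) (H.coeff l) = H.coeff l

/-- The weighted homogeneous component of weight `m` when the variable has weight `E`. -/
noncomputable def wcomp (E m : ℕ) (F : S[X]) : S[X] :=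
  ∑ l ∈ Finset.range (F.natDegree + 1),
    if l * E ≤ m then monomial l (G.comp (m - l * E) (F.coeff l)) else 0

theorem coeff_wcomp (E m : ℕ) (F : S[X]) (l : ℕ) :
    (G.wcomp E m F).coeff l = if l * E ≤ m then G.comp (m - l * E) (F.coeff l) else 0 := by
  rw [wcomp, finsetSum_coeff]
  have : ∀ k, (if k * E ≤ m then monomial k (G.comp (m - k * E) (F.coeff k)) else 0).coeff l =
      if k = l then (if l * E ≤ m then G.comp (m - l * E) (F.coeff l) else 0) else 0 := by
    intro k
    by_cases hk : k = l
    · subst hk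
      rw [if_pos rfl]
      split_ifs
      · rw [coeff_monomial, if_pos rfl]
      · simp
    · rw [if_neg hk]
      split_ifs
      · rw [coeff_monomial, if_neg hk]
      · simp
  simp only [this, Finset.sum_ite_eq', Finset.mem_range]
  by_cases hl : l < F.natDegree + 1
  · rw [if_pos hl]
  · rw [if_neg hl, coeff_eq_zero_of_natDegree_lt (by omega)]
    simp

theorem wt_wcomp (E m : ℕ) (F : S[X]) : G.Wt E m (G.wcomp E m F) := by
  intro l hl
  rw [coeff_wcomp] at hl ⊢
  by_cases h : l * E ≤ m
  · rw [if_pos h]; exact ⟨h, G.hom_comp _ _⟩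
  · rw [if_neg h] at hl; exact absurd rfl hl

theorem eval_wcomp {E : ℕ} {z : S} (hz : G.comp E z = z) (m : ℕ) (F : S[X]) :
    (G.wcomp E m F).eval z = G.comp m (F.eval z) := by
  rw [wcomp, eval_finsetSum, eval_eq_sum_range, map_sum]
  refine Finset.sum_congr rfl fun l _ => ?_
  rw [mul_comm (F.coeff l)]
  by_cases h : l * E ≤ m
  · rw [if_pos h, eval_monomial, mul_comm]
    conv_rhs => rw [← Nat.add_sub_cancel' h]
    rw [G.comp_hom_mul (G.hom_pow hz l)]
  · rw [if_neg h, eval_zero, G.comp_hom_mul_lt (G.hom_pow hz l) (by omega)]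

theorem exists_wcomp_ne_zero (E : ℕ) {F : S[X]} (hF : F ≠ 0) : ∃ m, G.wcomp E m F ≠ 0 := by
  by_contra! h
  refine hF (Polynomial.ext fun l => ?_)
  rw [coeff_zero]
  refine G.eq_of_comp fun n => ?_
  have := congrArg (fun q => q.coeff l) (h (n + l * E))
  simp only [coeff_wcomp, coeff_zero] at this
  rw [if_pos (by omega)] at this
  simpa using this

/-- The closure properties of the subalgebra generated by the variables found so far. -/
structure Stable (A : Subalgebra K S) (e : ℕ) : Prop where
  comp_mem : ∀ n, ∀ f ∈ A, G.comp n f ∈ A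
  τ_mem : ∀ w, ∀ f ∈ A, G.τ w f ∈ A
  D_mem : ∀ w, ∀ f ∈ A, G.D w f ∈ A
  mem_of_lt : ∀ n < e, ∀ f, G.comp n f = f → f ∈ A
  root_mem : ∀ u, u ^ p ∈ A → u ∈ A

variable {G} in
theorem Stable.τ_sub_mem {A : Subalgebra K S} {e : ℕ} (hA : G.Stable A e) {y : S}
    (hy : G.comp e y = y) (w : W) : G.Lt e (G.τ w y - y) ∧ G.τ w y - y ∈ A := by
  have h : G.Lt e (G.τ w y - y) := by
    intro k hk
    rw [map_sub]
    rcases hk.eq_or_lt with rfl | hk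
    · rw [G.comp_τ w _ y hy, hy, sub_self]
    · rw [G.comp_τ_gt w e k y hy hk, G.comp_of_hom hy hk.ne', sub_self]
  refine ⟨h, ?_⟩
  rw [← G.sum_comp _ e h]
  exact sum_mem fun i hi => hA.mem_of_lt i (Finset.mem_range.1 hi) _ (G.hom_comp _ _)

variable {G} in
theorem Stable.root_mem_iter {A : Subalgebra K S} {e : ℕ} (hA : G.Stable A e) (k : ℕ) {u : S}
    (h : u ^ p ^ k ∈ A) : u ∈ A := by
  induction k with
  | zero => simpa using h
  | succ k ih =>
    rw [pow_succ, pow_mul] at h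
    exact ih (hA.root_mem _ h)

theorem lt_coeff_taylor {e q m : ℕ} {a : S} (ha : G.Lt e a) (he : e ≠ 0) (hq : q ≠ 0)
    {H : S[X]} (hH : G.Wt (q * e) m H) (w : W) (l : ℕ) :
    (m < l * (q * e) → (taylor (a ^ q) (H.map (G.τ w : S →+* S)) - H).coeff l = 0) ∧
    G.Lt (m - l * (q * e)) ((taylor (a ^ q) (H.map (G.τ w : S →+* S)) - H).coeff l) := by
  have hz : ∀ j, m < j * (q * e) → H.coeff j = 0 := fun j hj => by
    by_contra h
    exact absurd (hH j h).1 (by omega)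
  rw [coeff_sub, taylor_coeff_eq_sum]
  by_cases hl : m < l * (q * e)
  · have : ∑ j ∈ Finset.range ((H.map (G.τ w : S →+* S)).natDegree + 1),
        (j.choose l : S) * (H.map (G.τ w : S →+* S)).coeff j * (a ^ q) ^ (j - l) - H.coeff l
        = 0 := by
      rw [hz l hl, sub_zero]
      refine Finset.sum_eq_zero fun j _ => ?_
      rcases lt_or_ge j l with h | h
      · rw [Nat.choose_eq_zero_of_lt h]; simp
      · rw [coeff_map, hz j (hl.trans_le (Nat.mul_le_mul_right _ h))]; simp
    rw [this]
    exact ⟨fun _ => rfl, Lt.zero G _⟩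
  refine ⟨fun h => absurd h hl, ?_⟩
  set n := (H.map (G.τ w : S →+* S)).natDegree + 1
  have hsplit : ∑ j ∈ Finset.range n,
        (j.choose l : S) * (H.map (G.τ w : S →+* S)).coeff j * (a ^ q) ^ (j - l) - H.coeff l
      = ∑ j ∈ Finset.range n, (if j = l then 0 else
        (j.choose l : S) * (H.map (G.τ w : S →+* S)).coeff j * (a ^ q) ^ (j - l))
        + (G.τ w (H.coeff l) - H.coeff l) := by
    have : ∀ j ∈ Finset.range n,
        (j.choose l : S) * (H.map (G.τ w : S →+* S)).coeff j * (a ^ q) ^ (j - l) =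
        (if j = l then 0 else
        (j.choose l : S) * (H.map (G.τ w : S →+* S)).coeff j * (a ^ q) ^ (j - l)) +
        (if j = l then G.τ w (H.coeff l) else 0) := by
      intro j _
      by_cases h : j = l
      · subst h; simp
      · simp [h]
    rw [Finset.sum_congr rfl this, Finset.sum_add_distrib, Finset.sum_ite_eq']
    by_cases hn : l ∈ Finset.range n
    · rw [if_pos hn]; ring
    · rw [if_neg hn]
      have : G.τ w (H.coeff l) = 0 := by
        have := coeff_eq_zero_of_natDegree_lt (p := H.map (G.τ w : S →+* S)) (n := l)
          (by rw [Finset.mem_range] at hn; omega)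
        rwa [coeff_map] at this
      rw [this]; ring
  rw [hsplit]
  refine Lt.add G (Lt.sum G _ fun j _ => ?_) ?_
  · by_cases hjl : j = l
    · rw [if_pos hjl]; exact Lt.zero G _
    rw [if_neg hjl, coeff_map]
    rcases lt_or_ge j l with h | h
    · rw [Nat.choose_eq_zero_of_lt h]; simpa using Lt.zero G _
    by_cases hc : H.coeff j = 0
    · rw [hc]; simpa using Lt.zero G _
    obtain ⟨h1, h2⟩ := hH j hc
    have h3 : G.Lt (m - j * (q * e) + 1) (G.τ w (H.coeff j)) := fun k hk =>
      G.comp_τ_gt w _ k _ h2 (by omega)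
    have h4 : G.Lt ((e - 1) * (q * (j - l)) + 1) (a ^ (q * (j - l))) :=
      Lt.pow G (by rwa [Nat.sub_add_cancel (Nat.pos_of_ne_zero he)]) _
    have h5 := (h3.mul G h4)
    have h6 : (j.choose l : S) * (G.τ w : S →+* S) (H.coeff j) * (a ^ q) ^ (j - l) =
        (j.choose l) • (G.τ w (H.coeff j) * a ^ (q * (j - l))) := by
      rw [nsmul_eq_mul, pow_mul, mul_assoc]; rfl
    rw [h6]
    intro k hk
    rw [map_nsmul, h5 k, smul_zero]
    refine le_trans ?_ hk
    have hd : 1 ≤ q * (j - l) := Nat.mul_pos (Nat.pos_of_ne_zero hq) (by omega)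
    obtain ⟨e', rfl⟩ := Nat.exists_eq_succ_of_ne_zero he
    obtain ⟨d, rfl⟩ := Nat.exists_eq_add_of_le h
    simp only [Nat.add_sub_cancel_left, Nat.succ_eq_add_one, Nat.add_sub_cancel] at *
    have : (l + d) * (q * (e' + 1)) = l * (q * (e' + 1)) + (e' * (q * d) + q * d) := by ring
    omega
  · by_cases hc : H.coeff l = 0
    · rw [hc, map_zero, sub_zero]; exact Lt.zero G _
    obtain ⟨h1, h2⟩ := hH l hc
    intro k hk
    rw [map_sub]
    rcases hk.eq_or_lt with rfl | hk
    · rw [G.comp_τ w _ _ h2, h2, sub_self]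
    · rw [G.comp_τ_gt w _ k _ h2 hk, G.comp_of_hom h2 hk.ne', sub_self]

variable {G} in
theorem Stable.eval_ne_zero [IsDomain S] [ExpChar S p] {A : Subalgebra K S} {e : ℕ} (he : e ≠ 0)
    (hA : G.Stable A e) {y : S} (hy : G.comp e y = y) (hyA : y ∉ A) (m : ℕ) :
    ∀ (d k : ℕ) (H : S[X]), H.natDegree ≤ d → H ≠ 0 → (∀ l, H.coeff l ∈ A) →
      G.Wt (p ^ k * e) m H → H.eval (y ^ p ^ k) ≠ 0 := by
  have hp : 0 < p := expChar_pos S p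
  induction m using Nat.strong_induction_on with
  | _ m ihm =>
  intro d
  induction d using Nat.strong_induction_on with
  | _ d ihd =>
  intro k H hHd hH0 hHA hHw hev
  set q := p ^ k with hq
  have hq0 : q ≠ 0 := (pow_pos hp k).ne'
  set z := y ^ q with hz
  have hzhom : G.comp (q * e) z = z := G.hom_pow hy q
  have hdeg0 : H.natDegree ≠ 0 := by
    intro h
    rw [eq_C_of_natDegree_eq_zero h, eval_C] at hev
    rw [eq_C_of_natDegree_eq_zero h, hev, C_0] at hH0
    exact hH0 rfl
  have hH' : derivative H ≠ 0 := by
    intro hder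
    rcases ‹ExpChar S p› with _ | hprime
    · exact hdeg0 (derivative_eq_zero.1 hder)
    · rename_i hchar
      have hpp : p ≠ 0 := hp.ne'
      have hexp := expand_contract p hder hpp
      have hdeg : (contract p H).natDegree * p = H.natDegree := by
        rw [← natDegree_expand, hexp]
      have h1 : (contract p H).natDegree < d := by
        have : 2 ≤ p := hprime.two_le
        have : 0 < (contract p H).natDegree := Nat.pos_of_ne_zero fun h => hdeg0 (by
          rw [← hdeg, h, zero_mul])
        nlinarith
      refine ihd _ h1 (k + 1) (contract p H) le_rfl ?_ ?_ ?_ ?_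
      · intro h; rw [← hexp, h] at hH0; simp at hH0
      · intro l; rw [coeff_contract hpp]; exact hHA _
      · intro l hl
        rw [coeff_contract hpp] at hl ⊢
        have := hHw _ hl
        rwa [show l * p * (p ^ k * e) = l * (p ^ (k + 1) * e) by ring] at this
      · rw [← hexp, expand_eval] at hev
        rwa [pow_succ, pow_mul]
  have hG : ∀ w, taylor ((G.τ w y - y) ^ q) (H.map (G.τ w : S →+* S)) = H := by
    intro w
    obtain ⟨ha1, ha2⟩ := hA.τ_sub_mem hy w
    rw [← sub_eq_zero]
    set F := taylor ((G.τ w y - y) ^ q) (H.map (G.τ w : S →+* S)) - H with hF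
    by_contra hF0
    have hcoef := G.lt_coeff_taylor ha1 he hq0 hHw w
    rw [← hF] at hcoef
    have hevF : F.eval z = 0 := by
      rw [hF, eval_sub, hev, sub_zero, taylor_eval]
      have : z + (G.τ w y - y) ^ q = G.τ w z := by
        rw [hz, hq, ← add_pow_expChar_pow, map_pow]; congr 1; ring
      rw [this]
      change eval ((G.τ w : S →+* S) z) _ = 0
      rw [eval_map, eval₂_hom, hev, map_zero]
    obtain ⟨m', hm'⟩ := G.exists_wcomp_ne_zero (q * e) hF0
    rcases lt_or_ge m' m with hlt | hge
    · refine ihm m' hlt _ k (G.wcomp (q * e) m' F) le_rfl hm' ?_ (G.wt_wcomp _ _ _) ?_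
      · intro l
        rw [coeff_wcomp]
        split_ifs
        · refine hA.comp_mem _ _ ?_
          rw [hF, coeff_sub, taylor_coeff_eq_sum]
          refine sub_mem (sum_mem fun j _ => mul_mem (mul_mem (natCast_mem _ _) ?_) ?_) (hHA l)
          · rw [coeff_map]; exact hA.τ_mem w _ (hHA j)
          · exact pow_mem (pow_mem ha2 _) _
        · exact zero_mem _
      · rw [← hq, ← hz, G.eval_wcomp hzhom, hevF, map_zero]
    · refine hm' (Polynomial.ext fun l => ?_)
      rw [coeff_wcomp, coeff_zero]
      split_ifs with h
      · exact (hcoef l).2 _ (by omega)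
      · rfl
  have hwt' : ∀ l, (derivative H).coeff l ≠ 0 → (l + 1) * (q * e) ≤ m ∧
      G.comp (m - (l + 1) * (q * e)) ((derivative H).coeff l) = (derivative H).coeff l := by
    intro l hl
    rw [coeff_derivative] at hl ⊢
    obtain ⟨h1, h2⟩ := hHw (l + 1) (left_ne_zero_of_mul hl)
    refine ⟨h1, ?_⟩
    have : H.coeff (l + 1) * ((l : S) + 1) = (l + 1) • H.coeff (l + 1) := by
      rw [nsmul_eq_mul, mul_comm]; push_cast; rfl
    rw [this, map_nsmul, h2]
  have hqe : 0 < q * e := Nat.mul_pos (Nat.pos_of_ne_zero hq0) (Nat.pos_of_ne_zero he)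
  have hm : q * e ≤ m := by
    obtain ⟨l, hl⟩ : ∃ l, (derivative H).coeff l ≠ 0 := by
      by_contra! h; exact hH' (Polynomial.ext fun l => by simp [h l])
    have := (hwt' l hl).1
    nlinarith
  have hW' : G.Wt (q * e) (m - q * e) (derivative H) := by
    intro l hl
    obtain ⟨h1, h2⟩ := hwt' l hl
    have h3 : (l + 1) * (q * e) = l * (q * e) + q * e := by ring
    rw [h3] at h1 h2
    refine ⟨by omega, ?_⟩
    rwa [show m - q * e - l * (q * e) = m - (l * (q * e) + q * e) by omega]
  have hderA : ∀ l, (derivative H).coeff l ∈ A := by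
    intro l
    rw [coeff_derivative]
    exact mul_mem (hHA _) (add_mem (natCast_mem _ _) (one_mem _))
  have hne : (derivative H).eval z ≠ 0 :=
    ihm (m - q * e) (by omega) _ k _ le_rfl hH' hderA hW'
  have hhom : G.comp (m - q * e) ((derivative H).eval z) = (derivative H).eval z := by
    rw [← G.eval_wcomp hzhom]
    congr 1
    ext l
    rw [coeff_wcomp]
    by_cases hl : (derivative H).coeff l = 0
    · simp [hl]
    · rw [if_pos (hW' l hl).1, (hW' l hl).2]
  have hinv : ∀ w, G.τ w ((derivative H).eval z) = (derivative H).eval z := by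
    intro w
    have h1 : G.τ w ((derivative H).eval z) =
        ((derivative H).map (G.τ w : S →+* S)).eval (G.τ w z) := by
      change _ = eval ((G.τ w : S →+* S) z) _
      rw [eval_map, eval₂_hom]; rfl
    have h2 : G.τ w z = z + (G.τ w y - y) ^ q := by
      rw [hz, hq, ← add_pow_expChar_pow, map_pow]; congr 1; ring
    conv_rhs => rw [← hG w]
    rw [h1, h2, ← taylor_eval, ← derivative_map]
    congr 1
    simp only [taylor_apply, derivative_comp]
    rw [derivative_add, derivative_X, derivative_C, add_zero, one_mul]
  have hm0 : m - q * e = 0 := by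
    by_contra h
    exact hne (G.eq_zero_of_τ _ _ hhom h hinv)
  have hmq : m = q * e := by omega
  have hcoef : ∀ l, 2 ≤ l → H.coeff l = 0 := by
    intro l hl
    by_contra h
    have := (hHw l h).1
    rw [hmq] at this
    nlinarith
  have hdeg : H.natDegree ≤ 1 := natDegree_le_iff_coeff_eq_zero.2 fun l hl => hcoef l hl
  rw [eq_X_add_C_of_natDegree_le_one hdeg] at hev
  simp only [eval_add, eval_mul, eval_C, eval_X] at hev
  have hc1 : H.coeff 1 ≠ 0 := by
    intro h
    exact hdeg0 (by
      refine Nat.le_zero.1 (natDegree_le_iff_coeff_eq_zero.2 fun l hl => ?_)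
      rcases Nat.lt_or_ge l 2 with h2 | h2
      · obtain rfl : l = 1 := by omega
        exact h
      · exact hcoef l h2)
  have h1 := (hHw 1 hc1).2
  rw [hmq, one_mul, Nat.sub_self] at h1
  obtain ⟨c, hc⟩ := G.hom_zero _ h1
  have hc0 : c ≠ 0 := by rintro rfl; rw [map_zero] at hc; exact hc1 hc.symm
  have hzA : z = -(algebraMap K S c⁻¹ * H.coeff 0) := by
    have h2 : algebraMap K S c⁻¹ * H.coeff 1 = 1 := by
      rw [← hc, ← map_mul, inv_mul_cancel₀ hc0, map_one]
    linear_combination (algebraMap K S c⁻¹) * hev - z * h2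
  refine hyA (hA.root_mem_iter k (u := y) ?_)
  rw [← hq, ← hz, hzA]
  exact neg_mem (mul_mem (A.algebraMap_mem _) (hHA 0))

variable {G} in
theorem Stable.eq_zero_of_eval [IsDomain S] [ExpChar S p] {A : Subalgebra K S} {e : ℕ}
    (he : e ≠ 0) (hA : G.Stable A e) {y : S} (hy : G.comp e y = y) (hyA : y ∉ A) (F : S[X])
    (hF : ∀ l, F.coeff l ∈ A) (hev : F.eval y = 0) : F = 0 := by
  by_contra h
  obtain ⟨m, hm⟩ := G.exists_wcomp_ne_zero e h
  refine hA.eval_ne_zero he hy hyA m _ 0 _ le_rfl hm ?_ ?_ ?_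
  · intro l
    rw [coeff_wcomp]
    split_ifs
    · exact hA.comp_mem _ _ (hF l)
    · exact zero_mem _
  · rw [pow_zero, one_mul]; exact G.wt_wcomp _ _ _
  · rw [pow_zero, pow_one, G.eval_wcomp hy, hev, map_zero]

end GradedTranslation

end

section

open Polynomial

namespace GradedTranslation

variable {K : Type u} {S : Type v} {W : Type w} {p : ℕ} [Field K] [CommRing S] [Algebra K S]
  (G : GradedTranslation K S W p)

theorem comp_mul_pow_char [IsDomain S] [ExpChar S p] (k : ℕ) (f : S) :
    G.comp (p * k) (f ^ p) = G.comp k f ^ p := by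
  have hp : 0 < p := expChar_pos S p
  obtain ⟨N, hN⟩ := G.exists_bound f
  rw [G.pow_eq_sum f N hN, map_sum]
  have h : ∀ m, G.comp (p * k) (G.comp m f ^ p) = if m = k then G.comp m f ^ p else 0 := by
    intro m
    rw [← G.hom_pow (G.hom_comp m f), G.comp_comp]
    by_cases hk : m = k
    · simp [hk]
    · rw [if_neg (fun h => hk (Nat.eq_of_mul_eq_mul_left hp h).symm), if_neg hk]
  simp only [h, Finset.sum_ite_eq', Finset.mem_range]
  split_ifs with h1
  · rfl
  · rw [hN k (by omega), zero_pow hp.ne']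

theorem D_eval (w : W) (y : S) (F : S[X]) :
    ∃ F' : S[X], (∀ l, F'.coeff l = G.D w (F.coeff l)) ∧
      G.D w (F.eval y) = F'.eval y + (derivative F).eval y * G.D w y := by
  induction F using Polynomial.induction_on' with
  | add f g hf hg =>
    obtain ⟨f', h1, h2⟩ := hf
    obtain ⟨g', h3, h4⟩ := hg
    refine ⟨f' + g', fun l => by simp [h1, h3], ?_⟩
    simp only [eval_add, map_add, h2, h4]
    ring
  | monomial n a =>
    refine ⟨monomial n (G.D w a), fun l => ?_, ?_⟩
    · rw [coeff_monomial, coeff_monomial]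
      split_ifs <;> simp
    · simp only [eval_monomial, derivative_monomial, Derivation.leibniz, Derivation.leibniz_pow,
        smul_eq_mul, nsmul_eq_mul]
      ring

section
variable {G} [IsDomain S] [ExpChar S p] {A : Subalgebra K S} {e : ℕ}

theorem Stable.ne_pow_of_hom (hp : p.Prime) (he : e ≠ 0) (hA : G.Stable A e)
    {y : S} (hy : G.comp e y = y) (hyA : y ∉ A) (β : ℕ) :
    ∀ b c s, G.comp β b = b → b ≠ 0 → b ∈ A → c ∈ A → b ^ p * y + c ≠ s ^ p := by
  induction β using Nat.strong_induction_on with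
  | _ β ih =>
  intro b c s hb hb0 hbA hcA hs
  have hlow : ∀ w, ∀ r < β, G.comp r (G.τ w b) = 0 := by
    intro w r hr
    by_contra hne
    set a := G.τ w y - y
    have ha := (hA.τ_sub_mem hy w).2
    have h1 : G.τ w b ^ p * y + (G.τ w b ^ p * a + G.τ w c) = G.τ w s ^ p := by
      rw [← map_pow _ s, ← hs, map_add, map_mul, map_pow]; ring
    have hbw : G.τ w b ∈ A := hA.τ_mem w b hbA
    obtain ⟨s', hs', -⟩ := G.comp_pow_char (e + p * r) (G.τ w s)
    refine ih r hr _ (G.comp (e + p * r) (G.τ w b ^ p * a + G.τ w c)) s' (G.hom_comp r _) hne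
      (hA.comp_mem _ _ hbw) (hA.comp_mem _ _ (add_mem (mul_mem (pow_mem hbw _) ha)
        (hA.τ_mem w c hcA))) ?_
    rw [← hs', ← h1, map_add _ (G.τ w b ^ p * y), mul_comm _ y, mul_comm _ y, G.comp_hom_mul hy,
      G.comp_mul_pow_char]
  have hinv : ∀ w, G.τ w b = b := by
    intro w
    refine G.eq_of_comp fun n => ?_
    rcases lt_trichotomy n β with h | h | h
    · rw [hlow w n h, G.comp_of_hom hb h.ne]
    · rw [h, G.comp_τ w _ _ hb, hb]
    · rw [G.comp_τ_gt w _ _ _ hb h, G.comp_of_hom hb h.ne']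
  have hβ : β = 0 := by
    by_contra h
    exact hb0 (G.eq_zero_of_τ β b hb h hinv)
  subst hβ
  obtain ⟨k, rfl⟩ := G.hom_zero b hb
  have hk : k ≠ 0 := by rintro rfl; simp at hb0
  obtain ⟨s', hs', j, hj, hj'⟩ := G.comp_pow_char e s
  have hs'A : s' ∈ A := by
    refine hA.mem_of_lt j ?_ _ hj'
    have := hp.two_le
    have : 0 < e := Nat.pos_of_ne_zero he
    nlinarith
  have h2 := congrArg (G.comp e) hs
  have h3 : (algebraMap K S k) ^ p * y = (k ^ p) • y := by
    rw [Algebra.smul_def, map_pow]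
  rw [hs', map_add, h3, map_smul, hy] at h2
  have h4 : y = (k ^ p)⁻¹ • (s' ^ p - G.comp e c) := by
    rw [← h2, add_sub_cancel_right, smul_smul, inv_mul_cancel₀ (pow_ne_zero _ hk), one_smul]
  apply hyA
  rw [h4]
  exact A.smul_mem (sub_mem (pow_mem hs'A _) (hA.comp_mem _ _ hcA)) _

theorem Stable.ne_pow (hp : p.Prime) (he : e ≠ 0) (hA : G.Stable A e)
    {y : S} (hy : G.comp e y = y) (hyA : y ∉ A) {b c s : S} (hb0 : b ≠ 0) (hbA : b ∈ A)
    (hcA : c ∈ A) : b ^ p * y + c ≠ s ^ p := by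
  intro h
  obtain ⟨β, hβ⟩ : ∃ β, G.comp β b ≠ 0 := by
    by_contra! h0
    exact hb0 (G.eq_of_comp fun n => by rw [h0 n, map_zero])
  obtain ⟨s', hs', -⟩ := G.comp_pow_char (e + p * β) s
  refine hA.ne_pow_of_hom hp he hy hyA β (G.comp β b) (G.comp (e + p * β) c) s' (G.hom_comp _ _)
    hβ (hA.comp_mem _ _ hbA) (hA.comp_mem _ _ hcA) ?_
  rw [← hs', ← h, map_add, mul_comm _ y, mul_comm _ y, G.comp_hom_mul hy, G.comp_mul_pow_char]

theorem Stable.root_eval (hp : p.Prime) (he : e ≠ 0) (hA : G.Stable A e)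
    {y : S} (hy : G.comp e y = y) (hyA : y ∉ A) (d : ℕ) :
    ∀ (F : S[X]) (u : S), F.natDegree ≤ d → (∀ l, F.coeff l ∈ A) → u ^ p = F.eval y →
      ∃ F' : S[X], (∀ l, F'.coeff l ∈ A) ∧ u = F'.eval y := by
  have hchar : CharP S p := by
    rcases ‹ExpChar S p› with _ | _
    · exact absurd hp Nat.not_prime_one
    · assumption
  have hpS : (p : S) = 0 := CharP.cast_eq_zero S p
  have hDp : ∀ w (b : S), G.D w (b ^ p) = 0 := by
    intro w b
    rw [Derivation.leibniz_pow, nsmul_eq_mul, hpS, zero_mul]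
  have hDy : ∀ w, G.D w y ∈ A := by
    intro w
    obtain ⟨n, rfl⟩ := Nat.exists_eq_succ_of_ne_zero he
    exact hA.mem_of_lt n (Nat.lt_succ_self n) _ (G.hom_D w n y hy)
  induction d using Nat.strong_induction_on with
  | _ d ih =>
  intro F u hd hFA hu
  by_cases hN0 : F.natDegree = 0
  · rw [eq_C_of_natDegree_eq_zero hN0, eval_C] at hu
    refine ⟨C u, fun l => ?_, by simp⟩
    rw [coeff_C]
    split_ifs
    · exact hA.root_mem u (hu ▸ hFA 0)
    · exact zero_mem _
  have hrel : ∀ w l, G.D w (F.coeff l) + F.coeff (l + 1) * (l + 1) * G.D w y = 0 := by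
    intro w l
    obtain ⟨F', h1, h2⟩ := G.D_eval w y F
    have h3 : F' + derivative F * C (G.D w y) = 0 := by
      refine hA.eq_zero_of_eval he hy hyA _ ?_ ?_
      · intro l
        rw [coeff_add, coeff_mul_C, h1, coeff_derivative]
        exact add_mem (hA.D_mem w _ (hFA l)) (mul_mem (mul_mem (hFA _)
          (add_mem (natCast_mem _ _) (one_mem _))) (hDy w))
      · rw [eval_add, eval_mul, eval_C, ← h2, ← hu, hDp]
    have h4 := congrArg (fun q => q.coeff l) h3
    simpa only [coeff_add, coeff_mul_C, h1, coeff_derivative, coeff_zero] using h4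
  set N := F.natDegree with hN
  obtain ⟨b, hb⟩ := G.exists_pow (F.coeff N) fun w => by
    have := hrel w N
    rwa [coeff_eq_zero_of_natDegree_lt (by omega : F.natDegree < N + 1), zero_mul, zero_mul,
      add_zero] at this
  have hbA : b ∈ A := hA.root_mem b (hb ▸ hFA N)
  have hFN : F.coeff N ≠ 0 := by
    intro h
    have : F = 0 := leadingCoeff_eq_zero.1 h
    rw [this] at hN; simp at hN; exact hN0 hN
  have hb0 : b ≠ 0 := by
    rintro rfl; rw [zero_pow hp.ne_zero] at hb; exact hFN hb.symm
  by_cases hpN : p ∣ N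
  · obtain ⟨M, hM⟩ := hpN
    have h1 : (u - b * y ^ M) ^ p = F.eraseLead.eval y := by
      have h2 : F.eval y = F.eraseLead.eval y + b ^ p * (y ^ M) ^ p := by
        conv_lhs => rw [← F.eraseLead_add_monomial_natDegree_leadingCoeff]
        rw [eval_add, eval_monomial, leadingCoeff, ← hN, ← hb, hM, ← pow_mul y M p, mul_comm M p]
      rw [sub_pow_expChar, hu, mul_pow, h2]; ring
    have h3 : F.eraseLead.natDegree < d := by
      have := F.eraseLead_natDegree_le
      omega
    obtain ⟨F', hF', hF''⟩ := ih _ h3 F.eraseLead (u - b * y ^ M) le_rfl (fun l => by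
      rw [eraseLead_coeff]
      split_ifs
      · exact zero_mem _
      · exact hFA l) h1
    refine ⟨F' + monomial M b, fun l => ?_, ?_⟩
    · rw [coeff_add, coeff_monomial]
      refine add_mem (hF' l) ?_
      split_ifs
      · exact hbA
      · exact zero_mem _
    · rw [eval_add, eval_monomial, ← hF'']; ring
  · exfalso
    have hNS : (N : S) ^ p = N := by
      have := map_natCast (frobenius S p) N
      rwa [frobenius_def] at this
    have hN0' : (N : S) ≠ 0 := fun h => hpN ((CharP.cast_eq_zero_iff S p N).1 h)
    obtain ⟨s, hs⟩ := G.exists_pow (((N : S) * b) ^ p * y + F.coeff (N - 1)) fun w => by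
      have h1 := hrel w (N - 1)
      have h2 : N - 1 + 1 = N := by omega
      have h3 : ((N - 1 : ℕ) : S) + 1 = N := by
        rw [← Nat.cast_one (R := S), ← Nat.cast_add, h2]
      rw [h2, h3, ← hb] at h1
      rw [map_add, Derivation.leibniz, hDp, smul_zero, add_zero, mul_pow, hNS, smul_eq_mul]
      linear_combination h1
    exact hA.ne_pow hp he hy hyA (mul_ne_zero hN0' hb0) (mul_mem (natCast_mem _ _) hbA)
      (hFA (N - 1)) hs.symm

end

/-- Homogeneous algebraically independent sets generating everything in the degrees below those of
their members. -/
structure Good (B : Set S) : Prop where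
  hom : ∀ b ∈ B, ∃ e, e ≠ 0 ∧ G.comp e b = b ∧
    ∀ n < e, ∀ f, G.comp n f = f → f ∈ Algebra.adjoin K B
  indep : AlgebraicIndependent K (Subtype.val : B → S)
  root : ∀ u, u ^ p ∈ Algebra.adjoin K B → u ∈ Algebra.adjoin K B

variable {G}

theorem Good.comp_mem {B : Set S} (hB : G.Good B) {f : S} (hf : f ∈ Algebra.adjoin K B) :
    ∀ n, G.comp n f ∈ Algebra.adjoin K B := by
  induction hf using Algebra.adjoin_induction with
  | mem x hx =>
    intro n
    obtain ⟨e, -, h, -⟩ := hB.hom x hx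
    by_cases hn : n = e
    · rw [hn, h]; exact Algebra.subset_adjoin hx
    · rw [G.comp_of_hom h hn]; exact zero_mem _
  | algebraMap r =>
    intro n
    by_cases hn : n = 0
    · rw [hn, G.hom_algebraMap]; exact Subalgebra.algebraMap_mem _ r
    · rw [G.comp_of_hom (G.hom_algebraMap r) hn]; exact zero_mem _
  | add x y _ _ hx hy => intro n; rw [map_add]; exact add_mem (hx n) (hy n)
  | mul x y _ _ hx hy =>
    intro n
    obtain ⟨N, hN⟩ := G.exists_bound x
    rw [← G.sum_comp x N hN, Finset.sum_mul, map_sum]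
    refine sum_mem fun k _ => ?_
    rcases lt_or_ge n k with h | h
    · rw [G.comp_hom_mul_lt (G.hom_comp k x) h]; exact zero_mem _
    · rw [← Nat.add_sub_cancel' h, G.comp_hom_mul (G.hom_comp k x)]
      exact mul_mem (hx k) (hy _)

theorem Good.stable {B : Set S} (hB : G.Good B) (e : ℕ)
    (he : ∀ n < e, ∀ f, G.comp n f = f → f ∈ Algebra.adjoin K B) :
    G.Stable (Algebra.adjoin K B) e where
  comp_mem n f hf := hB.comp_mem hf n
  τ_mem w f hf := by
    induction hf using Algebra.adjoin_induction with
    | mem x hx =>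
      obtain ⟨e, he, h, h'⟩ := hB.hom x hx
      have h1 : G.Lt (e + 1) (G.τ w x) := fun k hk => G.comp_τ_gt w e k x h (by omega)
      rw [← G.sum_comp _ _ h1, Finset.sum_range_succ, G.comp_τ w e x h]
      exact add_mem (sum_mem fun i hi => h' i (Finset.mem_range.1 hi) _ (G.hom_comp _ _))
        (Algebra.subset_adjoin hx)
    | algebraMap r => rw [AlgHom.commutes]; exact Subalgebra.algebraMap_mem _ r
    | add x y _ _ hx hy => rw [map_add]; exact add_mem hx hy
    | mul x y _ _ hx hy => rw [map_mul]; exact mul_mem hx hy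
  D_mem w f hf := by
    induction hf using Algebra.adjoin_induction with
    | mem x hx =>
      obtain ⟨e, he, h, h'⟩ := hB.hom x hx
      obtain ⟨n, rfl⟩ := Nat.exists_eq_succ_of_ne_zero he
      exact h' n (Nat.lt_succ_self n) _ (G.hom_D w n x h)
    | algebraMap r => rw [Derivation.map_algebraMap]; exact zero_mem _
    | add x y _ _ hx hy => rw [map_add]; exact add_mem hx hy
    | mul x y hx' hy' hx hy =>
      rw [Derivation.leibniz]
      exact add_mem (mul_mem hx' hy) (mul_mem hy' hx)
  mem_of_lt := he
  root_mem := hB.root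

theorem mem_adjoin_insert_iff {B : Set S} {y z : S} :
    z ∈ Algebra.adjoin K (insert y B) ↔
      ∃ F : S[X], (∀ l, F.coeff l ∈ Algebra.adjoin K B) ∧ z = F.eval y := by
  constructor
  · intro hz
    induction hz using Algebra.adjoin_induction with
    | mem x hx =>
      rcases hx with rfl | hx
      · refine ⟨X, fun l => ?_, by simp⟩
        rw [coeff_X]
        split_ifs
        · exact one_mem _
        · exact zero_mem _
      · refine ⟨C x, fun l => ?_, by simp⟩
        rw [coeff_C]
        split_ifs
        · exact Algebra.subset_adjoin hx
        · exact zero_mem _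
    | algebraMap r =>
      refine ⟨C (algebraMap K S r), fun l => ?_, by simp⟩
      rw [coeff_C]
      split_ifs
      · exact Subalgebra.algebraMap_mem _ r
      · exact zero_mem _
    | add x y _ _ hx hy =>
      obtain ⟨F, h1, rfl⟩ := hx
      obtain ⟨F', h2, rfl⟩ := hy
      exact ⟨F + F', fun l => by rw [coeff_add]; exact add_mem (h1 l) (h2 l), by simp⟩
    | mul x y _ _ hx hy =>
      obtain ⟨F, h1, rfl⟩ := hx
      obtain ⟨F', h2, rfl⟩ := hy
      refine ⟨F * F', fun l => ?_, by simp⟩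
      rw [coeff_mul]
      exact sum_mem fun _ _ => mul_mem (h1 _) (h2 _)
  · rintro ⟨F, h, rfl⟩
    rw [eval_eq_sum_range]
    exact sum_mem fun l _ => mul_mem (Algebra.adjoin_mono (Set.subset_insert _ _) (h l))
      (pow_mem (Algebra.subset_adjoin (Set.mem_insert _ _)) _)

theorem Good.insert [IsDomain S] [ExpChar S p] {B : Set S} (hB : G.Good B) {e : ℕ} (he : e ≠ 0)
    (hlt : ∀ n < e, ∀ f, G.comp n f = f → f ∈ Algebra.adjoin K B) {y : S}
    (hy : G.comp e y = y) (hyB : y ∉ Algebra.adjoin K B) : G.Good (insert y B) where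
  hom b hb := by
    have hmono := Algebra.adjoin_mono (R := K) (Set.subset_insert y B)
    rcases hb with rfl | hb
    · exact ⟨e, he, hy, fun n hn f hf => hmono (hlt n hn f hf)⟩
    · obtain ⟨e', h1, h2, h3⟩ := hB.hom b hb
      exact ⟨e', h1, h2, fun n hn f hf => hmono (h3 n hn f hf)⟩
  indep := by
    have hst := hB.stable e hlt
    refine AlgebraicIndepOn.insert (x := id) (s := B) hB.indep ?_
    rw [Set.image_id]
    intro halg
    obtain ⟨F, hF0, hF⟩ := halg
    have := hst.eq_zero_of_eval he hy hyB (F.map (algebraMap (Algebra.adjoin K B) S))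
      (fun l => by rw [coeff_map]; exact (F.coeff l).2) (by rwa [eval_map_algebraMap])
    rw [Polynomial.map_eq_zero_iff Subtype.val_injective] at this
    exact hF0 this
  root u hu := by
    rcases em p.Prime with hp | hp
    · rw [mem_adjoin_insert_iff] at hu ⊢
      obtain ⟨F, h1, h2⟩ := hu
      exact (hB.stable e hlt).root_eval hp he hy hyB _ F u le_rfl h1 h2
    · have : p = 1 := by
        rcases ‹ExpChar S p› with _ | h
        · rfl
        · exact absurd h hp
      subst this
      simpa using hu

variable (G) in
theorem exists_good [IsDomain S] [ExpChar S p] [IsAlgClosed K] :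
    ∃ B : Set S, G.Good B ∧ Algebra.adjoin K B = ⊤ := by
  have hinj : Function.Injective (algebraMap K S) := (algebraMap K S).injective
  have hp : 0 < p := expChar_pos S p
  have hempty : G.Good ∅ := by
    refine ⟨fun b hb => absurd hb (Set.notMem_empty b), ?_, ?_⟩
    · exact algebraicIndependent_empty_type_iff.2 hinj
    · intro u hu
      rw [Algebra.adjoin_empty, Algebra.mem_bot] at hu ⊢
      obtain ⟨c, hc⟩ := hu
      obtain ⟨c', rfl⟩ := IsAlgClosed.exists_pow_nat_eq c hp
      refine ⟨c', ?_⟩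
      rw [map_pow] at hc
      exact frobenius_inj S p hc
  obtain ⟨B, -, hBmax⟩ := zorn_subset_nonempty {B : Set S | G.Good B} (by
    intro c hc hchain hne
    have hmono : ∀ s ∈ c, Algebra.adjoin K s ≤ Algebra.adjoin K (⋃₀ c) := fun s hs =>
      Algebra.adjoin_mono (Set.subset_sUnion_of_mem hs)
    refine ⟨⋃₀ c, ⟨?_, ?_, ?_⟩, fun s hs => Set.subset_sUnion_of_mem hs⟩
    · rintro b ⟨s, hs, hb⟩
      obtain ⟨e, h1, h2, h3⟩ := (hc hs).hom b hb
      exact ⟨e, h1, h2, fun n hn f hf => hmono s hs (h3 n hn f hf)⟩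
    · exact algebraicIndependent_sUnion_of_directed hne hchain.directedOn
        fun s hs => (hc hs).indep
    · intro u hu
      have hdir : ∀ z ∈ Algebra.adjoin K (⋃₀ c), ∃ s ∈ c, z ∈ Algebra.adjoin K s := by
        intro z hz
        have hup : ∀ s ∈ c, ∀ t ∈ c, ∃ r ∈ c, s ⊆ r ∧ t ⊆ r := fun s hs t ht =>
          hchain.directedOn s hs t ht
        induction hz using Algebra.adjoin_induction with
        | mem x hx =>
          obtain ⟨s, hs, hx⟩ := hx
          exact ⟨s, hs, Algebra.subset_adjoin hx⟩
        | algebraMap r =>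
          obtain ⟨s, hs⟩ := hne
          exact ⟨s, hs, Subalgebra.algebraMap_mem _ r⟩
        | add x y _ _ hx hy =>
          obtain ⟨s, hs, hx⟩ := hx
          obtain ⟨t, ht, hy⟩ := hy
          obtain ⟨r, hr, h1, h2⟩ := hup s hs t ht
          exact ⟨r, hr, add_mem (Algebra.adjoin_mono h1 hx) (Algebra.adjoin_mono h2 hy)⟩
        | mul x y _ _ hx hy =>
          obtain ⟨s, hs, hx⟩ := hx
          obtain ⟨t, ht, hy⟩ := hy
          obtain ⟨r, hr, h1, h2⟩ := hup s hs t ht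
          exact ⟨r, hr, mul_mem (Algebra.adjoin_mono h1 hx) (Algebra.adjoin_mono h2 hy)⟩
      obtain ⟨s, hs, h⟩ := hdir _ hu
      exact hmono s hs ((hc hs).root u h)) ∅ hempty
  have hB : G.Good B := hBmax.prop
  refine ⟨B, hB, ?_⟩
  have key : ∀ n, ∀ f, G.comp n f = f → f ∈ Algebra.adjoin K B := by
    intro n
    induction n using Nat.strong_induction_on with
    | _ n ih =>
    intro f hf
    by_contra hfB
    have hn : n ≠ 0 := by
      rintro rfl
      obtain ⟨c, rfl⟩ := G.hom_zero f hf
      exact hfB (Subalgebra.algebraMap_mem _ c)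
    have h1 := hBmax.le_of_ge (hB.insert hn ih hf hfB) (Set.subset_insert _ _)
    exact hfB (Algebra.subset_adjoin (h1 (Set.mem_insert _ _)))
  refine eq_top_iff.2 fun f _ => ?_
  obtain ⟨N, hN⟩ := G.exists_bound f
  rw [← G.sum_comp f N hN]
  exact sum_mem fun i _ => key i _ (G.hom_comp _ _)

end GradedTranslation

end

section

namespace RingHom

theorem flat_iff_forall_trivial {A : Type u} {B : Type v} [CommRing A] [CommRing B] (φ : A →+* B) :
    φ.Flat ↔ ∀ (l : ℕ) (a : Fin l → A) (f : Fin l → B), ∑ i, φ (a i) * f i = 0 →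
      ∃ (k : ℕ) (c : Fin l → Fin k → A) (z : Fin k → B),
        (∀ i, f i = ∑ j, φ (c i j) * z j) ∧ ∀ j, ∑ i, a i * c i j = 0 := by
  let _ := φ.toAlgebra
  rw [RingHom.Flat]
  constructor
  · intro h l a f haf
    obtain ⟨k, c, z, h1, h2⟩ :=
      Module.Flat.isTrivialRelation_of_sum_smul_eq_zero (R := A) (M := B) (f := a) (x := f)
        (by simpa [Algebra.smul_def, RingHom.algebraMap_toAlgebra] using haf)
    exact ⟨k, c, z,
      fun i => by simpa [Algebra.smul_def, RingHom.algebraMap_toAlgebra] using h1 i, h2⟩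
  · intro h
    apply Module.Flat.of_forall_isTrivialRelation
    intro l a f haf
    obtain ⟨k, c, z, h1, h2⟩ := h l a f
      (by simpa [Algebra.smul_def, RingHom.algebraMap_toAlgebra] using haf)
    exact ⟨k, c, z,
      fun i => by simpa [Algebra.smul_def, RingHom.algebraMap_toAlgebra] using h1 i, h2⟩

theorem Flat.exists_trivial {A : Type u} {B : Type v} [CommRing A] [CommRing B] {φ : A →+* B}
    (h : φ.Flat) {ι : Type*} [Fintype ι] (a : ι → A) (f : ι → B) (haf : ∑ i, φ (a i) * f i = 0) :
    ∃ (k : ℕ) (c : ι → Fin k → A) (z : Fin k → B),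
        (∀ i, f i = ∑ j, φ (c i j) * z j) ∧ ∀ j, ∑ i, a i * c i j = 0 := by
  classical
  let e := Fintype.equivFin ι
  obtain ⟨k, c, z, h1, h2⟩ := (flat_iff_forall_trivial φ).1 h _ (a ∘ e.symm) (f ∘ e.symm)
    (by rw [← haf]; exact Equiv.sum_comp e.symm (fun i => φ (a i) * f i))
  refine ⟨k, fun i => c (e i), z, fun i => by simpa using h1 (e i), fun j => ?_⟩
  rw [← h2 j, ← Equiv.sum_comp e]
  simp

/-- If `c0 * h` is a combination of the images of `u`, flatness expresses `h` through the colon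
ideal. -/
theorem Flat.exists_colon {A : Type u} {B : Type v} [CommRing A] [CommRing B] {φ : A →+* B}
    (hφ : φ.Flat) {ι : Type*} [Fintype ι] (c : A) (u : ι → A) (f : B) (z : ι → B)
    (h : φ c * f = ∑ i, φ (u i) * z i) :
    ∃ (k : ℕ) (a : Fin k → A) (w : Fin k → B),
      f = ∑ j, φ (a j) * w j ∧ ∀ j, c * a j ∈ Ideal.span (Set.range u) := by
  obtain ⟨k, C, w, h1, h2⟩ := hφ.exists_trivial (ι := Option ι) (fun o => o.elim c (fun i => - u i))
    (fun o => o.elim f z) (by simp [Fintype.sum_option, h])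
  refine ⟨k, C none, w, by simpa using h1 none, fun j => ?_⟩
  have := h2 j
  simp only [Fintype.sum_option, Option.elim, neg_mul, Finset.sum_neg_distrib] at this
  rw [add_neg_eq_zero.1 this]
  exact Ideal.sum_mem _ fun i _ => Ideal.mul_mem_right _ _ (Ideal.subset_span ⟨i, rfl⟩)

open Polynomial in
theorem _root_.Polynomial.Monic.mem_map_C_of_mul_mem {A : Type u} [CommRing A] (I : Ideal A)
    {χ p : A[X]} (hχ : χ.Monic) (h : χ * p ∈ I.map C) : p ∈ I.map C := by
  rw [Ideal.mem_map_C_iff] at h ⊢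
  have h1 : (χ * p).map (Ideal.Quotient.mk I) = 0 := by
    ext n
    rw [Polynomial.coeff_map, Polynomial.coeff_zero]
    exact Ideal.Quotient.eq_zero_iff_mem.2 (h n)
  rw [Polynomial.map_mul] at h1
  have h2 := ((hχ.map (Ideal.Quotient.mk I)).mul_right_eq_zero_iff).1 h1
  intro n
  have := congrArg (fun q => q.coeff n) h2
  simpa [Ideal.Quotient.eq_zero_iff_mem] using this

open Polynomial in
theorem Flat.quotient_of_monic {A : Type u} {B : Type v} {R : Type w} [CommRing A] [CommRing B]
    [CommRing R]
    {φ : A[X] →+* B} (hφ : φ.Flat) {χ : A[X]} (hχ : χ.Monic) {b c : B} (hbc : φ χ = b * c)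
    (π : B →+* R) (hπ : Function.Surjective π) (hker : RingHom.ker π = Ideal.span {b}) :
    ((π.comp φ).comp C).Flat := by
  rw [flat_iff_forall_trivial]
  intro l a f haf
  choose F hF using fun i => hπ (f i)
  have h1 : ∑ i, φ (C (a i)) * F i ∈ RingHom.ker π := by
    rw [RingHom.mem_ker, map_sum, ← haf]
    simp [hF]
  rw [hker, Ideal.mem_span_singleton'] at h1
  obtain ⟨h, hh⟩ := h1
  -- `χ h` is a combination of the `φ (C (a i))`.
  have h2 : φ χ * h = ∑ i, φ (C (a i)) * (c * F i) := by
    rw [hbc, mul_assoc, mul_comm b, mul_assoc, hh, Finset.mul_sum]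
    exact Finset.sum_congr rfl fun i _ => by ring
  obtain ⟨k, p, w, hw, hp⟩ := hφ.exists_colon χ (fun i => C (a i)) h _ h2
  have h3 : h ∈ Ideal.span (Set.range fun i => φ (C (a i))) := by
    rw [hw]
    refine Ideal.sum_mem _ fun j _ => Ideal.mul_mem_right _ _ ?_
    have h4 : p j ∈ (Ideal.span (Set.range a)).map C := by
      apply hχ.mem_map_C_of_mul_mem
      rw [Ideal.map_span, ← Set.range_comp]; exact hp j
    have := Ideal.mem_map_of_mem φ h4
    rwa [Ideal.map_span, Ideal.map_span, ← Set.range_comp, ← Set.range_comp] at this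
  obtain ⟨H, hH⟩ := (Ideal.mem_span_range_iff_exists_fun).1 h3
  have h5 : ∑ i, φ (C (a i)) * (F i - b * H i) = 0 := by
    simp only [mul_sub, Finset.sum_sub_distrib]
    rw [← hh, ← hH, sub_eq_zero, Finset.sum_mul]
    exact Finset.sum_congr rfl fun i _ => by ring
  have hC : (φ.comp C).Flat := by
    apply RingHom.Flat.comp _ hφ
    rw [← Polynomial.algebraMap_eq, RingHom.flat_algebraMap_iff]
    infer_instance
  obtain ⟨k', c', z', h6, h7⟩ := hC.exists_trivial a (fun i => F i - b * H i) h5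
  refine ⟨k', c', fun j => π (z' j), fun i => ?_, h7⟩
  have hb : π b = 0 := by
    have : b ∈ RingHom.ker π := by rw [hker]; exact Ideal.mem_span_singleton_self b
    exact this
  have := congrArg π (h6 i)
  simp [hF, hb] at this
  simpa using this

end RingHom

end

section

theorem exists_monic_relation {C : Type u} {R : Type v} [CommRing C] [Nontrivial C]
    [CommRing R] (ψ : C →+* R)
    {n : ℕ} (m : Fin n → R) (hm : ∀ f, ∃ c : Fin n → C, f = ∑ a, ψ (c a) * m a) (I : Ideal C)
    (F : R) (hF : F ∈ I.map ψ) :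
    ∃ a : ℕ → C, a n = 1 ∧ (∀ k < n, a k ∈ I) ∧
      ∑ k ∈ Finset.range (n + 1), ψ (a k) * F ^ k = 0 := by
  let _ := ψ.toAlgebra
  have hψ : algebraMap C R = ψ := rfl
  have htop : (⊤ : Submodule C R) = Submodule.span C (Set.range m) := by
    refine (eq_top_iff.2 fun f _ => ?_).symm
    obtain ⟨c, rfl⟩ := hm f
    refine Submodule.sum_mem _ fun a _ => ?_
    rw [← hψ, ← Algebra.smul_def]
    exact Submodule.smul_mem _ _ (Submodule.subset_span ⟨a, rfl⟩)
  have : Module.Finite C R := ⟨by rw [htop]; exact Submodule.fg_span (Set.finite_range m)⟩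
  obtain ⟨p, hp, hdeg, hcoef, hz⟩ :=
    LinearMap.exists_monic_and_natDegree_eq_and_coeff_mem_pow_and_aeval_eq_zero C
      (LinearMap.mulLeft C F) I (by
        rintro _ ⟨f, rfl⟩
        rw [LinearMap.mulLeft_apply, Ideal.smul_top_eq_map, Submodule.restrictScalars_mem]
        exact Ideal.mul_mem_right _ _ hF)
  have hle : p.natDegree ≤ n := by
    rw [hdeg, htop]
    refine (Submodule.spanFinrank_span_le_ncard_of_finite (Set.finite_range m)).trans ?_
    rw [← Nat.card_coe_set_eq]
    exact (Finite.card_range_le m).trans (by simp)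
  have hpz : Polynomial.aeval F p = 0 := by
    have h1 : Polynomial.aeval (Algebra.lmul C R F) p = 0 := hz
    rw [Polynomial.aeval_algHom_apply] at h1
    simpa using congrArg (fun e : Module.End C R => e 1) h1
  let q := p * Polynomial.X ^ (n - p.natDegree)
  have hq : q.Monic := hp.mul (Polynomial.monic_X_pow _)
  have hqn : q.natDegree = n := by
    rw [hp.natDegree_mul (Polynomial.monic_X_pow _), Polynomial.natDegree_X_pow]; omega
  refine ⟨q.coeff, by rw [← hqn]; exact hq, fun k hk => ?_, ?_⟩
  · rw [Polynomial.coeff_mul_X_pow']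
    split_ifs with h
    · exact Ideal.pow_le_self (by omega) (hcoef _)
    · exact I.zero_mem
  · have : Polynomial.aeval F q = 0 := by simp [q, hpz]
    rw [Polynomial.aeval_eq_sum_range, hqn] at this
    simpa [Algebra.smul_def, hψ] using this

namespace MvPolynomial

variable {K : Type u} [CommRing K] {σ : Type v} {τ : Type w}

theorem homogeneousComponent_hom_mul {a : ℕ} {f : MvPolynomial σ K} (hf : f.IsHomogeneous a)
    (n : ℕ) (g : MvPolynomial σ K) :
    homogeneousComponent n (f * g) = if a ≤ n then f * homogeneousComponent (n - a) g else 0 := by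
  classical
  have key : ∀ j, homogeneousComponent n (f * homogeneousComponent j g) =
      if a + j = n then f * homogeneousComponent j g else 0 := fun j => by
    rw [homogeneousComponent_of_mem (hf.mul (homogeneousComponent_isHomogeneous j g))]
    simp only [eq_comm]
  conv_lhs => rw [← sum_homogeneousComponent g, Finset.mul_sum, map_sum]
  simp only [key]
  split_ifs with h
  · rw [Finset.sum_eq_single (n - a)]
    · rw [if_pos (by omega)]
    · intro b _ hb
      rw [if_neg (by omega)]
    · intro hb
      rw [Finset.mem_range, not_lt] at hb
      rw [homogeneousComponent_eq_zero _ _ (by omega), mul_zero, ite_self]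
  · exact Finset.sum_eq_zero fun j _ => if_neg (by omega)

theorem homogeneousComponent_aeval {v : τ → MvPolynomial σ K} {W : τ → ℕ}
    (hv : ∀ i, (v i).IsHomogeneous (W i)) (n : ℕ) (q : MvPolynomial τ K) :
    homogeneousComponent n (aeval v q) = aeval v (weightedHomogeneousComponent W n q) := by
  classical
  induction q using MvPolynomial.induction_on' with
  | add p q hp hq => simp only [map_add, hp, hq]
  | monomial s a =>
    have h1 : (aeval v (monomial s a)).IsHomogeneous (Finsupp.weight W s) := by
      rw [aeval_monomial, ← zero_add (Finsupp.weight W s)]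
      refine (isHomogeneous_C σ a).mul ?_
      rw [Finsupp.weight_apply]
      refine IsHomogeneous.prod _ _ _ fun i _ => ?_
      simpa only [smul_eq_mul, mul_comm] using (hv i).pow (s i)
    have h2 : (monomial s a).IsWeightedHomogeneous W (Finsupp.weight W s) :=
      isWeightedHomogeneous_monomial W s a rfl
    rw [homogeneousComponent_of_mem h1, weightedHomogeneousComponent_of_mem h2]
    split_ifs <;> simp

theorem isHomogeneous_aeval_of_weighted {v : τ → MvPolynomial σ K} {W : τ → ℕ}
    (hv : ∀ i, (v i).IsHomogeneous (W i)) {n : ℕ} {q : MvPolynomial τ K}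
    (hq : q.IsWeightedHomogeneous W n) : (aeval v q).IsHomogeneous n := by
  have := homogeneousComponent_aeval hv n q
  rw [weightedHomogeneousComponent_eq_self hq] at this
  rw [← this]
  exact homogeneousComponent_isHomogeneous _ _

open Polynomial in
theorem natDegree_aeval_monomial_le {A : Type*} [CommRing A] [Algebra K A] (f : τ → A[X])
    (W : τ → ℕ)
    (hf : ∀ i, (f i).natDegree ≤ W i) (s : τ →₀ ℕ) (a : K) :
    (aeval f (monomial s a)).natDegree ≤ Finsupp.weight W s ∧
      (aeval f (monomial s a)).coeff (Finsupp.weight W s) =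
        aeval (fun i => (f i).coeff (W i)) (monomial s a) := by
  classical
  induction s using Finsupp.induction_linear generalizing a with
  | zero => simp [Polynomial.algebraMap_apply]
  | add s t hs ht =>
    have h : monomial (s + t) a = monomial s a * monomial t 1 := by simp [monomial_mul]
    rw [h, map_mul, map_mul, map_add]
    refine ⟨natDegree_mul_le_of_le (hs a).1 (ht 1).1, ?_⟩
    rw [coeff_mul_add_eq_of_natDegree_le (hs a).1 (ht 1).1, (hs a).2, (ht 1).2]
  | single i k =>
    have h1 : Finsupp.weight W (Finsupp.single i k) = k * W i := by
      simp [Finsupp.weight_single]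
    rw [h1, aeval_monomial, aeval_monomial]
    simp only [pow_zero, Finsupp.prod_single_index, Polynomial.algebraMap_apply]
    refine ⟨(natDegree_C_mul_le _ _).trans (natDegree_pow_le_of_le k (hf i)), ?_⟩
    rw [Polynomial.coeff_C_mul, coeff_pow_of_natDegree_le (hf i)]

open Polynomial in
theorem natDegree_aeval_le {A : Type*} [CommRing A] [Algebra K A] (f : τ → A[X])
    (W : τ → ℕ)
    (hf : ∀ i, (f i).natDegree ≤ W i) {w : ℕ} {χ : MvPolynomial τ K}
    (hχ : χ.IsWeightedHomogeneous W w) :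
    (aeval f χ).natDegree ≤ w ∧
      (aeval f χ).coeff w = aeval (fun i => (f i).coeff (W i)) χ := by
  have h : ∀ s ∈ χ.support, Finsupp.weight W s = w := fun s hs => hχ (mem_support_iff.1 hs)
  rw [χ.as_sum, map_sum, map_sum]
  constructor
  · refine natDegree_sum_le_of_forall_le _ _ fun s hs => ?_
    rw [← h s hs]
    exact (natDegree_aeval_monomial_le f W hf s _).1
  · rw [finsetSum_coeff]
    refine Finset.sum_congr rfl fun s hs => ?_
    rw [← h s hs]
    exact (natDegree_aeval_monomial_le f W hf s _).2

end MvPolynomial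

end

section

open MvPolynomial

/-- The retraction `K[Y, ℓ] → K[ℓ]` killing the first block of variables. -/
noncomputable def killLeft (K : Type u) [Field K] (ι Λ : Type) :
    MvPolynomial (ι ⊕ Λ) K →ₐ[K] MvPolynomial Λ K :=
  aeval (Sum.elim (fun _ => 0) X)

/-- A presentation of a polynomial ring as a flat module over `K[g, ℓ]` spanned by
`n` forms of degree at most `D`, the `ℓ` being linear forms. -/
structure NoetherFrame (K : Type u) [Field K] (σ ι : Type) (g : ι → MvPolynomial σ K)
    (n D : ℕ) where
  Λ : Type
  ℓ : Λ → MvPolynomial σ K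
  hℓ : ∀ k, (ℓ k).IsHomogeneous 1
  m : Fin n → MvPolynomial σ K
  deg : Fin n → ℕ
  deg_le : ∀ a, deg a ≤ D
  hm : ∀ a, (m a).IsHomogeneous (deg a)
  flat : (aeval (R := K) (Sum.elim g ℓ) : MvPolynomial (ι ⊕ Λ) K →ₐ[K] _).toRingHom.Flat
  span : ∀ f, ∃ c : Fin n → MvPolynomial (ι ⊕ Λ) K,
    f = ∑ a, aeval (R := K) (Sum.elim g ℓ) (c a) * m a

namespace NoetherFrame

variable {K : Type u} [Field K] {σ ι : Type} {g : ι → MvPolynomial σ K} {n D : ℕ}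
  (Fr : NoetherFrame K σ ι g n D)

noncomputable abbrev ψ : MvPolynomial (ι ⊕ Fr.Λ) K →ₐ[K] MvPolynomial σ K :=
  aeval (Sum.elim g Fr.ℓ)

noncomputable abbrev lin : MvPolynomial Fr.Λ K →ₐ[K] MvPolynomial σ K := aeval Fr.ℓ

theorem sub_rename_killLeft_mem {Λ : Type} (q : MvPolynomial (ι ⊕ Λ) K) :
    q - rename Sum.inr (killLeft K ι Λ q) ∈
      Ideal.span (Set.range fun i => (X (Sum.inl i) : MvPolynomial (ι ⊕ Λ) K)) := by
  rw [← Ideal.Quotient.eq]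
  have : (Ideal.Quotient.mkₐ K (Ideal.span (Set.range fun i =>
      (X (Sum.inl i) : MvPolynomial (ι ⊕ Λ) K)))) =
      ((Ideal.Quotient.mkₐ K _).comp (rename Sum.inr)).comp (killLeft K ι Λ) := by
    ext i
    rcases i with i | i
    · simp only [killLeft, AlgHom.comp_apply, aeval_X, Sum.elim_inl, map_zero,
        Ideal.Quotient.mkₐ_eq_mk]
      exact Ideal.Quotient.eq_zero_iff_mem.2 (Ideal.subset_span ⟨i, rfl⟩)
    · simp [killLeft]
  exact congrArg (fun F => F q) this

theorem mem_of_killLeft_eq_zero {Λ : Type} {q : MvPolynomial (ι ⊕ Λ) K}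
    (h : killLeft K ι Λ q = 0) :
    q ∈ Ideal.span (Set.range fun i => (X (Sum.inl i) : MvPolynomial (ι ⊕ Λ) K)) := by
  simpa [h] using sub_rename_killLeft_mem q

theorem killLeft_eq_zero_of_mem {Λ : Type} {q : MvPolynomial (ι ⊕ Λ) K}
    (h : q ∈ Ideal.span (Set.range fun i => (X (Sum.inl i) : MvPolynomial (ι ⊕ Λ) K))) :
    killLeft K ι Λ q = 0 := by
  have : Ideal.span (Set.range fun i => (X (Sum.inl i) : MvPolynomial (ι ⊕ Λ) K)) ≤
      RingHom.ker (killLeft K ι Λ) := by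
    rw [Ideal.span_le]
    rintro _ ⟨i, rfl⟩
    simp [RingHom.mem_ker, killLeft]
  exact this h

theorem map_span_X : (Ideal.span (Set.range fun i =>
    (X (Sum.inl i) : MvPolynomial (ι ⊕ Fr.Λ) K))).map Fr.ψ = Ideal.span (Set.range g) := by
  rw [Ideal.map_span, ← Set.range_comp]
  congr 2
  ext1 i
  simp

theorem ψ_rename (q : MvPolynomial Fr.Λ K) : Fr.ψ (rename Sum.inr q) = Fr.lin q := by
  rw [aeval_rename]; rfl

theorem ψ_mem {q : MvPolynomial (ι ⊕ Fr.Λ) K} (h : killLeft K ι Fr.Λ q = 0) :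
    Fr.ψ q ∈ Ideal.span (Set.range g) := by
  rw [← Fr.map_span_X]
  exact Ideal.mem_map_of_mem _ (mem_of_killLeft_eq_zero h)

theorem ψ_sub_lin_mem (q : MvPolynomial (ι ⊕ Fr.Λ) K) :
    Fr.ψ q - Fr.lin (killLeft K ι Fr.Λ q) ∈ Ideal.span (Set.range g) := by
  rw [← Fr.ψ_rename, ← map_sub, ← Fr.map_span_X]
  exact Ideal.mem_map_of_mem _ (sub_rename_killLeft_mem q)

/-- Nonzero elements of `K[ℓ]` are nonzerodivisors modulo `g`. -/
theorem mem_of_lin_mul_mem [Finite ι] {p : MvPolynomial Fr.Λ K} (hp : p ≠ 0) {f : MvPolynomial σ K}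
    (h : Fr.lin p * f ∈ Ideal.span (Set.range g)) : f ∈ Ideal.span (Set.range g) := by
  have := Fintype.ofFinite ι
  obtain ⟨z, hz⟩ := Ideal.mem_span_range_iff_exists_fun.1 h
  obtain ⟨k, a, w, hw, ha⟩ := Fr.flat.exists_colon (rename Sum.inr p) (fun i => X (Sum.inl i)) f z
    (by
      change Fr.ψ _ * f = ∑ i, Fr.ψ _ * z i
      rw [Fr.ψ_rename, ← hz]
      simp [mul_comm])
  rw [hw]
  refine Ideal.sum_mem _ fun j _ => Ideal.mul_mem_right _ _ (Fr.ψ_mem ?_)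
  have h1 := killLeft_eq_zero_of_mem (ha j)
  rw [map_mul] at h1
  refine (mul_eq_zero.1 h1).resolve_left ?_
  have : killLeft K ι Fr.Λ (rename Sum.inr p) = p := by
    rw [killLeft, aeval_rename]; exact aeval_X_left_apply p
  rwa [this]

theorem exists_lin_relation {d : ι → ℕ} (hg : ∀ i, (g i).IsHomogeneous (d i))
    {f : MvPolynomial σ K} {e : ℕ} (hf : f.IsHomogeneous e) :
    ∃ q : ℕ → MvPolynomial Fr.Λ K, q n = 1 ∧ (∀ k ≤ n, (q k).IsHomogeneous ((n - k) * e)) ∧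
      ∑ k ∈ Finset.range (n + 1), Fr.lin (q k) * f ^ k ∈ Ideal.span (Set.range g) := by
  obtain ⟨a, han, -, hsum⟩ := exists_monic_relation Fr.ψ.toRingHom Fr.m Fr.span ⊤ f
      (by rw [Ideal.map_top]; trivial)
  let W : ι ⊕ Fr.Λ → ℕ := Sum.elim d (fun _ => 1)
  have hv : ∀ i, (Sum.elim g Fr.ℓ i).IsHomogeneous (W i) := by
    rintro (i | i)
    · exact hg i
    · exact Fr.hℓ i
  let b : ℕ → MvPolynomial (ι ⊕ Fr.Λ) K := fun k =>
    weightedHomogeneousComponent W ((n - k) * e) (a k)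
  have hb : ∀ k, (b k).IsWeightedHomogeneous W ((n - k) * e) := fun k =>
    weightedHomogeneousComponent_isWeightedHomogeneous _ _
  refine ⟨fun k => killLeft K ι Fr.Λ (b k), ?_, fun k hk => ?_, ?_⟩
  · have : b n = 1 := by
      simp only [b, han, Nat.sub_self, zero_mul]
      exact weightedHomogeneousComponent_eq_self (isWeightedHomogeneous_one K W)
    simp [this]
  · refine isHomogeneous_aeval_of_weighted (W := W) ?_ (hb k)
    rintro (i | i)
    · exact isHomogeneous_zero _ _ _
    · exact isHomogeneous_X _ _
  · have hsum' : ∑ k ∈ Finset.range (n + 1), Fr.ψ (b k) * f ^ k = 0 := by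
      have h0 := congrArg (homogeneousComponent (n * e)) hsum
      rw [map_sum, map_zero] at h0
      rw [← h0]
      refine Finset.sum_congr rfl fun k hk => ?_
      have hk' : k ≤ n := by simpa [Nat.lt_succ_iff] using hk
      have h1 : homogeneousComponent ((n - k) * e + k * e) (Fr.ψ (a k) * f ^ k) =
          homogeneousComponent ((n - k) * e) (Fr.ψ (a k)) * f ^ k := by
        rw [mul_comm _ (f ^ k), mul_comm _ (f ^ k), mul_comm k e,
          homogeneousComponent_hom_mul (hf.pow k), if_pos (by omega), Nat.add_sub_cancel]
      have h2 : (n - k) * e + k * e = n * e := by rw [← add_mul]; congr 1; omega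
      rw [h2] at h1
      change _ = homogeneousComponent (n * e) (Fr.ψ (a k) * f ^ k)
      rw [h1, homogeneousComponent_aeval hv]
    have h3 : ∑ k ∈ Finset.range (n + 1), (Fr.lin (killLeft K ι Fr.Λ (b k)) - Fr.ψ (b k)) * f ^ k
        ∈ Ideal.span (Set.range g) := by
      refine Ideal.sum_mem _ fun k _ => Ideal.mul_mem_right _ _ ?_
      rw [← neg_sub]
      exact neg_mem (Fr.ψ_sub_lin_mem _)
    simpa only [sub_mul, Finset.sum_sub_distrib, hsum', sub_zero] using h3

end NoetherFrame

end

section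

open Polynomial in
theorem RingHom.Flat.mapRingHom {A : Type u} {B : Type v} [CommRing A] [CommRing B] {φ : A →+* B}
    (h : φ.Flat) : (Polynomial.mapRingHom φ).Flat := by
  let _ := φ.toAlgebra
  let _ : Algebra A[X] B[X] := Polynomial.algebra A B
  have : Module.Flat A B := h
  have h1 : Algebra.IsPushout A A[X] B B[X] := inferInstance
  have : Module.Flat A[X] B[X] := Module.Flat.isBaseChange A A[X] B B[X] h1.out
  exact (RingHom.flat_algebraMap_iff (R := A[X]) (S := B[X])).2 this

open MvPolynomial

variable {K : Type u} [Field K] {σ ι : Type}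

/-- Adjoining one more variable on both sides preserves flatness. -/
theorem MvPolynomial.flat_aeval_option {Λ : Type} {g : ι → MvPolynomial σ K}
    {ℓ : Λ → MvPolynomial σ K}
    (h : (aeval (R := K) (Sum.elim g ℓ) : MvPolynomial (ι ⊕ Λ) K →ₐ[K] _).toRingHom.Flat) :
    (aeval (R := K) (Sum.elim (fun o : Option ι => o.elim Polynomial.X fun i => Polynomial.C (g i))
      fun k => Polynomial.C (ℓ k)) : MvPolynomial (Option ι ⊕ Λ) K →ₐ[K] _).toRingHom.Flat := by
  let e : Option ι ⊕ Λ → Option (ι ⊕ Λ) :=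
    Sum.elim (fun o => o.map Sum.inl) (fun k => some (Sum.inr k))
  let e' : Option (ι ⊕ Λ) → Option ι ⊕ Λ := fun o => o.elim (Sum.inl none)
    (Sum.elim (fun i => Sum.inl (some i)) Sum.inr)
  let E : (Option ι ⊕ Λ) ≃ Option (ι ⊕ Λ) := ⟨e, e', by rintro ((_ | i) | k) <;> rfl,
    by rintro (_ | i | k) <;> rfl⟩
  have h1 : ((renameEquiv K E).trans (optionEquivLeft K (ι ⊕ Λ))).toAlgHom.toRingHom.Flat :=
    RingHom.Flat.of_bijective (AlgEquiv.bijective _)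
  have h2 := h1.comp h.mapRingHom
  convert h2 using 1
  refine MvPolynomial.ringHom_ext (fun r => ?_) ?_
  · simp [Polynomial.algebraMap_apply, optionEquivLeft_C]
  · rintro ((_ | i) | k)
    · simp [E, e, optionEquivLeft_X_none]
    · simp [E, e, optionEquivLeft_X_some]
    · simp [E, e, optionEquivLeft_X_some]

namespace NoetherFrame

section shear

variable {Λ : Type} [DecidableEq Λ] (v : Λ → K) (κ : Λ)

/-- The shear `ℓ_k ↦ X'_k + v_k X`, `ℓ_κ ↦ v_κ X`. -/
noncomputable def shearVar : Option ι ⊕ Λ →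
    Polynomial (MvPolynomial (Option ι ⊕ {k : Λ // k ≠ κ}) K) :=
  Sum.elim (fun o => Polynomial.C (X (Sum.inl o)))
    (fun k => (if h : k ≠ κ then Polynomial.C (X (Sum.inr ⟨k, h⟩)) else 0) +
      Polynomial.C (C (v k)) * Polynomial.X)

noncomputable def shear : MvPolynomial (Option ι ⊕ Λ) K →+*
    Polynomial (MvPolynomial (Option ι ⊕ {k : Λ // k ≠ κ}) K) :=
  (aeval (R := K) (shearVar v κ)).toRingHom

noncomputable def unshearVar : Option ι ⊕ {k : Λ // k ≠ κ} → MvPolynomial (Option ι ⊕ Λ) K :=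
  Sum.elim (fun o => X (Sum.inl o))
    (fun k => X (Sum.inr k.1) - C (v k.1 * (v κ)⁻¹) * X (Sum.inr κ))

noncomputable def unshear : Polynomial (MvPolynomial (Option ι ⊕ {k : Λ // k ≠ κ}) K) →+*
    MvPolynomial (Option ι ⊕ Λ) K :=
  Polynomial.eval₂RingHom (aeval (R := K) (unshearVar v κ)).toRingHom
    (C (v κ)⁻¹ * X (Sum.inr κ))

variable {v κ}

theorem unshear_shear (hv : v κ ≠ 0) :
    (unshear v κ).comp (shear v κ) = RingHom.id (MvPolynomial (Option ι ⊕ Λ) K) := by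
  refine MvPolynomial.ringHom_ext (fun r => ?_) ?_
  · simp [shear, unshear, Polynomial.algebraMap_apply]
  · rintro (o | k)
    · simp [shear, shearVar, unshear, unshearVar]
    · by_cases h : k = κ
      · subst h
        simp [shear, shearVar, unshear, ← mul_assoc, ← C_mul, hv]
      · simp [shear, shearVar, unshear, unshearVar, h]
        ring

theorem shear_unshear (hv : v κ ≠ 0) :
    (shear v κ).comp (unshear v κ) = RingHom.id
      (Polynomial (MvPolynomial (Option ι ⊕ {k : Λ // k ≠ κ}) K)) := by
  refine Polynomial.ringHom_ext' (MvPolynomial.ringHom_ext (fun r => ?_) ?_) ?_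
  · simp [shear, unshear, Polynomial.algebraMap_apply]
  · rintro (o | k)
    · simp [shear, shearVar, unshear, unshearVar]
    · have hc : (Polynomial.C (C (v κ)⁻¹) :
          Polynomial (MvPolynomial (Option ι ⊕ {k : Λ // k ≠ κ}) K))
          * Polynomial.C (C (v κ)) = 1 := by
        rw [← Polynomial.C_mul, ← C_mul, inv_mul_cancel₀ hv, C_1, Polynomial.C_1]
      simp [shear, shearVar, unshear, unshearVar, k.2, Polynomial.algebraMap_apply]
      linear_combination (-(Polynomial.C (C (v k)) * Polynomial.X)) * hc
  · simp [shear, shearVar, unshear, Polynomial.algebraMap_apply, ← mul_assoc,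
        ← Polynomial.C_mul, ← C_mul, hv]

theorem shear_monic {d : Option ι → ℕ} (hd : ∀ i, 1 ≤ d i) {w : ℕ}
    {χ : MvPolynomial (Option ι ⊕ Λ) K}
    (hχ : χ.IsWeightedHomogeneous (Sum.elim d fun _ => 1) w) :
    (shear v κ χ).natDegree ≤ w ∧
      (shear v κ χ).coeff w = C (eval v (killLeft K (Option ι) Λ χ)) := by
  have h := natDegree_aeval_le (shearVar v κ) (Sum.elim d fun _ => 1) (by
    rintro (o | k)
    · simp [shearVar]
    · simp only [shearVar, Sum.elim_inr]
      refine Polynomial.natDegree_add_le_of_degree_le ?_ ?_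
      · split_ifs <;> simp
      · exact (Polynomial.natDegree_C_mul_le _ _).trans Polynomial.natDegree_X_le) hχ
  refine ⟨h.1, h.2.trans ?_⟩
  have : (aeval (R := K) fun i => (shearVar (ι := ι) v κ i).coeff (Sum.elim d (fun _ => 1) i)) =
      ((Algebra.ofId K _).comp (aeval v)).comp (killLeft K (Option ι) Λ) := by
    ext1 i
    rcases i with o | k
    · have : d o ≠ 0 := by have := hd o; omega
      simp [shearVar, killLeft, Polynomial.coeff_C, this]
    · simp only [shearVar, killLeft, aeval_X, Sum.elim_inr, AlgHom.comp_apply]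
      split_ifs <;> simp [Polynomial.coeff_C, Algebra.ofId_apply]
  rw [this]
  simp [Algebra.ofId_apply, aeval_eq_eval]

end shear

end NoetherFrame

end

section

open MvPolynomial

namespace NoetherFrame

variable {K : Type u} [Field K] {σ ι : Type} {g : ι → MvPolynomial σ K} {n D : ℕ}
  (Fr : NoetherFrame K σ ι g n D)

theorem exists_shifted_relation {d : ι → ℕ} (hg : ∀ i, (g i).IsHomogeneous (d i))
    {f : MvPolynomial σ K} {e : ℕ} (hf : f.IsHomogeneous e) :
    ∃ k₀ ≤ n, ∃ q : ℕ → MvPolynomial Fr.Λ K, q 0 ≠ 0 ∧ q (n - k₀) = 1 ∧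
      (∀ k ≤ n - k₀, (q k).IsHomogeneous ((n - k₀ - k) * e)) ∧
      f ^ k₀ * ∑ k ∈ Finset.range (n - k₀ + 1), Fr.lin (q k) * f ^ k ∈
        Ideal.span (Set.range g) := by
  classical
  obtain ⟨q, hq1, hq, hmem⟩ := Fr.exists_lin_relation hg hf
  have hex : ∃ k, q k ≠ 0 := ⟨n, by rw [hq1]; exact one_ne_zero⟩
  have hle : Nat.find hex ≤ n := Nat.find_min' hex (by rw [hq1]; exact one_ne_zero)
  refine ⟨Nat.find hex, hle, fun k => q (Nat.find hex + k), by simpa using Nat.find_spec hex,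
    by simp only [Nat.add_sub_cancel' hle, hq1], fun k hk => ?_, ?_⟩
  · have := hq (Nat.find hex + k) (by omega)
    rwa [← Nat.sub_sub] at this
  · convert hmem using 1
    have h1 : n + 1 = Nat.find hex + (n - Nat.find hex + 1) := by omega
    have h0 : ∑ x ∈ Finset.range (Nat.find hex), Fr.lin (q x) * f ^ x = 0 :=
      Finset.sum_eq_zero fun k hk => by
        rw [not_ne_iff.1 (Nat.find_min hex (Finset.mem_range.1 hk)), map_zero, zero_mul]
    conv_rhs => rw [h1, Finset.sum_range_add, h0, zero_add]
    rw [Finset.mul_sum]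
    exact Finset.sum_congr rfl fun k _ => by rw [pow_add]; ring

theorem one_notMem {d : ι → ℕ} (hg : ∀ i, (g i).IsHomogeneous (d i)) (hd : ∀ i, 1 ≤ d i) :
    (1 : MvPolynomial σ K) ∉ Ideal.span (Set.range g) := by
  intro h
  have : Ideal.span (Set.range g) ≤ RingHom.ker (constantCoeff (R := K) (σ := σ)) := by
    rw [Ideal.span_le]
    rintro _ ⟨i, rfl⟩
    rw [SetLike.mem_coe, RingHom.mem_ker, constantCoeff_eq]
    refine (hg i).coeff_eq_zero ?_
    have := hd i
    simp only [map_zero]; omega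
  simpa [RingHom.mem_ker] using this h

theorem mem_of_pow_mul_mem {R : Type*} [CommRing R] {I : Ideal R} {f : R}
    (hreg : ∀ h, f * h ∈ I → h ∈ I) (k : ℕ) {h : R} (hh : f ^ k * h ∈ I) : h ∈ I := by
  induction k with
  | zero => simpa using hh
  | succ k ih => exact ih (hreg _ (by rwa [← mul_assoc, ← pow_succ']))

/-- Evaluation with one more form. -/
noncomputable abbrev ev (f : MvPolynomial σ K) :
    MvPolynomial (Option ι ⊕ Fr.Λ) K →ₐ[K] MvPolynomial σ K :=
  aeval (Sum.elim (fun o : Option ι => o.elim f g) Fr.ℓ)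

theorem exists_relation_ev {d : ι → ℕ} (hg : ∀ i, (g i).IsHomogeneous (d i)) (hd : ∀ i, 1 ≤ d i)
    {f : MvPolynomial σ K} {e : ℕ} (hf : f.IsHomogeneous e) (he : 1 ≤ e)
    (hreg : ∀ h, f * h ∈ Ideal.span (Set.range g) → h ∈ Ideal.span (Set.range g)) :
    ∃ (w : ℕ) (χ : MvPolynomial (Option ι ⊕ Fr.Λ) K) (c : MvPolynomial Fr.Λ K), w ≤ n * (n * e) ∧
      χ.IsWeightedHomogeneous (Sum.elim (fun o : Option ι => o.elim e d) fun _ => 1) w ∧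
      Fr.ev f χ = 0 ∧ killLeft K (Option ι) Fr.Λ χ = c ^ n ∧ c ≠ 0 ∧
      ∃ w₀ ≠ 0, c.IsHomogeneous w₀ := by
  obtain ⟨k₀, hk₀, q, hq0, hq1, hq, hmem⟩ := Fr.exists_shifted_relation hg hf
  have hF := mem_of_pow_mul_mem hreg _ hmem
  set F := ∑ k ∈ Finset.range (n - k₀ + 1), Fr.lin (q k) * f ^ k with hFdef
  have hlt : k₀ < n := by
    refine lt_of_le_of_ne hk₀ fun h => one_notMem hg hd ?_
    have h0 : n - k₀ = 0 := by omega
    rw [h0] at hq1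
    simpa [hFdef, h0, hq1] using hF
  let W : Option ι ⊕ Fr.Λ → ℕ := Sum.elim (fun o : Option ι => o.elim e d) fun _ => 1
  let w₀ := (n - k₀) * e
  have hw₀ : w₀ ≠ 0 := by
    have : 0 < n - k₀ := by omega
    positivity
  have hc : (q 0).IsHomogeneous w₀ := hq 0 (Nat.zero_le _)
  obtain ⟨a, ha1, haI, hsum⟩ := exists_monic_relation Fr.ψ.toRingHom Fr.m Fr.span
    (Ideal.span (Set.range fun i => (X (Sum.inl i) : MvPolynomial (ι ⊕ Fr.Λ) K))) F
    (by have := Fr.map_span_X; exact this ▸ hF)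
  let i : MvPolynomial (ι ⊕ Fr.Λ) K →ₐ[K] MvPolynomial (Option ι ⊕ Fr.Λ) K :=
    rename (Sum.map some id)
  let FD : MvPolynomial (Option ι ⊕ Fr.Λ) K :=
    ∑ k ∈ Finset.range (n - k₀ + 1), rename Sum.inr (q k) * X (Sum.inl none) ^ k
  have hi : ∀ p, Fr.ev f (i p) = Fr.ψ p := fun p => by
    simp only [i, ev, aeval_rename, ψ]
    congr 2
    ext1 j
    rcases j with j | j <;> rfl
  have hevFD : Fr.ev f FD = F := by
    simp only [FD, ev, map_sum, map_mul, aeval_rename, map_pow, aeval_X, hFdef]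
    rfl
  have hkr : ∀ p : MvPolynomial Fr.Λ K, killLeft K (Option ι) Fr.Λ (rename Sum.inr p) = p :=
    fun p => by rw [killLeft, aeval_rename]; exact aeval_X_left_apply p
  have hki : ∀ p, killLeft K (Option ι) Fr.Λ (i p) = killLeft K ι Fr.Λ p := fun p => by
    simp only [i, killLeft, aeval_rename]
    congr 2
    ext1 j
    rcases j with j | j <;> rfl
  have hkFD : killLeft K (Option ι) Fr.Λ FD = q 0 := by
    simp only [FD, map_sum, map_mul, hkr, map_pow]
    rw [Finset.sum_range_succ']
    simp [killLeft]
  let χ₀ := ∑ k ∈ Finset.range (n + 1), i (a k) * FD ^ k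
  have hev0 : Fr.ev f χ₀ = 0 := by
    simp only [χ₀, map_sum, map_mul, map_pow, hi, hevFD]
    exact hsum
  have hkill0 : killLeft K (Option ι) Fr.Λ χ₀ = q 0 ^ n := by
    simp only [χ₀, map_sum, map_mul, map_pow, hki, hkFD]
    rw [Finset.sum_range_succ, Finset.sum_eq_zero, ha1]
    · simp
    · intro k hk
      rw [killLeft_eq_zero_of_mem (haI k (Finset.mem_range.1 hk)), zero_mul]
  refine ⟨w₀ * n, weightedHomogeneousComponent W (w₀ * n) χ₀, q 0, ?_,
    weightedHomogeneousComponent_isWeightedHomogeneous _ _, ?_, ?_, hq0, w₀, hw₀, hc⟩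
  · rw [mul_comm]
    exact Nat.mul_le_mul_left _ (Nat.mul_le_mul_right _ (Nat.sub_le _ _))
  · rw [← homogeneousComponent_aeval, hev0, map_zero]
    rintro ((_ | j) | j)
    exacts [hf, hg j, Fr.hℓ j]
  · rw [killLeft, ← homogeneousComponent_aeval, ← killLeft, hkill0,
      homogeneousComponent_eq_self (hc.pow n)]
    rintro (j | j)
    exacts [isHomogeneous_zero _ _ _, isHomogeneous_X _ _]

theorem nonempty_snoc [Infinite K] (Fr : NoetherFrame K σ ι g n D) {d : ι → ℕ}
    (hg : ∀ i, (g i).IsHomogeneous (d i)) (hd : ∀ i, 1 ≤ d i)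
    {f : MvPolynomial σ K} {e : ℕ} (hf : f.IsHomogeneous e) (he : 1 ≤ e)
    (hreg : ∀ h, f * h ∈ Ideal.span (Set.range g) → h ∈ Ideal.span (Set.range g)) :
    Nonempty (NoetherFrame K σ (Option ι) (fun o => o.elim f g) (n * (n * (n * e)))
      (D + n * (n * e))) := by
  classical
  obtain ⟨w, χ, c, hw, hχ, hev, hkill, hc0, w₀, hw₀, hc⟩ := Fr.exists_relation_ev hg hd hf he hreg
  obtain ⟨v, hv⟩ : ∃ v : Fr.Λ → K, eval v c ≠ 0 := by
    by_contra! h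
    exact hc0 (MvPolynomial.funext fun v => by simpa using h v)
  obtain ⟨κ, hκ⟩ : ∃ κ, v κ ≠ 0 := by
    by_contra! h
    have : v = 0 := _root_.funext h
    rw [this, eval_zero, constantCoeff_eq] at hv
    exact hv (hc.coeff_eq_zero (by simpa using hw₀.symm))
  have hd' : ∀ o : Option ι, 1 ≤ o.elim e d := by rintro (_ | i); exacts [he, hd i]
  have hmon := shear_monic (v := v) (κ := κ) hd' hχ
  rw [hkill, map_pow] at hmon
  have hu : eval v c ^ n ≠ 0 := pow_ne_zero _ hv
  set A := MvPolynomial (Option ι ⊕ {k : Fr.Λ // k ≠ κ}) K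
  let χ' : Polynomial A := Polynomial.C (C (eval v c ^ n)⁻¹) * shear v κ χ
  have hdeg : χ'.natDegree ≤ w := (Polynomial.natDegree_C_mul_le _ _).trans hmon.1
  have hχ' : χ'.Monic := by
    refine Polynomial.monic_of_natDegree_le_of_coeff_eq_one w hdeg ?_
    rw [Polynomial.coeff_C_mul, hmon.2, ← C_mul, inv_mul_cancel₀ hu, C_1]
  let Φ : MvPolynomial (Option ι ⊕ Fr.Λ) K →ₐ[K] Polynomial (MvPolynomial σ K) :=
    aeval (Sum.elim (fun o : Option ι => o.elim Polynomial.X fun i => Polynomial.C (g i))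
      fun k => Polynomial.C (Fr.ℓ k))
  have hΦ : Φ.toRingHom.Flat := flat_aeval_option Fr.flat
  let φ : Polynomial A →+* Polynomial (MvPolynomial σ K) := Φ.toRingHom.comp (unshear v κ)
  have hφ : φ.Flat := (RingHom.Flat.of_bijective (f := unshear v κ) ⟨fun x y h => by
      have h1 := congrArg (fun F : _ →+* _ => F x) (shear_unshear hκ)
      have h2 := congrArg (fun F : _ →+* _ => F y) (shear_unshear hκ)
      exact h1.symm.trans ((congrArg (shear v κ) h).trans h2),
      fun y => ⟨shear v κ y, congrArg (fun F : _ →+* _ => F y) (unshear_shear hκ)⟩⟩).comp hΦ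
  let π := Polynomial.evalRingHom f
  have hπΦ : ∀ p, π (Φ p) = Fr.ev f p := fun p => by
    have : π.comp Φ.toRingHom = (Fr.ev f).toRingHom := by
      refine MvPolynomial.ringHom_ext (fun r => ?_) ?_
      · simp [π, Φ, Polynomial.algebraMap_apply]
      · rintro ((_ | i) | k) <;> simp [π, Φ]
    exact congrArg (fun F : _ →+* _ => F p) this
  have hπφ : π (φ χ') = 0 := by
    have h1 : unshear v κ (shear v κ χ) = χ :=
      congrArg (fun F : _ →+* _ => F χ) (unshear_shear hκ)
    simp only [χ', map_mul]
    have : π (φ (shear v κ χ)) = 0 := by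
      change π (Φ (unshear v κ (shear v κ χ))) = 0
      rw [h1, hπΦ, hev]
    rw [this, mul_zero]
  obtain ⟨c', hc'⟩ := Polynomial.dvd_iff_isRoot.2 (show Polynomial.IsRoot (φ χ') f from hπφ)
  have hflat := hφ.quotient_of_monic hχ' hc' π
    (fun r => ⟨Polynomial.C r, by simp [π]⟩) (Polynomial.ker_evalRingHom f)
  let ℓ' : {k : Fr.Λ // k ≠ κ} → MvPolynomial σ K :=
    fun k => Fr.ℓ k.1 - C (v k.1 * (v κ)⁻¹) * Fr.ℓ κ
  let ψ' : A →ₐ[K] MvPolynomial σ K := aeval (Sum.elim (fun o : Option ι => o.elim f g) ℓ')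
  have hψ' : (π.comp φ).comp Polynomial.C = ψ'.toRingHom := by
    refine MvPolynomial.ringHom_ext (fun r => ?_) ?_
    · refine Eq.trans ?_ (aeval_C _ _).symm
      simp [φ, π, Φ, unshear, Polynomial.algebraMap_apply]
    · rintro ((_ | i) | k) <;> refine Eq.trans ?_ (aeval_X _ _).symm
      · simp [φ, π, Φ, unshear, unshearVar]
      · simp [φ, π, Φ, unshear, unshearVar]
      · simp [φ, π, Φ, unshear, unshearVar, ℓ', Polynomial.algebraMap_apply]
  let x : MvPolynomial σ K := C (v κ)⁻¹ * Fr.ℓ κ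
  have hx : x.IsHomogeneous 1 := (Fr.hℓ κ).C_mul _
  have hπX : π (φ Polynomial.X) = x := by
    simp [φ, π, Φ, unshear, x, Polynomial.algebraMap_apply]
  let N := n * (n * e)
  have hgen : ∀ p : MvPolynomial (ι ⊕ Fr.Λ) K, ∃ r : Fin N → A,
      Fr.ψ p = ∑ b, ψ' (r b) * x ^ (b : ℕ) := by
    intro p
    let P := shear v κ (rename (Sum.map some id) p)
    have hP : π (φ P) = Fr.ψ p := by
      have h1 : unshear v κ P = rename (Sum.map some id) p :=
        congrArg (fun F : _ →+* _ => F _) (unshear_shear hκ)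
      change π (Φ (unshear v κ P)) = _
      rw [h1, hπΦ]
      simp only [ev, aeval_rename, ψ]
      congr 2
      ext1 j
      rcases j with j | j <;> rfl
    have hmod : π (φ (P %ₘ χ')) = Fr.ψ p := by
      rw [← hP]
      conv_rhs => rw [← Polynomial.modByMonic_add_div P χ']
      rw [map_add, map_add, map_mul, map_mul, hπφ, zero_mul, add_zero]
    refine ⟨fun b => (P %ₘ χ').coeff b, ?_⟩
    have hlt : (P %ₘ χ').natDegree < N ∨ P %ₘ χ' = 0 := by
      by_cases h1 : χ' = 1
      · right; rw [h1, Polynomial.modByMonic_one]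
      · left; exact (Polynomial.natDegree_modByMonic_lt P hχ' h1).trans_le (hdeg.trans hw)
    have hP2 : P %ₘ χ' =
        ∑ b ∈ Finset.range N, Polynomial.C ((P %ₘ χ').coeff b) * Polynomial.X ^ b := by
      rcases hlt with h | h
      · exact Polynomial.as_sum_range_C_mul_X_pow' _ h
      · simp [h]
    rw [← hmod]
    conv_lhs => rw [hP2]
    rw [map_sum, map_sum, Finset.sum_range]
    refine Finset.sum_congr rfl fun b _ => ?_
    rw [map_mul, map_mul, map_pow, map_pow, hπX]
    congr 1
    exact congrArg (fun F : _ →+* _ => F _) hψ'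
  refine ⟨⟨{k : Fr.Λ // k ≠ κ}, ℓ', fun k => (Fr.hℓ _).sub ((Fr.hℓ κ).C_mul _),
    fun t => Fr.m (finProdFinEquiv.symm t).1 * x ^ ((finProdFinEquiv.symm t).2 : ℕ),
    fun t => Fr.deg (finProdFinEquiv.symm t).1 + (finProdFinEquiv.symm t).2,
    fun t => Nat.add_le_add (Fr.deg_le _) (Fin.is_lt _).le,
    fun t => (Fr.hm _).mul (by simpa using hx.pow _), ?_, fun h => ?_⟩⟩
  · rw [hψ'] at hflat
    exact hflat
  · obtain ⟨cc, hcc⟩ := Fr.span h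
    choose r hr using fun a => hgen (cc a)
    refine ⟨fun t => r (finProdFinEquiv.symm t).1 (finProdFinEquiv.symm t).2, ?_⟩
    rw [← Equiv.sum_comp finProdFinEquiv, Fintype.sum_prod_type, hcc]
    refine Finset.sum_congr rfl fun a _ => ?_
    have := hr a
    rw [ψ] at this
    rw [this, Finset.sum_mul]
    refine Finset.sum_congr rfl fun b _ => ?_
    simp only [Equiv.symm_apply_apply]
    ring

end NoetherFrame

end

section

open MvPolynomial

namespace NoetherFrame

variable {K : Type u} [Field K] {σ ι ι' : Type} {g : ι → MvPolynomial σ K} {n D : ℕ}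

theorem aeval_rename_sumMap (Fr : NoetherFrame K σ ι g n D) (E : ι' ≃ ι)
    (p : MvPolynomial (ι' ⊕ Fr.Λ) K) :
    aeval (Sum.elim g Fr.ℓ) (rename (Sum.map E id) p) =
      aeval (R := K) (Sum.elim (fun i => g (E i)) Fr.ℓ) p := by
  rw [aeval_rename]
  congr 2
  ext1 j
  rcases j with j | j <;> rfl

/-- Reindexing the forms of a Noether frame. -/
def reindex (Fr : NoetherFrame K σ ι g n D) (E : ι' ≃ ι) :
    NoetherFrame K σ ι' (fun i => g (E i)) n D where
  Λ := Fr.Λ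
  ℓ := Fr.ℓ
  hℓ := Fr.hℓ
  m := Fr.m
  deg := Fr.deg
  deg_le := Fr.deg_le
  hm := Fr.hm
  flat := by
    have h : (renameEquiv K (Equiv.sumCongr E (Equiv.refl Fr.Λ))).toRingEquiv.toRingHom.Flat :=
      RingHom.Flat.of_bijective (renameEquiv K (Equiv.sumCongr E (Equiv.refl Fr.Λ))).bijective
    have := h.comp Fr.flat
    convert this using 1
    refine MvPolynomial.ringHom_ext (fun r => by simp) ?_
    rintro (i | i) <;> simp
  span f := by
    obtain ⟨c, hc⟩ := Fr.span f
    refine ⟨fun a => rename (Sum.map E.symm id) (c a), hc.trans ?_⟩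
    refine Finset.sum_congr rfl fun a _ => ?_
    rw [← aeval_rename_sumMap, rename_rename]
    congr 2
    have : (Sum.map E id ∘ Sum.map E.symm id : ι ⊕ Fr.Λ → _) = id := by
      ext1 j; rcases j with j | j <;> simp
    rw [this, rename_id_apply]

/-- The frame of the empty family. -/
noncomputable def ofIsEmpty [IsEmpty ι] (g : ι → MvPolynomial σ K) : NoetherFrame K σ ι g 1 0 where
  Λ := σ
  ℓ := X
  hℓ := isHomogeneous_X _
  m _ := 1
  deg _ := 0
  deg_le _ := le_rfl
  hm _ := isHomogeneous_one _ _
  flat := by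
    have h : (renameEquiv K (Equiv.emptySum ι σ)).toRingEquiv.toRingHom.Flat :=
      RingHom.Flat.of_bijective (renameEquiv K (Equiv.emptySum ι σ)).bijective
    convert h using 1
    refine MvPolynomial.ringHom_ext (fun r => by simp) ?_
    rintro (i | i)
    · exact isEmptyElim i
    · simp
  span f := ⟨fun _ => rename Sum.inr f, by
    rw [Fin.sum_univ_one, aeval_rename, mul_one]
    exact (aeval_X_left_apply f).symm⟩

end NoetherFrame

/-- Uniform existence of Noether frames for regular sequences of forms. -/
theorem exists_noetherFrame (s : ℕ) (e : Fin s → ℕ) (he : ∀ j, 1 ≤ e j) :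
    ∃ n D : ℕ, ∀ (K : Type u) [Field K] [Infinite K] (σ : Type) (g : Fin s → MvPolynomial σ K),
      (∀ j, (g j).IsHomogeneous (e j)) →
      (∀ j f, g j * f ∈ Ideal.span (g '' Set.Iio j) → f ∈ Ideal.span (g '' Set.Iio j)) →
      Nonempty (NoetherFrame K σ (Fin s) g n D) := by
  induction s with
  | zero => exact ⟨1, 0, fun K _ _ σ g _ _ => ⟨NoetherFrame.ofIsEmpty g⟩⟩
  | succ s ih =>
    obtain ⟨n, D, h⟩ := ih (fun j => e j.castSucc) fun j => he _
    refine ⟨n * (n * (n * e (Fin.last s))), D + n * (n * e (Fin.last s)),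
      fun K _ _ σ g hg hreg => ?_⟩
    have himg : ∀ j : Fin s, (fun j : Fin s => g j.castSucc) '' Set.Iio j =
        g '' Set.Iio j.castSucc := fun j => by
      ext x
      constructor
      · rintro ⟨i, hi, rfl⟩
        exact ⟨i.castSucc, by simpa using hi, rfl⟩
      · rintro ⟨i, hi, rfl⟩
        have hlt : (i : ℕ) < j := hi
        exact ⟨⟨i, by omega⟩, hlt, rfl⟩
    have hlast : g '' Set.Iio (Fin.last s) = Set.range fun j : Fin s => g j.castSucc := by
      ext x
      constructor
      · rintro ⟨i, hi, rfl⟩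
        exact ⟨⟨i, hi⟩, rfl⟩
      · rintro ⟨i, rfl⟩
        exact ⟨i.castSucc, Fin.castSucc_lt_last i, rfl⟩
    obtain ⟨Fr⟩ := h K σ (fun j => g j.castSucc) (fun j => hg _) fun j f => by
      rw [himg]; exact hreg _ f
    obtain ⟨Fr'⟩ := NoetherFrame.nonempty_snoc Fr (fun j => hg _) (fun j => he _)
      (hg (Fin.last s)) (he _)
      fun f => by rw [← hlast]; exact hreg _ f
    have h2 := Fr'.reindex finSuccEquivLast
    have h3 : (fun i => (finSuccEquivLast i).elim (g (Fin.last s)) fun j => g j.castSucc) = g := by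
      ext1 i
      induction i using Fin.lastCases <;> simp
    rw [h3] at h2
    exact ⟨h2⟩

end

section

namespace UP

open Polynomial

section Poly

variable {Q : ℕ → Type v} [∀ i, CommRing (Q i)]

/-- The embedding of polynomials over an ultraproduct into the ultraproduct of polynomials. -/
noncomputable def polyEmb (Q : ℕ → Type v) [∀ i, CommRing (Q i)] :
    (UP Q)[X] →+* UP (fun i => (Q i)[X]) :=
  eval₂RingHom (UP.map fun _ => C) (UP.mk fun _ => X)

@[simp] theorem polyEmb_C (a : UP Q) : polyEmb Q (C a) = UP.map (fun _ => C) a := by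
  simp [polyEmb]

@[simp] theorem polyEmb_X : polyEmb Q X = UP.mk fun _ => X := by simp [polyEmb]

theorem polyEmb_sum {ι : Type*} (s : Finset ι) (a : ι → ∀ i, Q i) (n : ι → ℕ) :
    polyEmb Q (∑ k ∈ s, C (UP.mk (a k)) * X ^ n k) =
      UP.mk fun i => ∑ k ∈ s, C (a k i) * X ^ n k := by
  simp only [map_sum, map_mul, polyEmb_C, map_pow, polyEmb_X, UP.map_mk, ← UP.mk_pow, ← UP.mk_mul,
    ← UP.mk_sum]

theorem polyEmb_mk {n : ℕ} (f : ∀ i, (Q i)[X]) (h : ∀ i, (f i).natDegree < n) :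
    polyEmb Q (∑ k ∈ Finset.range n, C (UP.mk fun i => (f i).coeff k) * X ^ k) = UP.mk f := by
  rw [polyEmb_sum]
  congr 1
  ext1 i
  exact (as_sum_range_C_mul_X_pow' _ (h i)).symm

theorem polyEmb_injective : Function.Injective (polyEmb Q) := by
  rw [injective_iff_map_eq_zero]
  intro p hp
  choose a ha using fun k => UP.mk_surj (p.coeff k)
  have h1 : p = ∑ k ∈ Finset.range (p.natDegree + 1), C (UP.mk (a k)) * X ^ k := by
    simp only [ha]; exact p.as_sum_range_C_mul_X_pow
  rw [h1, polyEmb_sum, UP.mk_eq_zero] at hp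
  ext k
  rw [coeff_zero, ← ha]
  by_cases hk : k < p.natDegree + 1
  · rw [UP.mk_eq_zero]
    filter_upwards [hp] with i hi
    have := congrArg (fun q => coeff q k) hi
    simpa [finsetSum_coeff, coeff_C_mul, coeff_X_pow, hk] using this
  · rw [ha, coeff_eq_zero_of_natDegree_lt (by omega)]

/-- A monic polynomial is represented by monic polynomials of the same degree. -/
theorem exists_monic_rep [∀ i, Nontrivial (Q i)] {P : (UP Q)[X]} (hP : P.Monic) :
    ∃ p : ∀ i, (Q i)[X], (∀ i, (p i).Monic) ∧ (∀ i, (p i).natDegree = P.natDegree) ∧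
      polyEmb Q P = UP.mk p := by
  choose a ha using fun k => UP.mk_surj (P.coeff k)
  have hdeg : ∀ i, (∑ k ∈ Finset.range P.natDegree, C (a k i) * X ^ k).degree <
      ((P.natDegree : ℕ) : WithBot ℕ) := fun i => by
    refine (degree_sum_le _ _).trans_lt ?_
    rw [Finset.sup_lt_iff (WithBot.bot_lt_coe _)]
    exact fun k hk => (degree_C_mul_X_pow_le _ _).trans_lt (by exact_mod_cast Finset.mem_range.1 hk)
  refine ⟨fun i => X ^ P.natDegree + ∑ k ∈ Finset.range P.natDegree, C (a k i) * X ^ k,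
    fun i => monic_X_pow_add (hdeg i), fun i => ?_, ?_⟩
  · refine natDegree_eq_of_degree_eq_some ?_
    rw [degree_add_eq_left_of_degree_lt (by rw [degree_X_pow]; exact hdeg i), degree_X_pow]
  · conv_lhs => rw [hP.as_sum]
    rw [map_add, map_pow, polyEmb_X]
    simp only [← ha]
    rw [polyEmb_sum, ← UP.mk_pow, ← UP.mk_add]

theorem exists_div_monic [∀ i, Nontrivial (Q i)] {P : (UP Q)[X]} (hP : P.Monic)
    (f : UP fun i => (Q i)[X]) : ∃ q r, f = polyEmb Q P * q + polyEmb Q r := by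
  obtain ⟨p, hp, hd, hpe⟩ := exists_monic_rep hP
  obtain ⟨f, rfl⟩ := UP.mk_surj f
  have hlt : ∀ i, (f i %ₘ p i).natDegree < P.natDegree + 1 := fun i => by
    rw [← hd i]
    exact Nat.lt_succ_of_le (natDegree_modByMonic_le _ (hp i))
  refine ⟨UP.mk fun i => f i /ₘ p i, ∑ k ∈ Finset.range (P.natDegree + 1),
    C (UP.mk fun i => (f i %ₘ p i).coeff k) * X ^ k, ?_⟩
  rw [polyEmb_mk (fun i => f i %ₘ p i) hlt, hpe, ← UP.mk_mul, ← UP.mk_add]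
  congr 1
  ext1 i
  rw [add_comm]; exact (modByMonic_add_div _ _).symm

theorem exists_of_monic_mul [∀ i, Nontrivial (Q i)] {P v : (UP Q)[X]} (hP : P.Monic)
    {x : UP fun i => (Q i)[X]} (h : polyEmb Q P * x = polyEmb Q v) : ∃ y, x = polyEmb Q y := by
  obtain ⟨p, hp, hd, hpe⟩ := exists_monic_rep hP
  refine ⟨v /ₘ P, ?_⟩
  rw [← sub_eq_zero]
  obtain ⟨z, hz⟩ := UP.mk_surj (x - polyEmb Q (v /ₘ P))
  have h1 : polyEmb Q P * (x - polyEmb Q (v /ₘ P)) = polyEmb Q (v %ₘ P) := by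
    rw [mul_sub, h, ← map_mul, ← map_sub]
    congr 1
    rw [sub_eq_iff_eq_add]
    exact (modByMonic_add_div _ _).symm
  rw [← hz, hpe, ← UP.mk_mul] at h1
  rw [← hz, UP.mk_eq_zero]
  choose a ha using fun k => UP.mk_surj ((v %ₘ P).coeff k)
  have h2 : v %ₘ P = ∑ k ∈ Finset.range P.natDegree, C (UP.mk (a k)) * X ^ k := by
    simp only [ha]
    by_cases hP1 : P = 1
    · subst hP1; simp
    · exact as_sum_range_C_mul_X_pow' _ (natDegree_modByMonic_lt _ hP hP1)
  rw [h2, polyEmb_sum, UP.mk_eq] at h1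
  filter_upwards [h1] with i hi
  by_contra hne
  have hdlt : (p i * z i).degree < ((P.natDegree : ℕ) : WithBot ℕ) := by
    rw [hi]
    refine (degree_sum_le _ _).trans_lt ?_
    rw [Finset.sup_lt_iff (WithBot.bot_lt_coe _)]
    exact fun k hk => (degree_C_mul_X_pow_le _ _).trans_lt (by exact_mod_cast Finset.mem_range.1 hk)
  rw [(hp i).degree_mul_comm, (hp i).degree_mul, degree_eq_natDegree hne,
    degree_eq_natDegree (hp i).ne_zero, hd i] at hdlt
  norm_cast at hdlt
  omega

variable {A : Type u} [CommRing A] {φ : A →+* UP Q}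

/-- The extension of a map into an ultraproduct to polynomials. -/
noncomputable def polyMap (φ : A →+* UP Q) : A[X] →+* UP (fun i => (Q i)[X]) :=
  (polyEmb Q).comp (Polynomial.mapRingHom φ)

theorem exists_trivial_of_monic [∀ i, Nontrivial (Q i)] (hφ : φ.Flat) {l : ℕ} (c : Fin l → A[X])
    (f : Fin l → UP fun i => (Q i)[X]) (h : ∑ j, polyMap φ (c j) * f j = 0) (j₀ : Fin l)
    (hc : (c j₀).Monic) :
    ∃ (k : ℕ) (a : Fin l → Fin k → A[X]) (z : Fin k → UP fun i => (Q i)[X]),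
      (∀ i, f i = ∑ j, polyMap φ (a i j) * z j) ∧ ∀ j, ∑ i, c i * a i j = 0 := by
  classical
  set P := Polynomial.mapRingHom φ (c j₀)
  have hP : P.Monic := hc.map φ
  choose q r hqr using fun j => exists_div_monic hP (f j)
  have hqr' : ∀ j, f j = polyMap φ (c j₀) * q j + polyEmb Q (r j) := hqr
  set f₀ := f j₀ + ∑ j ∈ Finset.univ.erase j₀, polyMap φ (c j) * q j with hf₀
  have hsum : polyMap φ (c j₀) * f₀ +
      ∑ j ∈ Finset.univ.erase j₀, polyMap φ (c j) * polyEmb Q (r j) = 0 := by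
    rw [← h, ← Finset.add_sum_erase _ _ (Finset.mem_univ j₀), hf₀, mul_add, add_assoc]
    congr 1
    rw [Finset.mul_sum, ← Finset.sum_add_distrib]
    refine Finset.sum_congr rfl fun j _ => ?_
    rw [hqr' j]; ring
  obtain ⟨y, hy⟩ := exists_of_monic_mul (v := -∑ j ∈ Finset.univ.erase j₀,
    Polynomial.mapRingHom φ (c j) * r j) hP (x := f₀) (by
      rw [map_neg, map_sum]
      simp only [map_mul]
      exact eq_neg_of_add_eq_zero_left hsum)
  let ρ : Fin l → (UP Q)[X] := Function.update r j₀ y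
  have hρ : ∑ j, Polynomial.mapRingHom φ (c j) * ρ j = 0 := by
    apply polyEmb_injective
    rw [map_zero, ← hsum, map_sum, ← Finset.add_sum_erase _ _ (Finset.mem_univ j₀)]
    simp only [map_mul, ρ, Function.update_self, hy]
    congr 1
    refine Finset.sum_congr rfl fun j hj => ?_
    rw [Function.update_of_ne (Finset.ne_of_mem_erase hj)]
    rfl
  obtain ⟨k, a, z, hz, ha⟩ := hφ.mapRingHom.exists_trivial c ρ hρ
  let e := Fintype.equivFin (Fin k ⊕ Fin l)
  let a' : Fin l → Fin k ⊕ Fin l → A[X] := fun i => Sum.elim (a i) fun j =>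
    if j = j₀ then 0 else (if i = j then c j₀ else 0) - if i = j₀ then c j else 0
  let z' : Fin k ⊕ Fin l → UP fun i => (Q i)[X] := Sum.elim (fun b => polyEmb Q (z b)) q
  refine ⟨_, fun i t => a' i (e.symm t), fun t => z' (e.symm t), fun i => ?_, fun t => ?_⟩
  · rw [Equiv.sum_comp e.symm (fun t => polyMap φ (a' i t) * z' t), Fintype.sum_sum_type]
    have h1 : ∑ b, polyMap φ (a' i (Sum.inl b)) * z' (Sum.inl b) = polyEmb Q (ρ i) := by
      rw [hz i, map_sum]
      simp only [map_mul]; rfl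
    rw [h1, ← Finset.add_sum_erase _ _ (Finset.mem_univ j₀)]
    have h2 : ∀ j ∈ Finset.univ.erase j₀, polyMap φ (a' i (Sum.inr j)) * z' (Sum.inr j) =
        (if i = j then polyMap φ (c j₀) * q j else 0) -
          if i = j₀ then polyMap φ (c j) * q j else 0 := by
      intro j hj
      simp only [a', z', Sum.elim_inr, if_neg (Finset.ne_of_mem_erase hj), map_sub]
      split_ifs <;> simp [sub_mul]
    rw [Finset.sum_congr rfl h2, Finset.sum_sub_distrib]
    by_cases hi : i = j₀
    · subst hi
      rw [Finset.sum_eq_zero (f := fun j => if i = j then polyMap φ (c i) * q j else 0)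
        (fun j hj => if_neg (Finset.ne_of_mem_erase hj).symm)]
      simp only [a', ρ, Function.update_self, if_true, Sum.elim_inr, map_zero, zero_mul, ← hy, hf₀]
      ring
    · simp only [if_neg hi, Finset.sum_const_zero, sub_zero, ρ, Function.update_of_ne hi]
      rw [Finset.sum_ite_eq, if_pos (Finset.mem_erase.2 ⟨hi, Finset.mem_univ _⟩), hqr' i]
      simp only [a', Sum.elim_inr, if_true, map_zero, zero_mul]
      ring
  · change ∑ i, c i * a' i (e.symm t) = 0
    rcases e.symm t with b | j
    · exact ha b
    · by_cases hj : j = j₀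
      · simp [a', hj]
      · simp only [a', Sum.elim_inr, if_neg hj, mul_sub, Finset.sum_sub_distrib, mul_ite, mul_zero,
          Finset.sum_ite_eq', Finset.mem_univ, if_true]
        ring

end Poly

end UP

end

section

namespace Nagata

open MvPolynomial

section
variable {R : Type u} [CommRing R] {n : ℕ}

/-- The substitution `X i ↦ X i + c X₀ ^ N ^ i` for `i ≠ 0`. -/
noncomputable def shift (R : Type u) [CommRing R] (n N : ℕ) (c : R) :
    MvPolynomial (Fin (n + 1)) R →ₐ[R] MvPolynomial (Fin (n + 1)) R :=
  aeval fun i => if i = 0 then X 0 else X i + C c * X 0 ^ N ^ (i : ℕ)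

theorem shift_comp (N : ℕ) (c : R) : (shift R n N c).comp (shift R n N (-c)) = AlgHom.id _ _ := by
  refine MvPolynomial.algHom_ext fun i => ?_
  cases i using Fin.cases <;> simp [shift, algHom_C]

/-- Nagata's change of variables. -/
noncomputable def equiv (R : Type u) [CommRing R] (n N : ℕ) :
    MvPolynomial (Fin (n + 1)) R ≃ₐ[R] MvPolynomial (Fin (n + 1)) R :=
  AlgEquiv.ofAlgHom (shift R n N 1) (shift R n N (-1)) (shift_comp N 1)
    (by simpa using shift_comp (R := R) (n := n) N (-1))

@[simp] theorem equiv_X_zero (N : ℕ) : equiv R n N (X 0) = X 0 := by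
  simp [equiv, shift]

@[simp] theorem equiv_X_succ (N : ℕ) (i : Fin n) :
    equiv R n N (X i.succ) = X i.succ + X 0 ^ N ^ (i.succ : ℕ) := by
  simp [equiv, shift]

/-- Nagata's change of variables followed by isolating the first variable. -/
noncomputable def polyEquiv (R : Type u) [CommRing R] (n N : ℕ) :
    MvPolynomial (Fin (n + 1)) R ≃ₐ[R] Polynomial (MvPolynomial (Fin n) R) :=
  (equiv R n N).trans (finSuccEquiv R n)

@[simp] theorem polyEquiv_C (N : ℕ) (r : R) : polyEquiv R n N (C r) = Polynomial.C (C r) := by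
  have := (polyEquiv R n N).commutes r
  simpa [algebraMap_eq, Polynomial.algebraMap_apply] using this

@[simp] theorem polyEquiv_X_zero (N : ℕ) : polyEquiv R n N (X 0) = Polynomial.X := by
  simp [polyEquiv, finSuccEquiv_X_zero]

@[simp] theorem polyEquiv_X_succ (N : ℕ) (i : Fin n) : polyEquiv R n N (X i.succ) =
    Polynomial.C (X i) + Polynomial.X ^ N ^ (i.succ : ℕ) := by
  simp [polyEquiv, finSuccEquiv_X_zero, finSuccEquiv_X_succ]

theorem polyEquiv_monomial [Nontrivial R] {N : ℕ} (hN : 0 < N) (v : Fin (n + 1) →₀ ℕ) (a : R) :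
    ∃ P : Polynomial (MvPolynomial (Fin n) R), P.Monic ∧
      P.natDegree = ∑ i : Fin (n + 1), N ^ (i : ℕ) * v i ∧
      polyEquiv R n N (monomial v a) = Polynomial.C (C a) * P := by
  have hi : ∀ i : Fin (n + 1), (polyEquiv R n N (X i)).Monic ∧
      (polyEquiv R n N (X i)).natDegree = N ^ (i : ℕ) := by
    intro i
    cases i using Fin.cases with
    | zero => rw [polyEquiv_X_zero]; exact ⟨Polynomial.monic_X, by simp⟩
    | succ i =>
      rw [polyEquiv_X_succ, add_comm]
      have : N ^ (i.succ : ℕ) ≠ 0 := (Nat.pow_pos hN).ne'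
      exact ⟨Polynomial.monic_X_pow_add_C _ this, Polynomial.natDegree_X_pow_add_C⟩
  refine ⟨∏ i, polyEquiv R n N (X i) ^ v i, Polynomial.monic_prod_of_monic _ _ fun i _ =>
    (hi i).1.pow _, ?_, ?_⟩
  · rw [Polynomial.natDegree_prod_of_monic _ _ fun i _ => (hi i).1.pow _]
    refine Finset.sum_congr rfl fun i _ => ?_
    rw [(hi i).1.natDegree_pow, (hi i).2, mul_comm]
  · rw [monomial_eq, Finsupp.prod_pow, map_mul, map_prod, polyEquiv_C]
    simp only [map_pow]

end

theorem sum_pow_mul_ne {n N : ℕ} (hN : 1 < N) {v w : Fin n →₀ ℕ}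
    (hv : ∀ i, v i < N) (hw : ∀ i, w i < N)
    (h : ∑ i : Fin n, N ^ (i : ℕ) * v i = ∑ i : Fin n, N ^ (i : ℕ) * w i) : v = w := by
  refine Finsupp.ext <| congrFun <| List.ofFn_inj.mp ?_
  apply Nat.ofDigits_inj_of_len_eq hN (by simp)
  · intro l hl
    obtain ⟨i, rfl⟩ := (List.mem_ofFn' _ _).1 hl
    exact hv i
  · intro l hl
    obtain ⟨i, rfl⟩ := (List.mem_ofFn' _ _).1 hl
    exact hw i
  · simpa only [Nat.ofDigits_eq_sum_mapIdx, List.mapIdx_eq_ofFn, List.get_ofFn, List.length_ofFn,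
      Fin.val_cast, mul_comm, List.sum_ofFn] using! h

theorem exists_monic {F : Type u} [Field F] {n : ℕ} {f : MvPolynomial (Fin (n + 1)) F}
    (hf : f ≠ 0) : ∃ (N : ℕ) (a : F), a ≠ 0 ∧
      (Polynomial.C (C a) * polyEquiv F n N f : Polynomial (MvPolynomial (Fin n) F)).Monic := by
  classical
  set N := 2 + f.totalDegree
  have hN : 1 < N := by omega
  choose P hP hdeg hmon using fun v : Fin (n + 1) →₀ ℕ =>
    polyEquiv_monomial (R := F) (by omega : 0 < N) v (coeff v f)
  have hlt : ∀ v ∈ f.support, ∀ i, v i < N := fun v hv i =>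
    ((monomial_le_degreeOf i hv).trans (degreeOf_le_totalDegree f i)).trans_lt (by omega)
  obtain ⟨v, hv, hmax⟩ := Finset.exists_max_image f.support (fun v => (P v).natDegree)
    (support_nonempty.mpr hf)
  have hv0 : coeff v f ≠ 0 := mem_support_iff.1 hv
  have hsum : polyEquiv F n N f = ∑ w ∈ f.support, Polynomial.C (C (coeff w f)) * P w := by
    conv_lhs => rw [f.as_sum, map_sum]
    exact Finset.sum_congr rfl fun w _ => hmon w
  refine ⟨N, (coeff v f)⁻¹, inv_ne_zero hv0, ?_⟩
  rw [hsum, ← Finset.add_sum_erase _ _ hv, mul_add, ← mul_assoc, ← Polynomial.C_mul, ← C_mul,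
    inv_mul_cancel₀ hv0, C_1, Polynomial.C_1, one_mul]
  have hC : ∀ (a : MvPolynomial (Fin n) F) (p : Polynomial (MvPolynomial (Fin n) F)),
      (Polynomial.C a * p).degree ≤ p.degree := fun a p => by
    rw [← Polynomial.smul_eq_C_mul]; exact Polynomial.degree_smul_le a p
  refine (hP v).add_of_left ?_
  refine (hC _ _).trans_lt ?_
  refine (Polynomial.degree_sum_le _ _).trans_lt ?_
  rw [Finset.sup_lt_iff (Ne.bot_lt (fun h => (hP v).ne_zero (Polynomial.degree_eq_bot.1 h)))]
  intro w hw
  refine (hC _ _).trans_lt ?_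
  rw [Finset.mem_erase] at hw
  refine Polynomial.degree_lt_degree (lt_of_le_of_ne (hmax w hw.2) fun h => hw.1 ?_)
  rw [hdeg, hdeg] at h
  exact sum_pow_mul_ne hN (hlt w hw.2) (hlt v hv) h

end Nagata

end

section

open Filter

namespace UP

section Emb

variable {K : ℕ → Type u} [∀ i, Field (K i)] {σ : Type}

/-- The embedding of polynomials over an ultraproduct into the ultraproduct of polynomials. -/
noncomputable def mvEmb (K : ℕ → Type u) [∀ i, Field (K i)] (σ : Type) :
    MvPolynomial σ (UP K) →+* UP fun i => MvPolynomial σ (K i) :=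
  MvPolynomial.eval₂Hom (UP.map fun _ => MvPolynomial.C) fun j => UP.mk fun _ => MvPolynomial.X j

@[simp] theorem mvEmb_C (a : UP K) :
    mvEmb K σ (MvPolynomial.C a) = UP.map (fun _ => MvPolynomial.C) a := by
  simp [mvEmb]

@[simp] theorem mvEmb_X (j : σ) :
    mvEmb K σ (MvPolynomial.X j) = UP.mk fun _ => MvPolynomial.X j := by
  simp [mvEmb]

open Nagata in
theorem polyMap_comp_polyEquiv (n N : ℕ) :
    (polyMap (mvEmb K (Fin n))).comp (polyEquiv (UP K) n N).toRingEquiv.toRingHom =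
      (UP.map fun i => (polyEquiv (K i) n N).toRingEquiv.toRingHom).comp
        (mvEmb K (Fin (n + 1))) := by
  refine MvPolynomial.ringHom_ext (fun r => ?_) fun j => ?_
  · obtain ⟨r, rfl⟩ := UP.mk_surj r
    simp [polyMap, UP.map_mk]
  · cases j using Fin.cases <;>
      simp [polyMap, UP.map_mk, ← UP.mk_pow, ← UP.mk_add]

theorem exists_trivial_of_forall_eq_zero {A : Type u} {B : Type v} [CommRing A] [CommRing B]
    (φ : A →+* B) {l : ℕ} {a : Fin l → A} (f : Fin l → B) (h : ∀ i, a i = 0) :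
    ∃ (k : ℕ) (c : Fin l → Fin k → A) (z : Fin k → B),
        (∀ i, f i = ∑ j, φ (c i j) * z j) ∧ ∀ j, ∑ i, a i * c i j = 0 := by
  classical
  refine ⟨l, fun i j => if i = j then 1 else 0, f, fun i => ?_, fun j => ?_⟩
  · rw [Finset.sum_eq_single i]
    · simp
    · intro j _ hj; simp [hj.symm]
    · simp
  · simp [h]

theorem flat_mvEmb_fin (n : ℕ) : (mvEmb K (Fin n)).Flat := by
  induction n with
  | zero =>
    have h1 : (UP.map fun i => (MvPolynomial.C : K i →+* MvPolynomial (Fin 0) (K i))).Flat := by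
      let _ := (UP.map fun i => (MvPolynomial.C : K i →+* MvPolynomial (Fin 0) (K i))).toAlgebra
      exact (inferInstance : Module.Flat (UP K) (UP fun i => MvPolynomial (Fin 0) (K i)))
    have h2 : (MvPolynomial.isEmptyRingEquiv (UP K) (Fin 0)).toRingHom.Flat :=
      RingHom.Flat.of_bijective (MvPolynomial.isEmptyRingEquiv (UP K) (Fin 0)).bijective
    convert h2.comp h1 using 1
    refine MvPolynomial.ringHom_ext (fun r => ?_) fun j => j.elim0
    have h3 : MvPolynomial.isEmptyRingEquiv (UP K) (Fin 0) (MvPolynomial.C r) = r :=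
      (RingEquiv.eq_symm_apply _).1 rfl
    rw [mvEmb_C]
    change _ = UP.map _ (MvPolynomial.isEmptyRingEquiv (UP K) (Fin 0) (MvPolynomial.C r))
    rw [h3]
  | succ n ih =>
    rw [RingHom.flat_iff_forall_trivial]
    intro l a f haf
    by_cases h0 : ∀ i, a i = 0
    · exact exists_trivial_of_forall_eq_zero _ f h0
    push Not at h0
    obtain ⟨j₀, hj₀⟩ := h0
    obtain ⟨N, u, hu, hmon⟩ := Nagata.exists_monic hj₀
    let T := (Nagata.polyEquiv (UP K) n N).toRingEquiv
    let T' := UP.map fun i => (Nagata.polyEquiv (K i) n N).toRingEquiv.toRingHom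
    have hT'inj : Function.Injective T' :=
      UP.map_injective _ fun i => (Nagata.polyEquiv (K i) n N).injective
    have hT'surj : Function.Surjective T' := fun y => by
      obtain ⟨y, rfl⟩ := UP.mk_surj y
      refine ⟨UP.mk fun i => (Nagata.polyEquiv (K i) n N).symm (y i), ?_⟩
      simp [T', UP.map_mk]
    have hcomm : ∀ x, polyMap (mvEmb K (Fin n)) (T x) = T' (mvEmb K (Fin (n + 1)) x) := fun x =>
      congrArg (fun F : _ →+* _ => F x) (polyMap_comp_polyEquiv n N)
    obtain ⟨k, c, z, hz, hc⟩ := exists_trivial_of_monic ih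
      (fun j => Polynomial.C (MvPolynomial.C u) * T (a j)) (fun j => T' (f j)) (by
        simp only [map_mul, hcomm, mul_assoc, ← Finset.mul_sum]
        simp only [← map_mul, ← map_sum, haf, map_zero, mul_zero]) j₀ hmon
    choose w hw using fun j => hT'surj (z j)
    refine ⟨k, fun i j => T.symm (c i j), w, fun i => hT'inj ?_, fun j => T.injective ?_⟩
    · rw [hz i, map_sum]
      refine Finset.sum_congr rfl fun j _ => ?_
      rw [map_mul, ← hcomm, hw, RingEquiv.apply_symm_apply]
    · have h1 := hc j
      simp only [mul_assoc, ← Finset.mul_sum] at h1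
      rw [map_sum, map_zero]
      simp only [map_mul, RingEquiv.apply_symm_apply]
      refine (mul_eq_zero.1 h1).resolve_left ?_
      simpa using hu

end Emb

section Noetherian

variable {A : Type u} [CommRing A] [IsNoetherianRing A] {B : ℕ → Type v} [∀ i, CommRing (B i)]
  {R : ℕ → Type w} [∀ i, CommRing (R i)]

/-- Flatness of a Noetherian ring over an ultraproduct propagates along levelwise flat maps. -/
theorem flat_map_comp {φ : A →+* UP B} (hφ : φ.Flat) (ρ : ∀ i, B i →+* R i)
    (hρ : ∀ᶠ i in (hyperfilter ℕ : Filter ℕ), (ρ i).Flat) : ((UP.map ρ).comp φ).Flat := by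
  classical
  rw [RingHom.flat_iff_forall_trivial]
  intro l a f haf
  let L : (Fin l → A) →ₗ[A] A := ∑ i, a i • LinearMap.proj i
  have hL : ∀ x, L x = ∑ i, a i * x i := fun x => by simp [L]
  obtain ⟨m, u, hu⟩ := Submodule.fg_iff_exists_fin_generating_family.1
    (IsNoetherian.noetherian (LinearMap.ker L))
  have hu0 : ∀ t, ∑ i, a i * u t i = 0 := fun t => by
    rw [← hL]
    have : u t ∈ LinearMap.ker L := hu ▸ Submodule.subset_span ⟨t, rfl⟩
    exact this
  have hker : ∀ x : Fin l → UP B, ∑ i, φ (a i) * x i = 0 →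
      ∃ y : Fin m → UP B, ∀ i, x i = ∑ t, φ (u t i) * y t := by
    intro x hx
    obtain ⟨k, c, z, hz, hc⟩ := hφ.exists_trivial a x hx
    have : ∀ j, ∃ d : Fin m → A, ∑ t, d t • u t = fun i => c i j := fun j => by
      rw [← Submodule.mem_span_range_iff_exists_fun, hu, LinearMap.mem_ker, hL]
      exact hc j
    choose d hd using this
    refine ⟨fun t => ∑ j, φ (d j t) * z j, fun i => ?_⟩
    simp only [hz i, Finset.mul_sum]
    rw [Finset.sum_comm]
    refine Finset.sum_congr rfl fun j _ => ?_
    rw [← congrFun (hd j) i]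
    simp only [Finset.sum_apply, Pi.smul_apply, smul_eq_mul, map_sum, map_mul, Finset.sum_mul]
    exact Finset.sum_congr rfl fun t _ => by ring
  choose a' ha' using fun i => UP.mk_surj (φ (a i))
  choose u' hu' using fun t i => UP.mk_surj (φ (u t i))
  have hlevel : ∀ᶠ n in (hyperfilter ℕ : Filter ℕ), ∀ x : Fin l → B n, ∑ i, a' i n * x i = 0 →
      ∃ y : Fin m → B n, ∀ i, x i = ∑ t, u' t i n * y t := by
    by_contra hcon
    rw [← Ultrafilter.eventually_not] at hcon
    have : ∀ n, ∃ x : Fin l → B n, (¬ ∀ x : Fin l → B n, ∑ i, a' i n * x i = 0 →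
      ∃ y : Fin m → B n, ∀ i, x i = ∑ t, u' t i n * y t) → ∑ i, a' i n * x i = 0 ∧
      ¬ ∃ y : Fin m → B n, ∀ i, x i = ∑ t, u' t i n * y t := fun n => by
      by_cases h : ∀ x : Fin l → B n, ∑ i, a' i n * x i = 0 →
        ∃ y : Fin m → B n, ∀ i, x i = ∑ t, u' t i n * y t
      · exact ⟨0, fun h' => absurd h h'⟩
      · have h2 := h
        push Not at h2
        obtain ⟨x, hx, hx2⟩ := h2
        exact ⟨x, fun _ => ⟨hx, by push Not; exact hx2⟩⟩
    choose x hx using this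
    obtain ⟨y, hy⟩ := hker (fun i => UP.mk fun n => x n i) (by
      simp only [← ha', ← UP.mk_mul, ← UP.mk_sum]
      rw [UP.mk_eq_zero]
      filter_upwards [hcon] with n hn
      exact (hx n hn).1)
    choose y' hy' using fun t => UP.mk_surj (y t)
    simp only [← hy', ← hu', ← UP.mk_mul, ← UP.mk_sum, UP.mk_eq] at hy
    obtain ⟨n, hn1, hn2⟩ := (hcon.and (Filter.eventually_all.2 hy)).exists
    exact (hx n hn1).2 ⟨fun t => y' t n, hn2⟩
  choose f' hf' using fun i => UP.mk_surj (f i)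
  simp only [RingHom.comp_apply, ← ha', ← hf', UP.map_mk, ← UP.mk_mul, ← UP.mk_sum,
    UP.mk_eq_zero] at haf
  have hz : ∀ᶠ n in (hyperfilter ℕ : Filter ℕ), ∃ z : Fin m → R n,
      ∀ i, f' i n = ∑ t, ρ n (u' t i n) * z t := by
    filter_upwards [hρ, hlevel, haf] with n h1 h2 h3
    obtain ⟨k, c, z, hz, hc⟩ := h1.exists_trivial _ _ h3
    choose y hy using fun j => h2 (fun i => c i j) (hc j)
    refine ⟨fun t => ∑ j, ρ n (y j t) * z j, fun i => ?_⟩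
    simp only [hz i, Finset.mul_sum]
    rw [Finset.sum_comm]
    refine Finset.sum_congr rfl fun j _ => ?_
    rw [hy j i]
    simp only [map_sum, map_mul, Finset.sum_mul]
    exact Finset.sum_congr rfl fun t _ => by ring
  choose! z hz using fun n (hn : ∃ z : Fin m → R n, ∀ i, f' i n = ∑ t, ρ n (u' t i n) * z t) => hn
  refine ⟨m, fun i t => u t i, fun t => UP.mk fun n => z n t, fun i => ?_, hu0⟩
  simp only [RingHom.comp_apply, ← hu', ← hf', UP.map_mk, ← UP.mk_mul, ← UP.mk_sum, UP.mk_eq]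
  filter_upwards [‹∀ᶠ n in (hyperfilter ℕ : Filter ℕ), ∃ z : Fin m → R n,
      ∀ i, f' i n = ∑ t, ρ n (u' t i n) * z t›] with n hn
  exact hz n hn i

end Noetherian

end UP

end

section

namespace MvPolynomial

variable {K : Type u} [Field K] {σ : Type v}

/-- Translation by a point, as an algebra endomorphism of a polynomial ring. -/
noncomputable def translate (w : σ → K) : MvPolynomial σ K →ₐ[K] MvPolynomial σ K :=
  aeval fun k => X k + C (w k)

@[simp] theorem translate_X (w : σ → K) (k : σ) : translate w (X k) = X k + C (w k) := by
  simp [translate]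

/-- The derivative in the direction of a vector. -/
noncomputable def dirDeriv (w : σ → K) : Derivation K (MvPolynomial σ K) (MvPolynomial σ K) :=
  mkDerivation K fun k => C (w k)

theorem coeff_mul_eq_zero_of_degree {a b : ℕ} {f g : MvPolynomial σ K}
    (hf : ∀ m, a ≤ m.degree → coeff m f = 0) (hg : ∀ m, b + 1 ≤ m.degree → coeff m g = 0)
    (m : σ →₀ ℕ) (hm : a + b ≤ m.degree) : coeff m (f * g) = 0 := by
  classical
  rw [coeff_mul]
  refine Finset.sum_eq_zero fun x hx => ?_
  have h1 : x.1.degree + x.2.degree = m.degree := by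
    rw [← Finset.HasAntidiagonal.mem_antidiagonal.1 hx, map_add]
  by_cases h : a ≤ x.1.degree
  · rw [hf _ h, zero_mul]
  · rw [hg _ (by omega), mul_zero]

theorem coeff_eq_zero_of_isHomogeneous {a : ℕ} {f : MvPolynomial σ K} (hf : f.IsHomogeneous a)
    (m : σ →₀ ℕ) (hm : m.degree ≠ a) : coeff m f = 0 := by
  by_contra h
  have := hf h
  rw [Finsupp.degree_eq_weight_one] at hm
  exact hm this

theorem totalDegree_le_of_coeff {n : ℕ} {f : MvPolynomial σ K}
    (h : ∀ m, n + 1 ≤ m.degree → coeff m f = 0) : f.totalDegree ≤ n := by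
  rw [totalDegree]
  refine Finset.sup_le fun m hm => ?_
  by_contra hlt
  exact (mem_support_iff.1 hm) (h m (by
    rw [Finsupp.degree_apply]
    have h2 : n < m.sum fun _ e => e := not_le.1 hlt
    exact h2))

theorem coeff_translate_sub (w : σ → K) {n : ℕ} {f : MvPolynomial σ K} (hf : f.IsHomogeneous n) :
    ∀ m, n ≤ m.degree → coeff m (translate w f - f) = 0 := by
  classical
  have key : ∀ s : σ →₀ ℕ, ∀ m : σ →₀ ℕ, s.degree ≤ m.degree →
      coeff m (translate w (monomial s 1) - monomial s 1) = 0 := by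
    have hadd : ∀ s t : σ →₀ ℕ, (∀ m : σ →₀ ℕ, s.degree ≤ m.degree →
        coeff m (translate w (monomial s (1 : K)) - monomial s 1) = 0) →
        (∀ m : σ →₀ ℕ, t.degree ≤ m.degree →
        coeff m (translate w (monomial t (1 : K)) - monomial t 1) = 0) →
        ∀ m : σ →₀ ℕ, (s + t).degree ≤ m.degree →
        coeff m (translate w (monomial (s + t) (1 : K)) - monomial (s + t) 1) = 0 := by
      intro s t hs ht m hm
      have e1 : (monomial (s + t) (1 : K)) = monomial s 1 * monomial t 1 := by
        rw [monomial_mul, one_mul]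
      have e2 : translate w (monomial (s + t) (1 : K)) - monomial (s + t) 1 =
          (translate w (monomial s (1 : K)) - monomial s 1) * translate w (monomial t (1 : K)) +
          (translate w (monomial t (1 : K)) - monomial t 1) * monomial s 1 := by
        rw [e1, map_mul]; ring
      have e3 : ∀ (s m : σ →₀ ℕ), s.degree + 1 ≤ m.degree →
          coeff m (monomial s (1 : K)) = 0 := fun s m h => by
        rw [coeff_monomial, if_neg]
        rintro rfl
        omega
      rw [map_add] at hm
      rw [e2, coeff_add, coeff_mul_eq_zero_of_degree hs (b := t.degree) ?_ m hm,
        coeff_mul_eq_zero_of_degree ht (e3 s) m (by omega), add_zero]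
      intro m hm
      have := ht m (by omega)
      rw [coeff_sub, e3 t m hm, sub_zero] at this
      exact this
    intro s
    have h0 : ∀ m : σ →₀ ℕ, (0 : σ →₀ ℕ).degree ≤ m.degree →
        coeff m (translate w (monomial (0 : σ →₀ ℕ) (1 : K)) - monomial 0 1) = 0 := by
      intro m _
      change coeff m (translate w 1 - 1) = 0
      simp
    induction s using Finsupp.induction_linear with
    | zero => exact h0
    | add s t hs ht => exact hadd s t hs ht
    | single k n =>
      induction n with
      | zero => simp
      | succ n ih =>
        rw [Finsupp.single_add]
        refine hadd _ _ ih fun m hm => ?_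
        change coeff m (translate w (X k) - X k) = 0
        rw [translate_X, add_sub_cancel_left, coeff_C, if_neg]
        rintro rfl
        simp at hm
  intro m hm
  rw [f.as_sum, map_sum, ← Finset.sum_sub_distrib, coeff_sum]
  refine Finset.sum_eq_zero fun s hs => ?_
  have hs1 : s.degree = n := by
    by_contra h
    exact (mem_support_iff.1 hs) (coeff_eq_zero_of_isHomogeneous hf s h)
  have e : monomial s (coeff s f) = coeff s f • monomial s (1 : K) := by
    rw [smul_monomial, smul_eq_mul, mul_one]
  rw [e, map_smul, ← smul_sub, coeff_smul, key s m (by omega), smul_zero]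

theorem translate_isHomogeneous_comp (w : σ → K) {n : ℕ} {f : MvPolynomial σ K}
    (hf : f.IsHomogeneous n) : homogeneousComponent n (translate w f) = f := by
  ext m
  rw [coeff_homogeneousComponent]
  split_ifs with h
  · have := coeff_translate_sub w hf m h.ge
    rwa [coeff_sub, sub_eq_zero] at this
  · exact (coeff_eq_zero_of_isHomogeneous hf m h).symm

theorem homogeneousComponent_translate_gt (w : σ → K) {n k : ℕ} {f : MvPolynomial σ K}
    (hf : f.IsHomogeneous n) (hk : n < k) : homogeneousComponent k (translate w f) = 0 := by
  ext m
  rw [coeff_homogeneousComponent]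
  split_ifs with h
  · have := coeff_translate_sub w hf m (by omega)
    rw [coeff_sub, coeff_eq_zero_of_isHomogeneous hf m (by omega), sub_zero] at this
    simpa using this
  · simp

theorem totalDegree_translate_le (w : σ → K) (f : MvPolynomial σ K) :
    (translate w f).totalDegree ≤ f.totalDegree := by
  classical
  conv_lhs => rw [← sum_homogeneousComponent f, map_sum]
  refine (totalDegree_finsetSum _ _).trans (Finset.sup_le fun n hn => ?_)
  refine totalDegree_le_of_coeff fun m hm => ?_
  have hn' := Finset.mem_range.1 hn
  have hh := homogeneousComponent_isHomogeneous n f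
  have := coeff_translate_sub w hh m (by omega)
  rw [coeff_sub, coeff_eq_zero_of_isHomogeneous hh m (by omega), sub_zero] at this
  exact this

theorem isHomogeneous_dirDeriv (w : σ → K) {n : ℕ} {f : MvPolynomial σ K}
    (hf : f.IsHomogeneous (n + 1)) : (dirDeriv w f).IsHomogeneous n := by
  classical
  rw [f.as_sum, map_sum]
  refine IsHomogeneous.sum _ _ _ fun s hs => ?_
  have hs1 : s.degree = n + 1 := by
    by_contra h
    exact (mem_support_iff.1 hs) (coeff_eq_zero_of_isHomogeneous hf s h)
  rw [dirDeriv, mkDerivation_monomial, smul_eq_C_mul]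
  have h2 : (s.sum fun i k => monomial (s - Finsupp.single i 1) (k : K) • C (w i) :
      MvPolynomial σ K).IsHomogeneous n := by
    refine IsHomogeneous.sum _ _ _ fun i hi => ?_
    change (monomial (s - Finsupp.single i 1) (s i : K) * C (w i)).IsHomogeneous n
    have h3 : (s - Finsupp.single i 1).degree = n := by
      have h4 : Finsupp.single i 1 ≤ s := by
        rw [Finsupp.single_le_iff]
        exact Nat.one_le_iff_ne_zero.2 (Finsupp.mem_support_iff.1 hi)
      have h5 := congrArg Finsupp.degree (tsub_add_cancel_of_le h4)
      rw [map_add, Finsupp.degree_single] at h5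
      omega
    simpa using (isHomogeneous_monomial (s i : K) h3).mul (isHomogeneous_C σ (w i))
  simpa using (isHomogeneous_C σ (coeff s f)).mul h2

theorem exists_translate_ne [Infinite K] {n : ℕ} (hn : n ≠ 0) {f : MvPolynomial σ K}
    (hf : f.IsHomogeneous n) (h0 : f ≠ 0) : ∃ w, translate w f ≠ f := by
  by_contra! h
  refine h0 (funext fun x => ?_)
  have h1 : eval 0 (translate x f) = eval x f := by
    rw [translate, ← coe_aeval_eq_eval, ← coe_aeval_eq_eval]
    change ((aeval (0 : σ → K)).comp (aeval fun k => X k + C (x k))) f = aeval x f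
    congr 1
    refine algHom_ext fun k => ?_
    simp
  rw [h x] at h1
  rw [← h1, map_zero, eval_zero, constantCoeff_eq]
  exact coeff_eq_zero_of_isHomogeneous hf 0 (by simpa using hn.symm)

theorem exists_pow_of_pderiv_eq_zero (p : ℕ) [hp : Fact p.Prime] [CharP K p] [PerfectRing K p]
    {f : MvPolynomial σ K} (h : ∀ w, dirDeriv w f = 0) :
    ∃ g : MvPolynomial σ K, g ^ p = f ∧ g.totalDegree ≤ f.totalDegree := by
  classical
  have hdvd : ∀ s ∈ f.support, ∀ k, p ∣ s k := by
    intro s hs k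
    by_contra hk
    have hk1 : Finsupp.single k 1 ≤ s := by
      rw [Finsupp.single_le_iff, Nat.one_le_iff_ne_zero]
      rintro h0
      exact hk (h0 ▸ dvd_zero p)
    have h1 := h (Pi.single k 1)
    have h2 : dirDeriv (Pi.single k (1 : K)) = pderiv k := by
      refine derivation_ext fun i => ?_
      rw [dirDeriv, mkDerivation_X, pderiv_X]
      by_cases hik : i = k
      · subst hik; simp
      · simp [hik]
    rw [h2] at h1
    have h3 := coeff_pderiv (i := k) f (s - Finsupp.single k 1)
    rw [h1, tsub_add_cancel_of_le hk1, coeff_zero] at h3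
    have h4 : (((s - Finsupp.single k 1 : σ →₀ ℕ) k : ℕ) : K) + 1 = (s k : K) := by
      rw [Finsupp.tsub_apply, Finsupp.single_eq_same, ← Nat.cast_succ, Nat.succ_eq_add_one]
      congr 1
      have := hk1 k
      rw [Finsupp.single_eq_same] at this
      omega
    rw [h4] at h3
    rcases mul_eq_zero.1 h3.symm with h5 | h5
    · exact mem_support_iff.1 hs h5
    · exact hk ((CharP.cast_eq_zero_iff K p _).1 h5)
  refine ⟨∑ s ∈ f.support, monomial (s.mapRange (· / p) (Nat.zero_div _))
    ((frobeniusEquiv K p).symm (coeff s f)), ?_, ?_⟩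
  · rw [sum_pow_char]
    conv_rhs => rw [f.as_sum]
    refine Finset.sum_congr rfl fun s hs => ?_
    rw [monomial_pow]
    congr 1
    · congr 1
      ext k
      simp [Nat.mul_div_cancel' (hdvd s hs k)]
    · rw [← frobenius_def, frobenius_apply_frobeniusEquiv_symm]
  · refine (totalDegree_finsetSum _ _).trans (Finset.sup_le fun s hs => ?_)
    refine (totalDegree_monomial_le _ _).trans ?_
    refine le_trans ?_ (le_totalDegree hs)
    rw [Finsupp.sum_mapRange_index (by simp)]
    exact Finset.sum_le_sum fun k _ => Nat.div_le_self _ _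

end MvPolynomial

end

section

open Filter

namespace UP

section Poly

variable (K : ℕ → Type u) [∀ i, Field (K i)] (σ : ℕ → Type)

/-- The ultraproduct of a sequence of polynomial rings. -/
abbrev Poly : Type u := UP fun i => MvPolynomial (σ i) (K i)

noncomputable instance : Algebra (UP K) (Poly K σ) := (UP.map fun _ => MvPolynomial.C).toAlgebra

variable {K σ}

theorem algebraMap_mk (c : ∀ i, K i) :
    algebraMap (UP K) (Poly K σ) (mk c) = mk fun i => MvPolynomial.C (c i) := map_mk _ _

theorem mk_smul (c : ∀ i, K i) (f : ∀ i, MvPolynomial (σ i) (K i)) :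
    (mk c : UP K) • (mk f : Poly K σ) = mk fun i => c i • f i := by
  rw [Algebra.smul_def, algebraMap_mk, ← mk_mul]
  simp only [MvPolynomial.smul_eq_C_mul]

/-- The linear endomorphism of an ultraproduct of polynomial rings induced levelwise. -/
noncomputable def mapLin (φ : ∀ i, MvPolynomial (σ i) (K i) →ₗ[K i] MvPolynomial (σ i) (K i)) :
    Poly K σ →ₗ[UP K] Poly K σ where
  toFun := map₀ fun i => φ i
  map_add' x y := by
    obtain ⟨f, rfl⟩ := mk_surj x
    obtain ⟨g, rfl⟩ := mk_surj y
    rw [← mk_add, map₀_mk, map₀_mk, map₀_mk, ← mk_add]; simp only [map_add]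
  map_smul' c x := by
    obtain ⟨c, rfl⟩ := mk_surj c
    obtain ⟨f, rfl⟩ := mk_surj x
    rw [mk_smul, map₀_mk, map₀_mk, RingHom.id_apply, mk_smul]; simp only [map_smul]

@[simp] theorem mapLin_mk (φ : ∀ i, MvPolynomial (σ i) (K i) →ₗ[K i] MvPolynomial (σ i) (K i))
    (f : ∀ i, MvPolynomial (σ i) (K i)) : mapLin φ (mk f) = mk fun i => φ i (f i) := map₀_mk _ f

variable (K σ) in
/-- The elements of bounded degree in an ultraproduct of polynomial rings. -/
noncomputable def bdd : Subalgebra (UP K) (Poly K σ) where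
  carrier := {x | ∃ f d, mk f = x ∧ ∀ i, (f i).totalDegree ≤ d}
  mul_mem' := by
    rintro _ _ ⟨f, d, rfl, hf⟩ ⟨g, e, rfl, hg⟩
    exact ⟨_, d + e, mk_mul f g, fun i => (MvPolynomial.totalDegree_mul _ _).trans
      (add_le_add (hf i) (hg i))⟩
  add_mem' := by
    rintro _ _ ⟨f, d, rfl, hf⟩ ⟨g, e, rfl, hg⟩
    exact ⟨_, max d e, mk_add f g, fun i => (MvPolynomial.totalDegree_add _ _).trans
      (max_le_max (hf i) (hg i))⟩
  algebraMap_mem' c := by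
    obtain ⟨c, rfl⟩ := mk_surj c
    exact ⟨_, 0, (algebraMap_mk c).symm, fun i => by simp⟩

theorem mem_bdd {x : Poly K σ} :
    x ∈ bdd K σ ↔ ∃ f d, mk f = x ∧ ∀ i, (f i).totalDegree ≤ d := Iff.rfl

theorem mk_mem_bdd {f : ∀ i, MvPolynomial (σ i) (K i)} (d : ℕ)
    (h : ∀ᶠ i in (hyperfilter ℕ : Filter ℕ), (f i).totalDegree ≤ d) : mk f ∈ bdd K σ := by
  classical
  refine ⟨fun i => if (f i).totalDegree ≤ d then f i else 0, d, mk_eq.2 ?_, fun i => ?_⟩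
  · filter_upwards [h] with i hi
    rw [if_pos hi]
  · dsimp only
    split_ifs with h
    · exact h
    · simp

/-- The homogeneous component of an element of an ultraproduct of polynomial rings. -/
noncomputable def comp (n : ℕ) : Poly K σ →ₗ[UP K] Poly K σ :=
  mapLin fun _ => MvPolynomial.homogeneousComponent n

theorem comp_mk (n : ℕ) (f : ∀ i, MvPolynomial (σ i) (K i)) :
    comp n (mk f) = mk fun i => MvPolynomial.homogeneousComponent n (f i) := mapLin_mk _ _

theorem comp_mk_eq_self {n : ℕ} {f : ∀ i, MvPolynomial (σ i) (K i)} :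
    comp n (mk f) = mk f ↔ ∀ᶠ i in (hyperfilter ℕ : Filter ℕ), (f i).IsHomogeneous n := by
  rw [comp_mk, mk_eq]
  refine eventually_congr (Eventually.of_forall fun i => ⟨fun h => ?_, fun h => ?_⟩)
  · rw [← h]; exact MvPolynomial.homogeneousComponent_isHomogeneous n _
  · exact MvPolynomial.homogeneousComponent_eq_self h

theorem comp_mem_bdd (n : ℕ) (x : Poly K σ) : comp n x ∈ bdd K σ := by
  obtain ⟨f, rfl⟩ := mk_surj x
  rw [comp_mk]
  exact ⟨_, n, rfl, fun i => (MvPolynomial.homogeneousComponent_isHomogeneous n _).totalDegree_le⟩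

theorem comp_comp (m n : ℕ) (x : Poly K σ) : comp m (comp n x) = if m = n then comp n x else 0 := by
  obtain ⟨f, rfl⟩ := mk_surj x
  rw [comp_mk, comp_mk]
  split_ifs with h
  · subst h
    refine mk_eq.2 (Eventually.of_forall fun i => MvPolynomial.homogeneousComponent_eq_self
      (MvPolynomial.homogeneousComponent_isHomogeneous _ _))
  · refine mk_eq_zero.2 (Eventually.of_forall fun i => ?_)
    rw [MvPolynomial.homogeneousComponent_of_mem
      (MvPolynomial.homogeneousComponent_isHomogeneous n _), if_neg h]

theorem comp_mul {a b : ℕ} {x y : Poly K σ} (hx : comp a x = x) (hy : comp b y = y) :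
    comp (a + b) (x * y) = x * y := by
  obtain ⟨f, rfl⟩ := mk_surj x
  obtain ⟨g, rfl⟩ := mk_surj y
  rw [comp_mk_eq_self] at hx hy
  rw [← mk_mul, comp_mk_eq_self]
  filter_upwards [hx, hy] with i h1 h2
  exact h1.mul h2

theorem exists_comp_bound {x : Poly K σ} (hx : x ∈ bdd K σ) :
    ∃ N, (∀ n ≥ N, comp n x = 0) ∧ ∑ n ∈ Finset.range N, comp n x = x := by
  obtain ⟨f, d, rfl, hf⟩ := hx
  refine ⟨d + 1, fun n hn => ?_, ?_⟩
  · rw [comp_mk]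
    refine mk_eq_zero.2 (Eventually.of_forall fun i =>
      MvPolynomial.homogeneousComponent_eq_zero _ _ ?_)
    have := hf i
    omega
  · simp only [comp_mk, ← mk_sum]
    refine mk_eq.2 (Eventually.of_forall fun i => ?_)
    conv_rhs => rw [← MvPolynomial.sum_homogeneousComponent (f i)]
    refine (Finset.sum_subset (Finset.range_mono (by have := hf i; omega)) fun n _ hn => ?_).symm
    exact MvPolynomial.homogeneousComponent_eq_zero _ _ (by
      rw [Finset.mem_range] at hn; omega)

theorem sum_comp {x : Poly K σ} (hx : x ∈ bdd K σ) {N : ℕ} (h : ∀ n ≥ N, comp n x = 0) :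
    ∑ n ∈ Finset.range N, comp n x = x := by
  obtain ⟨M, h1, h2⟩ := exists_comp_bound hx
  conv_rhs => rw [← h2]
  rcases le_total N M with hNM | hNM
  · refine Finset.sum_subset (Finset.range_mono hNM) fun n _ hn => h n ?_
    simpa using hn
  · refine (Finset.sum_subset (Finset.range_mono hNM) fun n _ hn => h1 n ?_).symm
    simpa using hn

/-- Translation by a point of an ultraproduct of affine spaces. -/
noncomputable def translate (w : ∀ i, σ i → K i) : Poly K σ →ₐ[UP K] Poly K σ :=
  { UP.map fun i => (MvPolynomial.translate (w i)).toRingHom with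
    commutes' := fun c => by
      obtain ⟨c, rfl⟩ := mk_surj c
      change UP.map _ _ = _
      rw [algebraMap_mk, map_mk]
      refine mk_eq.2 (Eventually.of_forall fun i => ?_)
      exact (MvPolynomial.translate (w i)).commutes (c i) }

theorem translate_mk (w : ∀ i, σ i → K i) (f : ∀ i, MvPolynomial (σ i) (K i)) :
    translate w (mk f) = mk fun i => MvPolynomial.translate (w i) (f i) := map_mk _ _

theorem translate_mem_bdd (w : ∀ i, σ i → K i) {x : Poly K σ} (hx : x ∈ bdd K σ) :
    translate w x ∈ bdd K σ := by
  obtain ⟨f, d, rfl, hf⟩ := hx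
  rw [translate_mk]
  exact ⟨_, d, rfl, fun i => (MvPolynomial.totalDegree_translate_le _ _).trans (hf i)⟩

/-- Differentiation along a vector of an ultraproduct of affine spaces. -/
noncomputable def deriv (w : ∀ i, σ i → K i) : Derivation (UP K) (Poly K σ) (Poly K σ) :=
  Derivation.mk' (mapLin fun i => (MvPolynomial.dirDeriv (w i)).toLinearMap) fun x y => by
    obtain ⟨f, rfl⟩ := mk_surj x
    obtain ⟨g, rfl⟩ := mk_surj y
    rw [← mk_mul, mapLin_mk, mapLin_mk, mapLin_mk, smul_eq_mul, smul_eq_mul, ← mk_mul, ← mk_mul,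
      ← mk_add]
    refine mk_eq.2 (Eventually.of_forall fun i => ?_)
    exact (MvPolynomial.dirDeriv (w i)).leibniz (f i) (g i)

theorem deriv_mk (w : ∀ i, σ i → K i) (f : ∀ i, MvPolynomial (σ i) (K i)) :
    deriv w (mk f) = mk fun i => MvPolynomial.dirDeriv (w i) (f i) := mapLin_mk _ _

theorem comp_deriv (w : ∀ i, σ i → K i) {n : ℕ} {x : Poly K σ} (hx : comp (n + 1) x = x) :
    comp n (deriv w x) = deriv w x := by
  obtain ⟨f, rfl⟩ := mk_surj x
  rw [comp_mk_eq_self] at hx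
  rw [deriv_mk, comp_mk_eq_self]
  filter_upwards [hx] with i hi
  exact MvPolynomial.isHomogeneous_dirDeriv _ hi

theorem deriv_mem_bdd (w : ∀ i, σ i → K i) {x : Poly K σ} (hx : x ∈ bdd K σ) :
    deriv w x ∈ bdd K σ := by
  obtain ⟨N, -, h⟩ := exists_comp_bound hx
  rw [← h, map_sum]
  refine Subalgebra.sum_mem _ fun n _ => ?_
  cases n with
  | zero =>
    obtain ⟨f, rfl⟩ := mk_surj x
    rw [comp_mk, deriv_mk]
    simp only [MvPolynomial.homogeneousComponent_zero, MvPolynomial.derivation_C]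
    rw [mk_zero]
    exact Subalgebra.zero_mem _
  | succ n =>
    rw [← comp_deriv w (n := n) (by rw [comp_comp, if_pos rfl])]
    exact comp_mem_bdd _ _

theorem exists_translate_ne [∀ i, Infinite (K i)] {n : ℕ} (hn : n ≠ 0) {x : Poly K σ}
    (hx : comp n x = x) (h : ∀ w, translate w x = x) : x = 0 := by
  obtain ⟨f, rfl⟩ := mk_surj x
  rw [comp_mk_eq_self] at hx
  have : ∀ i, ∃ w, (f i).IsHomogeneous n → MvPolynomial.translate w (f i) = f i → f i = 0 := by
    intro i
    by_cases h1 : (f i).IsHomogeneous n ∧ f i ≠ 0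
    · obtain ⟨w, hw⟩ := MvPolynomial.exists_translate_ne hn h1.1 h1.2
      exact ⟨w, fun _ h2 => absurd h2 hw⟩
    · refine ⟨0, fun h2 _ => ?_⟩
      by_contra h3
      exact h1 ⟨h2, h3⟩
  choose w hw using this
  have h1 := h w
  rw [translate_mk, mk_eq] at h1
  rw [mk_eq_zero]
  filter_upwards [hx, h1] with i h2 h3
  exact hw i h2 h3

theorem exists_pow_of_deriv_eq_zero [∀ i, IsAlgClosed (K i)] (p : ℕ) [ExpChar (UP K) p]
    {x : Poly K σ} (hx : x ∈ bdd K σ) (h : ∀ w, deriv w x = 0) :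
    ∃ y ∈ bdd K σ, y ^ p = x := by
  classical
  cases ‹ExpChar (UP K) p› with
  | zero => exact ⟨x, hx, pow_one x⟩
  | prime hp =>
    obtain ⟨f, d, rfl, hf⟩ := hx
    have hchar : ∀ᶠ i in (hyperfilter ℕ : Filter ℕ), CharP (K i) p := by
      have h0 : ((p : ℕ) : UP K) = 0 := CharP.cast_eq_zero _ _
      rw [← mk_natCast, mk_eq_zero] at h0
      filter_upwards [h0] with i hi
      exact (CharP.charP_iff_prime_eq_zero hp).2 hi
    have : ∀ i, ∃ w, MvPolynomial.dirDeriv w (f i) = 0 →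
        ∀ w, MvPolynomial.dirDeriv w (f i) = 0 := by
      intro i
      by_cases h1 : ∀ w, MvPolynomial.dirDeriv w (f i) = 0
      · exact ⟨0, fun _ => h1⟩
      · push Not at h1
        obtain ⟨w, hw⟩ := h1
        exact ⟨w, fun h2 => absurd h2 hw⟩
    choose w hw using this
    have h1 := h w
    rw [deriv_mk, mk_eq_zero] at h1
    have h2 : ∀ᶠ i in (hyperfilter ℕ : Filter ℕ), ∃ g : MvPolynomial (σ i) (K i),
        g ^ p = f i ∧ g.totalDegree ≤ d := by
      filter_upwards [hchar, h1] with i h3 h4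
      have := Fact.mk hp
      obtain ⟨g, hg, hg2⟩ := MvPolynomial.exists_pow_of_pderiv_eq_zero p (hw i h4)
      exact ⟨g, hg, hg2.trans (hf i)⟩
    choose! g hg using fun i (hi : ∃ g : MvPolynomial (σ i) (K i),
        g ^ p = f i ∧ g.totalDegree ≤ d) => hi
    refine ⟨mk g, mk_mem_bdd d ?_, ?_⟩
    · filter_upwards [h2] with i hi
      exact (hg i hi).2
    · rw [← mk_pow, mk_eq]
      filter_upwards [h2] with i hi
      exact (hg i hi).1

variable (K σ) in
/-- Bounded degree elements carry the structure of a graded algebra with translations. -/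
noncomputable def graded [∀ i, IsAlgClosed (K i)] (p : ℕ) [ExpChar (UP K) p] :
    GradedTranslation (UP K) (bdd K σ) (∀ i, σ i → K i) p where
  comp n := (comp n).restrict (p := (bdd K σ).toSubmodule) (q := (bdd K σ).toSubmodule)
    fun x _ => comp_mem_bdd n x
  comp_comp m n f := by
    refine Subtype.ext ((comp_comp m n (f : Poly K σ)).trans ?_)
    split_ifs <;> rfl
  exists_bound f := by
    obtain ⟨N, hN, -⟩ := exists_comp_bound f.2
    exact ⟨N, fun n hn => Subtype.ext (hN n hn)⟩
  sum_comp f N h := by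
    refine Subtype.ext ?_
    rw [AddSubmonoidClass.coe_finsetSum]
    exact sum_comp f.2 fun n hn => congrArg Subtype.val (h n hn)
  hom_mul a b f g hf hg := Subtype.ext
    (comp_mul (congrArg Subtype.val hf) (congrArg Subtype.val hg))
  hom_zero f hf := by
    obtain ⟨g, hg⟩ := mk_surj (f : Poly K σ)
    have h1 : comp 0 (f : Poly K σ) = f := congrArg Subtype.val hf
    rw [← hg, comp_mk] at h1
    refine ⟨mk fun i => MvPolynomial.coeff 0 (g i), Subtype.ext ?_⟩
    simp only [MvPolynomial.homogeneousComponent_zero] at h1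
    rw [← hg, ← h1]
    exact algebraMap_mk _
  hom_one := by
    refine Subtype.ext ?_
    change comp 0 (1 : Poly K σ) = 1
    rw [← mk_one, comp_mk_eq_self]
    exact Eventually.of_forall fun i => MvPolynomial.isHomogeneous_one _ _
  τ w := ((translate w).comp (bdd K σ).val).codRestrict (bdd K σ)
    fun x => translate_mem_bdd w x.2
  comp_τ w n f hf := by
    refine Subtype.ext ?_
    have h1 : comp n (f : Poly K σ) = f := congrArg Subtype.val hf
    change comp n (translate w (f : Poly K σ)) = f
    obtain ⟨g, hg⟩ := mk_surj (f : Poly K σ)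
    rw [← hg, comp_mk_eq_self] at h1
    rw [← hg, translate_mk, comp_mk, mk_eq]
    filter_upwards [h1] with i hi
    exact MvPolynomial.translate_isHomogeneous_comp _ hi
  comp_τ_gt w n m f hf hnm := by
    refine Subtype.ext ?_
    have h1 : comp n (f : Poly K σ) = f := congrArg Subtype.val hf
    change comp m (translate w (f : Poly K σ)) = 0
    obtain ⟨g, hg⟩ := mk_surj (f : Poly K σ)
    rw [← hg, comp_mk_eq_self] at h1
    rw [← hg, translate_mk, comp_mk, mk_eq_zero]
    filter_upwards [h1] with i hi
    exact MvPolynomial.homogeneousComponent_translate_gt _ hi hnm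
  eq_zero_of_τ n f hf hn h := by
    have : ∀ i, Infinite (K i) := fun i => IsAlgClosed.instInfinite
    exact Subtype.ext (exists_translate_ne hn (congrArg Subtype.val hf)
      fun w => congrArg Subtype.val (h w))
  D w := Derivation.mk' ((deriv w).toLinearMap.restrict (p := (bdd K σ).toSubmodule)
    (q := (bdd K σ).toSubmodule) fun x hx => deriv_mem_bdd w hx)
    fun x y => Subtype.ext ((deriv w).leibniz (x : Poly K σ) (y : Poly K σ))
  hom_D w n f hf := Subtype.ext (comp_deriv w (congrArg Subtype.val hf))
  exists_pow f h := by
    obtain ⟨y, hy, hy2⟩ := exists_pow_of_deriv_eq_zero p f.2 fun w => congrArg Subtype.val (h w)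
    exact ⟨⟨y, hy⟩, Subtype.ext hy2⟩

end Poly

end UP

end

section

open Filter

namespace UP

section Flat

variable (K : ℕ → Type u) [∀ i, Field (K i)] (σ : ℕ → Type)

/-- Homogeneous polynomial generators of the ring of bounded degree elements. -/
structure IsFrame (B : Set (bdd K σ)) : Prop where
  hom : ∀ b ∈ B, ∃ e, e ≠ 0 ∧ comp e (b : Poly K σ) = b
  indep : AlgebraicIndependent (UP K) (Subtype.val : B → bdd K σ)
  adjoin : Algebra.adjoin (UP K) B = ⊤

variable {K σ}

theorem exists_isFrame [∀ i, IsAlgClosed (K i)] : ∃ B, IsFrame K σ B := by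
  obtain ⟨p, hp⟩ := ExpChar.exists (UP K)
  have hinj : Function.Injective (algebraMap (UP K) (bdd K σ)) := RingHom.injective _
  have : ExpChar (bdd K σ) p := expChar_of_injective_algebraMap hinj p
  obtain ⟨B, hB, hB2⟩ := GradedTranslation.exists_good (graded K σ p)
  refine ⟨B, fun b hb => ?_, hB.indep, hB2⟩
  obtain ⟨e, he, h, -⟩ := hB.hom b hb
  exact ⟨e, he, congrArg Subtype.val h⟩

theorem exists_homogeneous_rep {e : ℕ} {x : Poly K σ} (hx : comp e x = x) :
    ∃ f : ∀ i, MvPolynomial (σ i) (K i), mk f = x ∧ ∀ i, (f i).IsHomogeneous e := by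
  obtain ⟨f, rfl⟩ := mk_surj x
  exact ⟨_, (comp_mk e f).symm.trans hx, fun i =>
    MvPolynomial.homogeneousComponent_isHomogeneous _ _⟩

theorem comp_mul_right {e : ℕ} {y : Poly K σ} (hy : comp e y = y) (n : ℕ) (t : Poly K σ) :
    comp n (t * y) = if e ≤ n then comp (n - e) t * y else 0 := by
  obtain ⟨f, rfl, hf⟩ := exists_homogeneous_rep hy
  obtain ⟨t, rfl⟩ := mk_surj t
  rw [← mk_mul, comp_mk]
  have : ∀ i, MvPolynomial.homogeneousComponent n (t i * f i) =
      if e ≤ n then MvPolynomial.homogeneousComponent (n - e) (t i) * f i else 0 := fun i => by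
    rw [mul_comm, MvPolynomial.homogeneousComponent_hom_mul (hf i)]
    split_ifs
    · rw [mul_comm]
    · rfl
  simp only [this]
  split_ifs
  · rw [mk_mul, comp_mk]
  · rw [mk_zero]

/-- Ideals generated by homogeneous bounded elements are contracted from the ultraproduct. -/
theorem mem_span_of_mem_span {ι : Type*} [Finite ι] (y : ι → bdd K σ) (e : ι → ℕ)
    (hy : ∀ j, comp (e j) (y j : Poly K σ) = y j) (x : bdd K σ)
    (hx : (x : Poly K σ) ∈ Ideal.span (Set.range fun j => (y j : Poly K σ))) :
    x ∈ Ideal.span (Set.range y) := by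
  cases nonempty_fintype ι
  obtain ⟨t, ht⟩ := Ideal.mem_span_range_iff_exists_fun.1 hx
  have hcomp : ∀ n, (⟨comp n (x : Poly K σ), comp_mem_bdd n _⟩ : bdd K σ) ∈
      Ideal.span (Set.range y) := by
    intro n
    rw [Ideal.mem_span_range_iff_exists_fun]
    refine ⟨fun j => if e j ≤ n then ⟨comp (n - e j) (t j), comp_mem_bdd _ _⟩ else 0,
      Subtype.ext ?_⟩
    rw [AddSubmonoidClass.coe_finsetSum]
    change _ = comp n (x : Poly K σ)
    rw [← ht, map_sum]
    refine Finset.sum_congr rfl fun j _ => ?_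
    rw [comp_mul_right (hy j)]
    by_cases h : e j ≤ n
    · rw [if_pos h]
      dsimp only
      rw [if_pos h]
      rfl
    · rw [if_neg h]
      dsimp only
      rw [if_neg h, zero_mul]
      rfl
  obtain ⟨N, -, hN⟩ := exists_comp_bound x.2
  have : x = ∑ n ∈ Finset.range N, (⟨comp n (x : Poly K σ), comp_mem_bdd n _⟩ : bdd K σ) := by
    refine Subtype.ext ?_
    rw [AddSubmonoidClass.coe_finsetSum]
    exact hN.symm
  rw [this]
  exact Ideal.sum_mem _ fun n _ => hcomp n

theorem _root_.MvPolynomial.mem_span_X_image_of_X_mul_mem {R τ : Type*} [CommRing R] {s : Set τ}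
    {b : τ} (hb : b ∉ s) {a : MvPolynomial τ R}
    (h : MvPolynomial.X b * a ∈ Ideal.span (MvPolynomial.X '' s : Set (MvPolynomial τ R))) :
    a ∈ Ideal.span (MvPolynomial.X '' s : Set (MvPolynomial τ R)) := by
  rw [MvPolynomial.mem_ideal_span_X_image] at h ⊢
  intro m hm
  obtain ⟨i, hi, h1⟩ := h (Finsupp.single b 1 + m) (by
    rw [MvPolynomial.support_X_mul, Finset.mem_map]
    exact ⟨m, hm, rfl⟩)
  refine ⟨i, hi, ?_⟩
  have : i ≠ b := fun h => hb (h ▸ hi)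
  simpa [Finsupp.single_apply, this.symm] using h1

namespace IsFrame

variable {B : Set (bdd K σ)}


theorem bijective (hB : IsFrame K σ B) : Function.Bijective
    (MvPolynomial.aeval (Subtype.val : B → bdd K σ) : MvPolynomial B (UP K) →ₐ[UP K] bdd K σ) := by
  refine ⟨hB.indep, ?_⟩
  rw [← AlgHom.range_eq_top, ← Algebra.adjoin_range_eq_range_aeval, Subtype.range_coe, hB.adjoin]

/-- Bounded degree elements form a polynomial ring. -/
noncomputable def equiv (hB : IsFrame K σ B) : MvPolynomial B (UP K) ≃ₐ[UP K] bdd K σ :=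
  AlgEquiv.ofBijective _ hB.bijective

@[simp] theorem equiv_X (hB : IsFrame K σ B) (b : B) : hB.equiv (MvPolynomial.X b) = b :=
  MvPolynomial.aeval_X _ _


theorem mem_span_of_mul_mem (hB : IsFrame K σ B) {ι : Type*} (y : ι → B) (b : B) (hb : ∀ j, y j ≠ b)
    {a : bdd K σ}
    (h : (b : bdd K σ) * a ∈ Ideal.span (Set.range fun j => (y j : bdd K σ))) :
    a ∈ Ideal.span (Set.range fun j => (y j : bdd K σ)) := by
  have key : ∀ x : bdd K σ, x ∈ Ideal.span (Set.range fun j => (y j : bdd K σ)) ↔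
      hB.equiv.symm x ∈
        Ideal.span (MvPolynomial.X '' Set.range y : Set (MvPolynomial B (UP K))) := by
    intro x
    have h1 : Ideal.map hB.equiv
        (Ideal.span (MvPolynomial.X '' Set.range y : Set (MvPolynomial B (UP K)))) =
        Ideal.span (Set.range fun j => (y j : bdd K σ)) := by
      rw [Ideal.map_span]
      congr 1
      rw [← Set.range_comp, ← Set.range_comp]
      congr 1
      ext1 j
      exact hB.equiv_X _
    rw [← h1, Ideal.mem_map_iff_of_surjective _ hB.equiv.surjective]
    constructor
    · rintro ⟨z, hz, rfl⟩
      convert hz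
      exact hB.equiv.symm_apply_apply z
    · intro h
      exact ⟨_, h, hB.equiv.apply_symm_apply x⟩
  rw [key] at h ⊢
  refine MvPolynomial.mem_span_X_image_of_X_mul_mem (b := b) ?_ ?_
  · rintro ⟨j, hj⟩
    exact hb j hj
  · convert h
    rw [map_mul]
    congr 1
    rw [← hB.equiv_X b]
    exact (hB.equiv.symm_apply_apply _).symm

end IsFrame

end Flat

end UP

end

section

open Filter

namespace UP

section Flat

variable {K : ℕ → Type u} [∀ i, Field (K i)] {σ : ℕ → Type}

theorem _root_.Fin.range_castLE_eq_image_Iio {A : Type*} {r : ℕ} (f : Fin r → A) (j : Fin r) :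
    Set.range (fun t : Fin j.val => f (t.castLE j.isLt.le)) = f '' Set.Iio j := by
  ext x
  constructor
  · rintro ⟨t, rfl⟩
    exact ⟨_, t.isLt, rfl⟩
  · rintro ⟨t, ht, rfl⟩
    exact ⟨⟨t.val, ht⟩, rfl⟩

theorem _root_.Fin.image_comp_castLE_Iio {A : Type*} {r : ℕ} (f : Fin r → A) (j : Fin r)
    (t : Fin j.val) :
    (fun t : Fin j.val => f (t.castLE j.isLt.le)) '' Set.Iio t =
      f '' Set.Iio (t.castLE j.isLt.le) := by
  ext x
  constructor
  · rintro ⟨s, hs, rfl⟩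
    exact ⟨_, hs, rfl⟩
  · rintro ⟨s, hs, rfl⟩
    exact ⟨⟨s.val, lt_trans hs t.isLt⟩, hs, rfl⟩

theorem IsFrame.eventually_regular [∀ i, IsAlgClosed (K i)] {B : Set (bdd K σ)}
    (hB : IsFrame K σ B) {r : ℕ} (y : Fin r → B) (hinj : Function.Injective y) (e : Fin r → ℕ)
    (he : ∀ j, 1 ≤ e j) (Y : Fin r → ∀ i, MvPolynomial (σ i) (K i))
    (hY : ∀ j i, (Y j i).IsHomogeneous (e j))
    (hmk : ∀ j, UP.mk (Y j) = ((y j : bdd K σ) : Poly K σ)) (j : Fin r) :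
    ∀ᶠ i in (hyperfilter ℕ : Filter ℕ), ∀ f,
      Y j i * f ∈ Ideal.span ((fun t => Y t i) '' Set.Iio j) →
      f ∈ Ideal.span ((fun t => Y t i) '' Set.Iio j) := by
  classical
  have hinf : ∀ i, Infinite (K i) := fun i => IsAlgClosed.instInfinite
  induction j using WellFoundedLT.induction with
  | _ j ih =>
  obtain ⟨n, D, hEL⟩ := exists_noetherFrame.{u} j.val (fun t => e (t.castLE j.isLt.le))
    fun t => he _
  have hfr : ∀ᶠ i in (hyperfilter ℕ : Filter ℕ), Nonempty (NoetherFrame (K i) (σ i) (Fin j.val)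
      (fun t => Y (t.castLE j.isLt.le) i) n D) := by
    have : ∀ᶠ i in (hyperfilter ℕ : Filter ℕ), ∀ t : Fin j.val, ∀ f,
      Y (t.castLE j.isLt.le) i * f ∈ Ideal.span ((fun t => Y t i) '' Set.Iio (t.castLE j.isLt.le)) →
      f ∈ Ideal.span ((fun t => Y t i) '' Set.Iio (t.castLE j.isLt.le)) :=
      Filter.eventually_all.2 fun t => ih _ t.isLt
    filter_upwards [this] with i hi
    refine hEL (K i) (σ i) _ (fun t => hY _ i) fun t f hf => ?_
    rw [Fin.image_comp_castLE_Iio (fun t => Y t i) j t] at hf ⊢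
    exact hi t f hf
  have hrel : ∀ᶠ i in (hyperfilter ℕ : Filter ℕ), ∃ k₀ : Fin (n + 1),
      ∃ F c h : MvPolynomial (σ i) (K i), F.totalDegree ≤ n * e j ∧ F = c + Y j i * h ∧
        (∀ u, c * u ∈ Ideal.span ((fun t => Y t i) '' Set.Iio j) →
          u ∈ Ideal.span ((fun t => Y t i) '' Set.Iio j)) ∧
        Y j i ^ k₀.val * F ∈ Ideal.span ((fun t => Y t i) '' Set.Iio j) := by
    filter_upwards [hfr] with i ⟨Fr⟩
    obtain ⟨k₀, hk₀, q, hq0, hq1, hq, hmem⟩ := Fr.exists_shifted_relation (fun t => hY _ i) (hY j i)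
    rw [Fin.range_castLE_eq_image_Iio (fun t => Y t i) j] at hmem
    refine ⟨⟨k₀, by omega⟩, _, Fr.lin (q 0),
      ∑ k ∈ Finset.range (n - k₀), Fr.lin (q (k + 1)) * Y j i ^ k, ?_, ?_, ?_, hmem⟩
    · refine MvPolynomial.IsHomogeneous.totalDegree_le ?_ |>.trans
        (Nat.mul_le_mul_right _ (Nat.sub_le n k₀))
      refine MvPolynomial.IsHomogeneous.sum _ _ _ fun k hk => ?_
      have hk' : k ≤ n - k₀ := by
        have := Finset.mem_range.1 hk
        omega
      have h1 : (Fr.lin (q k)).IsHomogeneous ((n - k₀ - k) * e j) :=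
        MvPolynomial.isHomogeneous_aeval_of_weighted Fr.hℓ (hq k hk')
      have h2 := h1.mul ((hY j i).pow k)
      have h3 : (n - k₀ - k) * e j + e j * k = (n - k₀) * e j := by
        rw [mul_comm (e j) k, ← add_mul, Nat.sub_add_cancel hk']
      rwa [h3] at h2
    · rw [Finset.sum_range_succ', pow_zero, mul_one, add_comm, Finset.mul_sum]
      congr 1
      exact Finset.sum_congr rfl fun k _ => by ring
    · intro u hu
      rw [← Fin.range_castLE_eq_image_Iio (fun t => Y t i) j] at hu ⊢
      exact Fr.mem_of_lin_mul_mem hq0 hu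
  rw [Ultrafilter.eventually_exists_iff] at hrel
  obtain ⟨k₀, hrel⟩ := hrel
  choose! F c h hF using fun i (hi : ∃ F c h : MvPolynomial (σ i) (K i),
    F.totalDegree ≤ n * e j ∧ F = c + Y j i * h ∧
        (∀ u, c * u ∈ Ideal.span ((fun t => Y t i) '' Set.Iio j) →
          u ∈ Ideal.span ((fun t => Y t i) '' Set.Iio j)) ∧
        Y j i ^ k₀.val * F ∈ Ideal.span ((fun t => Y t i) '' Set.Iio j)) => hi
  have hFb : UP.mk F ∈ bdd K σ := mk_mem_bdd _ (by
    filter_upwards [hrel] with i hi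
    exact (hF i hi).1)
  have hmem1 : UP.mk (fun i => Y j i ^ k₀.val * F i) ∈ Ideal.span
      (Set.range fun t : Fin j.val => UP.mk (Y (t.castLE j.isLt.le))) := by
    rw [mem_span_range]
    filter_upwards [hrel] with i hi
    rw [Fin.range_castLE_eq_image_Iio (fun t => Y t i) j]
    exact (hF i hi).2.2.2
  have hmem2 : ((y j : bdd K σ) ^ k₀.val * ⟨UP.mk F, hFb⟩ : bdd K σ) ∈ Ideal.span
      (Set.range fun t : Fin j.val => (y (t.castLE j.isLt.le) : bdd K σ)) := by
    refine mem_span_of_mem_span _ (fun t => e (t.castLE j.isLt.le)) (fun t => ?_) _ ?_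
    · rw [← hmk, comp_mk_eq_self]
      exact Eventually.of_forall fun i => hY _ i
    · rw [mk_mul, mk_pow] at hmem1
      simp only [hmk] at hmem1
      exact hmem1
  have hmem3 := NoetherFrame.mem_of_pow_mul_mem (fun a => hB.mem_span_of_mul_mem
    (fun t : Fin j.val => y (t.castLE j.isLt.le)) (y j) (fun t ht => by
      have h1 := congrArg Fin.val (hinj ht)
      have := t.isLt
      simp only [Fin.val_castLE] at h1
      omega)) _ hmem2
  have hmem4 : UP.mk F ∈ Ideal.span
      (Set.range fun t : Fin j.val => UP.mk (Y (t.castLE j.isLt.le))) := by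
    have := Ideal.mem_map_of_mem (bdd K σ).val hmem3
    rw [Ideal.map_span, ← Set.range_comp] at this
    simp only [hmk]
    exact this
  rw [mem_span_range] at hmem4
  filter_upwards [hrel, hmem4] with i hi hi2 f hf
  rw [Fin.range_castLE_eq_image_Iio (fun t => Y t i) j] at hi2
  obtain ⟨-, h1, h2, -⟩ := hF i hi
  refine h2 f ?_
  have h3 : c i * f = F i * f - h i * (Y j i * f) := by rw [h1]; ring
  rw [h3]
  exact Ideal.sub_mem _ (Ideal.mul_mem_right _ _ hi2) (Ideal.mul_mem_left _ _ hf)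

theorem _root_.MvPolynomial.flat_rename_inl (k : Type u) [CommRing k] (ι Λ : Type) :
    (MvPolynomial.rename (R := k) (Sum.inl : ι → ι ⊕ Λ)).toRingHom.Flat := by
  let E := (MvPolynomial.renameEquiv k (Equiv.sumComm ι Λ)).trans (MvPolynomial.sumAlgEquiv k Λ ι)
  have h1 : (MvPolynomial.C : MvPolynomial ι k →+* MvPolynomial Λ (MvPolynomial ι k)).Flat := by
    have := (RingHom.flat_algebraMap_iff (R := MvPolynomial ι k)
      (S := MvPolynomial Λ (MvPolynomial ι k))).2 inferInstance
    rwa [MvPolynomial.algebraMap_eq] at this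
  have h2 : E.symm.toRingEquiv.toRingHom.Flat :=
    RingHom.Flat.of_bijective E.symm.bijective
  convert h1.comp h2 using 1
  refine MvPolynomial.ringHom_ext (fun a => ?_) fun j => ?_
  · refine (AlgEquiv.eq_symm_apply E).2 ?_
    simp [E]
  · refine (AlgEquiv.eq_symm_apply E).2 ?_
    simp [E]

theorem IsFrame.flat_aeval [∀ i, IsAlgClosed (K i)] {B : Set (bdd K σ)}
    (hB : IsFrame K σ B) {r : ℕ} (y : Fin r → B) (hinj : Function.Injective y) :
    (MvPolynomial.aeval (R := UP K) fun j => ((y j : bdd K σ) : Poly K σ)).toRingHom.Flat := by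
  have hinf : ∀ i, Infinite (K i) := fun i => IsAlgClosed.instInfinite
  choose e he hy using fun j => hB.hom (y j) (y j).2
  choose Y hYmk hY using fun j => exists_homogeneous_rep (hy j)
  obtain ⟨n, D, hEL⟩ := exists_noetherFrame.{u} r e fun j => Nat.one_le_iff_ne_zero.2 (he j)
  have hflat : ∀ᶠ i in (hyperfilter ℕ : Filter ℕ),
      (MvPolynomial.aeval (R := K i) fun j => Y j i).toRingHom.Flat := by
    have := Filter.eventually_all.2 (hB.eventually_regular y hinj e
      (fun j => Nat.one_le_iff_ne_zero.2 (he j)) Y hY hYmk)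
    filter_upwards [this] with i hi
    obtain ⟨Fr⟩ := hEL (K i) (σ i) (fun j => Y j i) (fun j => hY j i) hi
    have := (MvPolynomial.flat_rename_inl (K i) (Fin r) Fr.Λ).comp Fr.flat
    convert this using 1
    refine MvPolynomial.ringHom_ext (fun a => ?_) fun j => ?_ <;> simp
  have := flat_map_comp (flat_mvEmb_fin (K := K) r)
    (fun i => (MvPolynomial.aeval (R := K i) fun j => Y j i).toRingHom) hflat
  convert this using 1
  refine MvPolynomial.ringHom_ext (fun a => ?_) fun j => ?_
  · obtain ⟨a, rfl⟩ := mk_surj a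
    simp [map_mk, algebraMap_mk, MvPolynomial.algebraMap_eq]
  · simp [map_mk, hYmk]

/-- The ultraproduct is flat over the ring of bounded degree elements. -/
theorem flat_bdd [∀ i, IsAlgClosed (K i)] : (algebraMap (bdd K σ) (Poly K σ)).Flat := by
  classical
  obtain ⟨B, hB⟩ := exists_isFrame (K := K) (σ := σ)
  rw [RingHom.flat_iff_forall_trivial]
  intro l a f haf
  choose q hq using fun t => hB.bijective.2 (a t)
  let V : Finset B := Finset.univ.biUnion fun t => (q t).vars
  let y : Fin V.card → B := fun j => (V.equivFin.symm j : B)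
  have hyinj : Function.Injective y := Subtype.val_injective.comp V.equivFin.symm.injective
  have hex : ∀ t, ∃ c : MvPolynomial (Fin V.card) (UP K),
      MvPolynomial.aeval (fun j => (y j : bdd K σ)) c = a t := by
    intro t
    have h1 : q t ∈ MvPolynomial.supported (UP K) (V : Set B) := by
      rw [MvPolynomial.mem_supported]
      intro b hb
      exact Finset.mem_biUnion.2 ⟨t, Finset.mem_univ _, hb⟩
    rw [MvPolynomial.supported_eq_range_rename] at h1
    obtain ⟨c, hc⟩ := h1
    refine ⟨MvPolynomial.rename V.equivFin c, ?_⟩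
    rw [MvPolynomial.aeval_rename, ← hq t, ← hc]
    change _ = MvPolynomial.aeval _ (MvPolynomial.rename _ c)
    rw [MvPolynomial.aeval_rename]
    congr 2
    ext1 b
    simp [y]
  choose c hc using hex
  have hfl := hB.flat_aeval y hyinj
  have hc' : ∀ p : MvPolynomial (Fin V.card) (UP K),
      MvPolynomial.aeval (R := UP K) (fun j => ((y j : bdd K σ) : Poly K σ)) p =
      ((MvPolynomial.aeval (fun j => (y j : bdd K σ)) p : bdd K σ) : Poly K σ) := by
    intro p
    rw [← Subalgebra.coe_val, ← AlgHom.comp_apply, MvPolynomial.comp_aeval]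
  obtain ⟨k, C, z, h1, h2⟩ := hfl.exists_trivial c f (by
    rw [← haf]
    refine Finset.sum_congr rfl fun t _ => ?_
    exact congrArg (· * f t) ((hc' (c t)).trans (congrArg Subtype.val (hc t))))
  refine ⟨k, fun t j => MvPolynomial.aeval (fun j => (y j : bdd K σ)) (C t j), z, fun t => ?_,
    fun j => ?_⟩
  · rw [h1 t]
    refine Finset.sum_congr rfl fun j _ => ?_
    exact congrArg (· * z j) (hc' _)
  · simp only [← hc, ← map_mul, ← map_sum, h2 j, map_zero]

end Flat

end UP

end

section

section Regular

open Polynomial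

/-- An element all of whose conjugates coincide is radical. -/
theorem exists_pow_mem_range_of_forall_root {F : Type u} {Ω : Type v} [Field F] [Field Ω]
    [IsAlgClosed Ω] [Algebra F Ω] (p : ℕ) [ExpChar F p] {x : Ω} (hx : IsAlgebraic F x)
    (h : ∀ y, aeval y (minpoly F x) = 0 → y = x) :
    ∃ n, x ^ p ^ n ∈ (algebraMap F Ω).range := by
  classical
  rw [← minpoly.natSepDegree_eq_one_iff_pow_mem p, natSepDegree_eq_of_isAlgClosed Ω]
  refine Finset.card_eq_one.2 ⟨x, ?_⟩
  ext y
  rw [Multiset.mem_toFinset, mem_aroots, Finset.mem_singleton]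
  constructor
  · exact fun hy => h y hy.2
  · rintro rfl
    exact ⟨minpoly.ne_zero hx.isIntegral, minpoly.aeval _ _⟩

variable {S : Type u} {T : Type u} {F Ω : Type u} [CommRing S] [CommRing T]
  [IsDomain T] [Field F] [Field Ω] [Algebra S T] [Algebra T F]
  [IsFractionRing T F] [Algebra T Ω] [FaithfulSMul T Ω] [Algebra F Ω] [IsScalarTower T F Ω]
  [Algebra S Ω] [IsScalarTower S T Ω]

theorem exists_smul_eq_algebraMap_of_isAlgebraic
    (hS : ∀ (f g : T), g ≠ 0 → ∀ (n : ℕ) (c : ℕ → S), c n = 1 →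
      ∑ k ∈ Finset.range (n + 1), algebraMap S T (c k) * f ^ k * g ^ (n - k) = 0 →
      ∃ h : S, f = algebraMap S T h * g)
    {x : Ω} (hx : IsAlgebraic S x) (hxF : x ∈ (algebraMap F Ω).range) :
    ∃ s d : S, s ≠ 0 ∧ algebraMap S Ω s * x = algebraMap S Ω d := by
  have hinj : Function.Injective (algebraMap T Ω) := FaithfulSMul.algebraMap_injective T Ω
  obtain ⟨s, hs, P, hP, hPx⟩ := hx.exists_integral_multiple
  obtain ⟨z, rfl⟩ := hxF
  obtain ⟨f, g, hg, rfl⟩ := IsFractionRing.div_surjective (A := T) z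
  have hg0 : g ≠ 0 := nonZeroDivisors.ne_zero hg
  have hgΩ : algebraMap T Ω g ≠ 0 := by rwa [Ne, map_eq_zero_iff _ hinj]
  rw [map_div₀, ← IsScalarTower.algebraMap_apply, ← IsScalarTower.algebraMap_apply] at hPx ⊢
  obtain ⟨h, hh⟩ := hS (algebraMap S T s * f) g hg0 P.natDegree P.coeff hP.coeff_natDegree (by
    apply hinj
    rw [map_zero, ← zero_mul (algebraMap T Ω g ^ P.natDegree), ← hPx, eval₂_eq_sum_range,
      map_sum, Finset.sum_mul]
    refine Finset.sum_congr rfl fun k hk => ?_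
    have hk' : k ≤ P.natDegree := by
      have := Finset.mem_range.1 hk
      omega
    rw [map_mul, map_mul, map_pow, map_pow, map_mul, ← IsScalarTower.algebraMap_apply,
      ← IsScalarTower.algebraMap_apply, Algebra.smul_def, mul_assoc, mul_assoc]
    congr 1
    obtain ⟨m, hm⟩ := Nat.exists_eq_add_of_le hk'
    rw [hm, Nat.add_sub_cancel_left, pow_add, ← mul_assoc, ← mul_pow]
    congr 2
    field_simp)
  refine ⟨s, h, hs, ?_⟩
  have := congrArg (algebraMap T Ω) hh
  rw [map_mul, map_mul, ← IsScalarTower.algebraMap_apply, ← IsScalarTower.algebraMap_apply] at this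
  rw [← mul_div_assoc, this, mul_div_assoc, div_self hgΩ, mul_one]

variable [IsDomain S] [IsAlgClosed Ω] [FaithfulSMul S T]

/-- A regularity criterion: linear independence persists over algebraic elements. -/
theorem LinearIndependent.eq_zero_of_isAlgebraic (p : ℕ) [ExpChar F p]
    (hS : ∀ (f g : T), g ≠ 0 → ∀ (n : ℕ) (c : ℕ → S), c n = 1 →
      ∑ k ∈ Finset.range (n + 1), algebraMap S T (c k) * f ^ k * g ^ (n - k) = 0 →
      ∃ h : S, f = algebraMap S T h * g)
    {ι : Type} (hp : ∀ t : ι → T, LinearIndependent S t → LinearIndependent S fun i => t i ^ p)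
    {t : ι → T} (ht : LinearIndependent S t) (s : Finset ι) (l : ι → Ω)
    (hl : ∀ i, IsAlgebraic S (l i)) (h : ∑ i ∈ s, l i * algebraMap T Ω (t i) = 0) :
    ∀ i ∈ s, l i = 0 := by
  classical
  have hinj : Function.Injective (algebraMap T Ω) := FaithfulSMul.algebraMap_injective T Ω
  have hST : Function.Injective (algebraMap S T) := FaithfulSMul.algebraMap_injective S T
  have hTF : Function.Injective (algebraMap T F) := IsFractionRing.injective T F
  have : ExpChar Ω p := expChar_of_injective_algebraMap (algebraMap F Ω).injective p
  have : FaithfulSMul S Ω := (faithfulSMul_iff_algebraMap_injective S Ω).2 (by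
    rw [IsScalarTower.algebraMap_eq S T Ω]; exact hinj.comp hST)
  have hpn : ∀ n, LinearIndependent S fun i => t i ^ p ^ n := by
    intro n
    induction n with
    | zero => simpa using ht
    | succ n ih =>
      have := hp _ ih
      simpa [← pow_mul, ← pow_succ] using this
  induction s using Finset.strongInduction generalizing l with
  | _ s ih =>
  intro i₀ hi₀
  by_contra hne
  set m : ι → Ω := fun i => l i / l i₀ with hm
  have hmalg : ∀ i, IsAlgebraic S (m i) := fun i => by
    rw [hm]
    simp only [div_eq_mul_inv]
    exact (hl i).mul (hl i₀).inv
  have hm0 : m i₀ = 1 := div_self hne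
  have hmsum : ∑ i ∈ s, m i * algebraMap T Ω (t i) = 0 := by
    have : ∑ i ∈ s, m i * algebraMap T Ω (t i) =
        (l i₀)⁻¹ * ∑ i ∈ s, l i * algebraMap T Ω (t i) := by
      rw [Finset.mul_sum]
      exact Finset.sum_congr rfl fun i _ => by simp only [hm]; ring
    rw [this, h, mul_zero]
  have hmF : ∀ i, IsAlgebraic F (m i) := fun i => by
    have h1 : IsAlgebraic T (m i) := (hmalg i).extendScalars hST
    exact h1.extendScalars hTF
  let E := algebraicClosure F Ω
  have hconj : ∀ i ∈ s, ∀ y, aeval y (minpoly F (m i)) = 0 → y = m i := by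
    intro i hi y hy
    have hmE : ∀ i, m i ∈ E := fun i => mem_algebraicClosure_iff.2 (hmF i)
    have hEalg : ∀ x : E, IsIntegral F x := fun x => by
      have := (mem_algebraicClosure_iff.1 x.2).isIntegral
      exact (isIntegral_algHom_iff E.val Subtype.val_injective).1 this
    obtain ⟨φ, hφ⟩ := IntermediateField.exists_algHom_of_splits_of_aeval
      (F := F) (E := E) (K := Ω) (fun x => ⟨hEalg x, IsAlgClosed.splits _⟩)
      (x := ⟨m i, hmE i⟩) (y := y) (by
        rw [← minpoly.algHom_eq E.val Subtype.val_injective]; exact hy)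
    have hφT : ∀ a : T, φ (algebraMap F E (algebraMap T F a)) = algebraMap T Ω a := fun a => by
      rw [φ.commutes, ← IsScalarTower.algebraMap_apply]
    have hvT : ∀ a : T, E.val.toRingHom (algebraMap F E (algebraMap T F a)) =
        algebraMap T Ω a := fun a => by
      rw [IsScalarTower.algebraMap_apply T F Ω]
      exact E.val.commutes _
    let f : S →+* E := ((algebraMap F E).comp (algebraMap T F)).comp (algebraMap S T)
    have hf1 : (φ : E →+* Ω).comp f = algebraMap S Ω := by
      ext a
      exact (hφT _).trans (IsScalarTower.algebraMap_apply S T Ω a).symm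
    have hf2 : E.val.toRingHom.comp f = algebraMap S Ω := by
      ext a
      exact (hvT _).trans (IsScalarTower.algebraMap_apply S T Ω a).symm
    have hsum : ∑ j ∈ s, φ ⟨m j, hmE j⟩ * algebraMap T Ω (t j) = 0 := by
      have h1 : ∑ j ∈ s, (⟨m j, hmE j⟩ : E) * algebraMap F E (algebraMap T F (t j)) = 0 := by
        apply E.val.toRingHom.injective
        rw [map_sum, map_zero, ← hmsum]
        exact Finset.sum_congr rfl fun j _ => by
          rw [map_mul]; exact congrArg (m j * ·) (hvT _)
      have h2 := congrArg φ h1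
      rw [map_sum, map_zero] at h2
      rw [← h2]
      exact Finset.sum_congr rfl fun j _ => by rw [map_mul, hφT]
    have hφalg : ∀ j, IsAlgebraic S (φ ⟨m j, hmE j⟩) := by
      intro j
      obtain ⟨P, hP0, hP⟩ := hmalg j
      refine ⟨P, hP0, ?_⟩
      have h1 : P.eval₂ f (⟨m j, hmE j⟩ : E) = 0 := by
        apply E.val.toRingHom.injective
        rw [Polynomial.hom_eval₂, hf2, map_zero]
        exact hP
      have h2 := congrArg (φ : E →+* Ω) h1
      rw [Polynomial.hom_eval₂, hf1, map_zero] at h2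
      exact h2
    by_cases hii : i = i₀
    · subst hii
      rw [← hφ]
      have : (⟨m i, hmE i⟩ : E) = 1 := Subtype.ext hm0
      rw [this, map_one, hm0]
    · have := ih (s.erase i₀) (Finset.erase_ssubset hi₀) (fun j => m j - φ ⟨m j, hmE j⟩)
        (fun j => (hmalg j).sub (hφalg j)) (by
          have h3 : (m i₀ - φ ⟨m i₀, hmE i₀⟩) = 0 := by
            have : (⟨m i₀, hmE i₀⟩ : E) = 1 := Subtype.ext hm0
            rw [this, map_one, hm0, sub_self]
          rw [← Finset.sum_erase_add _ _ hi₀] at hmsum hsum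
          have h4 := congrArg₂ (· - ·) hmsum hsum
          simp only [sub_mul, Finset.sum_sub_distrib]
          have h5 := congrArg (· * algebraMap T Ω (t i₀)) h3
          simp only [sub_mul, zero_mul] at h5
          simp only [sub_zero] at h4
          linear_combination h4 - h5) i (Finset.mem_erase.2 ⟨hii, hi⟩)
      rw [← hφ]
      exact (sub_eq_zero.1 this).symm
  have hpow : ∀ i ∈ s, ∃ n, m i ^ p ^ n ∈ (algebraMap F Ω).range := fun i hi =>
    exists_pow_mem_range_of_forall_root p (hmF i) (hconj i hi)
  choose! n hn using hpow
  set N := s.sup n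
  have hN : ∀ i ∈ s, m i ^ p ^ N ∈ (algebraMap F Ω).range := by
    intro i hi
    obtain ⟨k, hk⟩ := Nat.exists_eq_add_of_le (Finset.le_sup (f := n) hi)
    change N = _ at hk
    rw [hk, pow_add, pow_mul]
    exact Subring.pow_mem _ (hn i hi) _
  have hsd := fun i (hi : i ∈ s) =>
    exists_smul_eq_algebraMap_of_isAlgebraic hS ((hmalg i).pow (p ^ N)) (hN i hi)
  choose! c d hc hcd using hsd
  have hrel := congrArg (· ^ p ^ N) hmsum
  beta_reduce at hrel
  rw [sum_pow_char_pow, zero_pow (pow_ne_zero _ (expChar_pos F p).ne')] at hrel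
  have hrel2 : ∑ i ∈ s, ((∏ j ∈ s.erase i, c j) * d i) • t i ^ p ^ N = 0 := by
    apply hinj
    rw [map_zero, ← mul_zero (algebraMap S Ω (∏ j ∈ s, c j)), ← hrel, map_sum, Finset.mul_sum]
    refine Finset.sum_congr rfl fun i hi => ?_
    rw [Algebra.smul_def, map_mul, ← IsScalarTower.algebraMap_apply, map_mul, ← hcd i hi,
      ← Finset.mul_prod_erase s c hi, map_mul, map_pow, mul_pow]
    ring
  have h0 := linearIndependent_iff'.1 (hpn N) s _ hrel2 i₀ hi₀
  rcases mul_eq_zero.1 h0 with h1 | h1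
  · obtain ⟨j, hj, hj0⟩ := Finset.prod_eq_zero_iff.1 h1
    exact hc j (Finset.mem_of_mem_erase hj) hj0
  · have := hcd i₀ hi₀
    rw [h1, hm0, one_pow, mul_one, map_zero] at this
    exact hc i₀ hi₀ ((map_eq_zero_iff _ (FaithfulSMul.algebraMap_injective S Ω)).1 this)

end Regular

end

section

open Filter

section MaxIndep

/-- A finite family of vectors over a domain contains an independent subfamily whose span contains
a nonzero multiple of every vector. -/
theorem exists_linearIndepOn_smul_mem_span {S M ι : Type*} [CommRing S] [IsDomain S]
    [AddCommGroup M] [Module S M] (h : ι → M) (A : Finset ι) :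
    ∃ J : Finset ι, LinearIndepOn S h (J : Set ι) ∧ ∃ c : S, c ≠ 0 ∧
      ∀ a ∈ A, ∃ u : ι → S, c • h a = ∑ j ∈ J, u j • h j := by
  classical
  induction A using Finset.induction_on with
  | empty => exact ⟨∅, by simp, 1, one_ne_zero, by simp⟩
  | insert a A ha ih =>
    obtain ⟨J, hJ, c, hc, hA⟩ := ih
    by_cases haJ : a ∈ J
    · refine ⟨J, hJ, c, hc, fun b hb => ?_⟩
      rcases Finset.mem_insert.1 hb with rfl | hb
      · refine ⟨fun j => if j = b then c else 0, ?_⟩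
        simp [ite_smul, haJ]
      · exact hA b hb
    by_cases hins : LinearIndepOn S h ((insert a J : Finset ι) : Set ι)
    · refine ⟨insert a J, hins, c, hc, fun b hb => ?_⟩
      rcases Finset.mem_insert.1 hb with rfl | hb
      · refine ⟨fun j => if j = b then c else 0, ?_⟩
        simp [ite_smul]
      · obtain ⟨u, hu⟩ := hA b hb
        refine ⟨fun j => if j = a then 0 else u j, ?_⟩
        rw [Finset.sum_insert haJ, hu]
        beta_reduce
        rw [if_pos rfl, zero_smul, zero_add]
        refine Finset.sum_congr rfl fun j hj => ?_
        rw [if_neg (fun hja : j = a => haJ (hja ▸ hj))]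
    · rw [linearIndepOn_finset_iff] at hins hJ
      push Not at hins
      obtain ⟨f, hf, i, hi, hfi⟩ := hins
      rw [Finset.sum_insert haJ] at hf
      have hfa : f a ≠ 0 := by
        intro h0
        rw [h0, zero_smul, zero_add] at hf
        rcases Finset.mem_insert.1 hi with rfl | hi
        · exact hfi h0
        · exact hfi (hJ f hf i hi)
      refine ⟨J, linearIndepOn_finset_iff.2 hJ, c * f a, mul_ne_zero hc hfa, fun b hb => ?_⟩
      rcases Finset.mem_insert.1 hb with rfl | hb
      · refine ⟨fun j => - (c * f j), ?_⟩
        rw [mul_smul, eq_neg_of_add_eq_zero_left hf, smul_neg, Finset.smul_sum,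
          ← Finset.sum_neg_distrib]
        exact Finset.sum_congr rfl fun j _ => by rw [neg_smul, mul_smul]
      · obtain ⟨u, hu⟩ := hA b hb
        refine ⟨fun j => f a * u j, ?_⟩
        rw [mul_comm, mul_smul, hu, Finset.smul_sum]
        exact Finset.sum_congr rfl fun j _ => by rw [mul_smul]

end MaxIndep

theorem IsIntegrallyClosed.exists_eq_mul_of_sum_eq_zero {A : Type*} [CommRing A] [IsDomain A]
    [IsIntegrallyClosed A] {f g : A} (hg : g ≠ 0) (n : ℕ) (c : ℕ → A) (hc : c n = 1)
    (h : ∑ k ∈ Finset.range (n + 1), c k * f ^ k * g ^ (n - k) = 0) :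
    ∃ q, f = q * g ∧ ∑ k ∈ Finset.range (n + 1), c k * q ^ k = 0 := by
  have hgF : algebraMap A (FractionRing A) g ≠ 0 := by
    rwa [Ne, map_eq_zero_iff _ (IsFractionRing.injective A (FractionRing A))]
  have key : ∀ q : FractionRing A, algebraMap A _ f = q * algebraMap A _ g →
      ∑ k ∈ Finset.range (n + 1), algebraMap A (FractionRing A) (c k) * q ^ k = 0 := by
    intro q hq
    have h1 := congrArg (algebraMap A (FractionRing A)) h
    rw [map_zero, map_sum] at h1
    have h2 : algebraMap A (FractionRing A) g ^ n *
        ∑ k ∈ Finset.range (n + 1), algebraMap A (FractionRing A) (c k) * q ^ k = 0 := by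
      rw [← h1, Finset.mul_sum]
      refine Finset.sum_congr rfl fun k hk => ?_
      obtain ⟨m, hm⟩ := Nat.exists_eq_add_of_le (Nat.lt_succ_iff.1 (Finset.mem_range.1 hk))
      rw [map_mul, map_mul, map_pow, map_pow, hq, hm, Nat.add_sub_cancel_left]
      ring
    exact (mul_eq_zero.1 h2).resolve_left (pow_ne_zero _ hgF)
  have hint : IsIntegral A (algebraMap A (FractionRing A) f / algebraMap A (FractionRing A) g) := by
    have hk := key _ (div_mul_cancel₀ _ hgF).symm
    refine ⟨Polynomial.X ^ n + ∑ k ∈ Finset.range n, Polynomial.C (c k) * Polynomial.X ^ k,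
      Polynomial.monic_X_pow_add ?_, ?_⟩
    · refine (Polynomial.degree_sum_le _ _).trans_lt ?_
      refine (Finset.sup_lt_iff (WithBot.bot_lt_coe n)).2 fun k hk => ?_
      exact (Polynomial.degree_C_mul_X_pow_le _ _).trans_lt
        (WithBot.coe_lt_coe.2 (Finset.mem_range.1 hk))
    · rw [Finset.sum_range_succ, hc, map_one, one_mul] at hk
      rw [Polynomial.eval₂_add, Polynomial.eval₂_finsetSum, ← hk, add_comm]
      simp
  obtain ⟨q, hq⟩ := IsIntegrallyClosed.isIntegral_iff.1 hint
  have hq' : algebraMap A (FractionRing A) f = algebraMap A _ q * algebraMap A _ g := by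
    rw [hq, div_mul_cancel₀ _ hgF]
  refine ⟨q, IsFractionRing.injective A (FractionRing A) (by rw [hq', map_mul]), ?_⟩
  apply IsFractionRing.injective A (FractionRing A)
  rw [map_zero, ← key _ hq', map_sum]
  exact Finset.sum_congr rfl fun k _ => by rw [map_mul, map_pow]

theorem MvPolynomial.totalDegree_le_of_monic_relation {σ k : Type*} [Field k]
    (n d : ℕ) (c : ℕ → MvPolynomial σ k) (hc : c n = 1) (hd : ∀ j ≤ n, (c j).totalDegree ≤ d)
    (q : MvPolynomial σ k) (h : ∑ j ∈ Finset.range (n + 1), c j * q ^ j = 0) :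
    q.totalDegree ≤ d := by
  by_contra! hlt
  have hq0 : q ≠ 0 := by
    rintro rfl
    simp at hlt
  have hn : n ≠ 0 := by
    rintro rfl
    simp [hc] at h
  rw [Finset.sum_range_succ, hc, one_mul] at h
  have h1 : (q ^ n).totalDegree ≤ d + (n - 1) * q.totalDegree := by
    rw [eq_neg_of_add_eq_zero_right h, MvPolynomial.totalDegree_neg]
    refine (MvPolynomial.totalDegree_finsetSum _ _).trans (Finset.sup_le fun j hj => ?_)
    have hj' := Finset.mem_range.1 hj
    refine (MvPolynomial.totalDegree_mul _ _).trans (Nat.add_le_add (hd j hj'.le) ?_)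
    exact (MvPolynomial.totalDegree_pow _ _).trans (Nat.mul_le_mul_right _ (by omega))
  have hpow : ∀ m : ℕ, (q ^ m).totalDegree = m * q.totalDegree := fun m => by
    induction m with
    | zero => simp
    | succ m ih =>
      rw [pow_succ, MvPolynomial.totalDegree_mul_of_isDomain (pow_ne_zero _ hq0) hq0, ih]
      ring
  rw [hpow] at h1
  obtain ⟨m, rfl⟩ := Nat.exists_eq_succ_of_ne_zero hn
  simp only [Nat.succ_eq_add_one, Nat.add_sub_cancel, add_mul, one_mul] at h1
  omega

namespace UP

section Regular

variable {K : ℕ → Type u} [∀ i, Field (K i)] {σ : ℕ → Type}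

theorem exists_eq_mul_of_sum_eq_zero (f g : Poly K σ) (hg : g ≠ 0) (n : ℕ) (c : ℕ → bdd K σ)
    (hc : c n = 1) (h : ∑ k ∈ Finset.range (n + 1),
      algebraMap (bdd K σ) (Poly K σ) (c k) * f ^ k * g ^ (n - k) = 0) :
    ∃ h : bdd K σ, f = algebraMap (bdd K σ) (Poly K σ) h * g := by
  classical
  obtain ⟨f, rfl⟩ := mk_surj f
  obtain ⟨g, rfl⟩ := mk_surj g
  choose C d hCc hCd using fun k => mem_bdd.1 (c k).2
  have h1 : ∀ᶠ i in (hyperfilter ℕ : Filter ℕ), C n i = 1 := by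
    have : mk (C n) = 1 := by rw [hCc, hc]; rfl
    rw [← mk_one] at this
    exact mk_eq.1 this
  have h2 : ∀ᶠ i in (hyperfilter ℕ : Filter ℕ),
      ∑ k ∈ Finset.range (n + 1), C k i * f i ^ k * g i ^ (n - k) = 0 := by
    rw [← mk_eq_zero, ← h]
    simp only [mk_sum, mk_mul, mk_pow, hCc]
    rfl
  have h3 := mk_ne_zero.1 hg
  have h4 : ∀ᶠ i in (hyperfilter ℕ : Filter ℕ), ∃ q : MvPolynomial (σ i) (K i),
      f i = q * g i ∧ q.totalDegree ≤ (Finset.range (n + 1)).sup d := by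
    filter_upwards [h1, h2, h3] with i h1 h2 h3
    obtain ⟨q, hq, hq2⟩ :=
      IsIntegrallyClosed.exists_eq_mul_of_sum_eq_zero h3 n (fun k => C k i) h1 h2
    refine ⟨q, hq, MvPolynomial.totalDegree_le_of_monic_relation n _ (fun k => C k i) h1
      (fun j hj => (hCd j i).trans ?_) q hq2⟩
    exact Finset.le_sup (f := d) (Finset.mem_range.2 (Nat.lt_succ_of_le hj))
  choose! q hq using fun i (hi : ∃ q : MvPolynomial (σ i) (K i),
      f i = q * g i ∧ q.totalDegree ≤ (Finset.range (n + 1)).sup d) => hi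
  refine ⟨⟨mk q, mk_mem_bdd _ (h4.mono fun i hi => (hq i hi).2)⟩, ?_⟩
  change mk f = mk q * mk g
  rw [← mk_mul]
  exact mk_eq.2 (h4.mono fun i hi => (hq i hi).1)

theorem linearIndependent_pow [∀ i, IsAlgClosed (K i)] (p : ℕ) [hp : ExpChar (UP K) p] {ι : Type}
    {t : ι → Poly K σ} (ht : LinearIndependent (bdd K σ) t) :
    LinearIndependent (bdd K σ) fun i => t i ^ p := by
  classical
  rcases hp with _ | hp
  · simpa using ht
  rename_i hchar
  have hpp : p ≠ 0 := hp.ne_zero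
  have hcharS : CharP (bdd K σ) p := charP_of_injective_algebraMap (algebraMap (UP K) _).injective p
  have hcharT : CharP (Poly K σ) p :=
    charP_of_injective_algebraMap (algebraMap (UP K) _).injective p
  have hfact : Fact p.Prime := ⟨hp⟩
  rw [linearIndependent_iff']
  intro s
  induction s using Finset.strongInduction with
  | _ s ih =>
  intro c h i₀ hi₀
  by_contra hne
  have hD : ∀ w, ∀ i ∈ s, (c i₀ : Poly K σ) * deriv w (c i : Poly K σ) =
      c i * deriv w (c i₀ : Poly K σ) := by
    intro w i hi
    let D : bdd K σ → bdd K σ := fun x => ⟨deriv w x, deriv_mem_bdd w x.2⟩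
    have hDt : ∀ x : Poly K σ, deriv w (x ^ p) = 0 := fun x => by
      rw [Derivation.leibniz_pow, nsmul_eq_mul, CharP.cast_eq_zero, zero_mul]
    have hs : ∑ j ∈ s, (c i₀ * D (c j) - c j * D (c i₀)) • t j ^ p = 0 := by
      have e1 : ∑ j ∈ s, D (c j) • t j ^ p = 0 := by
        have := congrArg (deriv w) h
        rw [map_sum, map_zero] at this
        rw [← this]
        refine Finset.sum_congr rfl fun j _ => ?_
        change _ = deriv w ((c j : Poly K σ) * t j ^ p)
        rw [Derivation.leibniz, hDt, smul_zero, zero_add, smul_eq_mul, mul_comm]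
        rfl
      simp only [sub_smul, Finset.sum_sub_distrib, mul_smul, ← Finset.smul_sum, e1, smul_zero]
      simp only [smul_comm _ (D (c i₀)), ← Finset.smul_sum, h, smul_zero, sub_zero]
    by_cases hii : i = i₀
    · rw [hii]
    · rw [← Finset.sum_erase_add _ _ hi₀, mul_comm (c i₀), sub_self, zero_smul, add_zero] at hs
      have := ih _ (Finset.erase_ssubset hi₀) _ hs i (Finset.mem_erase.2 ⟨hii, hi⟩)
      exact congrArg Subtype.val (sub_eq_zero.1 this)
  have hd : ∀ i ∈ s, ∃ d : bdd K σ, d ^ p = c i * c i₀ ^ (p - 1) := by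
    intro i hi
    obtain ⟨y, hy, hyp⟩ := exists_pow_of_deriv_eq_zero (K := K) p
      (c i * c i₀ ^ (p - 1) : bdd K σ).2 (fun w => by
        change deriv w ((c i : Poly K σ) * (c i₀ : Poly K σ) ^ (p - 1)) = 0
        obtain ⟨m, rfl⟩ := Nat.exists_eq_add_of_le' hp.two_le
        have hc0 : ((m + 2 : ℕ) : Poly K σ) = 0 := CharP.cast_eq_zero _ _
        rw [Derivation.leibniz, Derivation.leibniz_pow, show m + 2 - 1 = m + 1 from rfl,
          Nat.add_sub_cancel, nsmul_eq_mul]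
        simp only [smul_eq_mul]
        push_cast at hc0 ⊢
        linear_combination (c i₀ : Poly K σ) ^ m * hD w i hi +
          (c i : Poly K σ) * (c i₀ : Poly K σ) ^ m * deriv w (c i₀ : Poly K σ) * hc0)
    exact ⟨⟨y, hy⟩, Subtype.ext hyp⟩
  choose! d hd using hd
  have h1 : (∑ i ∈ s, d i • t i) ^ p = 0 := by
    rw [sum_pow_char, ← smul_zero (c i₀ ^ (p - 1)), ← h, Finset.smul_sum]
    refine Finset.sum_congr rfl fun i hi => ?_
    rw [smul_pow, hd i hi, smul_smul, mul_comm]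
  have h2 := linearIndependent_iff'.1 ht s d (pow_eq_zero_iff hpp |>.1 h1) i₀ hi₀
  have h3 := hd i₀ hi₀
  rw [h2, zero_pow hpp, ← pow_succ'] at h3
  exact hne (pow_eq_zero_iff (Nat.succ_ne_zero _) |>.1 h3.symm)

end Regular

end UP

end

section

namespace UP

/-- A linear relation with algebraic coefficients is a combination of relations over the ring of
bounded degree elements. -/
theorem exists_bdd_relations {K : ℕ → Type u} [∀ i, Field (K i)] [∀ i, IsAlgClosed (K i)]
    {σ : ℕ → Type} {Ω : Type u} [Field Ω] [IsAlgClosed Ω] [Algebra (Poly K σ) Ω]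
    [FaithfulSMul (Poly K σ) Ω] {ι : Type} (A : Finset ι) (h : ι → Poly K σ) (l : ι → Ω)
    (hl : ∀ i, IsAlgebraic (bdd K σ) (l i))
    (hsum : ∑ a ∈ A, l a * algebraMap (Poly K σ) Ω (h a) = 0) :
    ∃ (J : Finset ι) (c : bdd K σ) (u : ι → ι → bdd K σ), c ≠ 0 ∧
      (∀ a ∈ A, c • h a = ∑ j ∈ J, u a j • h j) ∧
      ∀ j ∈ J, ∑ a ∈ A, algebraMap (bdd K σ) Ω (u a j) * l a = 0 := by
  classical
  obtain ⟨J, hJ, c, hc, hu⟩ := exists_linearIndepOn_smul_mem_span (S := bdd K σ) h A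
  choose! u hu using hu
  obtain ⟨p, hp⟩ := ExpChar.exists (UP K)
  let F := FractionRing (Poly K σ)
  let _ : Algebra F Ω := FractionRing.liftAlgebra (Poly K σ) Ω
  have : IsScalarTower (Poly K σ) F Ω := FractionRing.isScalarTower_liftAlgebra _ _
  have hF : ExpChar F p :=
    expChar_of_injective_ringHom
      (f := (algebraMap (Poly K σ) F).comp (algebraMap (UP K) (Poly K σ)))
      (RingHom.injective _) p
  have hfaith : FaithfulSMul (bdd K σ) (Poly K σ) :=
    (faithfulSMul_iff_algebraMap_injective _ _).2 Subtype.val_injective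
  refine ⟨J, c, u, hc, hu, fun j hj => ?_⟩
  have key := LinearIndependent.eq_zero_of_isAlgebraic (S := bdd K σ) (T := Poly K σ) (F := F)
    (Ω := Ω) (ι := J) p exists_eq_mul_of_sum_eq_zero (fun t ht => linearIndependent_pow p ht)
    (t := fun j : J => h j) hJ Finset.univ
    (fun j => ∑ a ∈ A, algebraMap (bdd K σ) Ω (u a j) * l a)
    (fun j => by
      have hinj : Function.Injective (algebraMap (bdd K σ) Ω) :=
        (FaithfulSMul.algebraMap_injective (Poly K σ) Ω).comp Subtype.val_injective
      have : FaithfulSMul (bdd K σ) Ω := (faithfulSMul_iff_algebraMap_injective _ _).2 hinj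
      exact Subalgebra.sum_mem (Subalgebra.algebraicClosure (bdd K σ) Ω) fun a _ =>
        (isAlgebraic_algebraMap (u a j)).mul (hl a))
    (by
      rw [Finset.sum_coe_sort J fun j => (∑ a ∈ A, algebraMap (bdd K σ) Ω (u a j) * l a) *
        algebraMap (Poly K σ) Ω (h j)]
      simp only [Finset.sum_mul]
      rw [Finset.sum_comm, ← mul_zero (algebraMap (bdd K σ) Ω c), ← hsum, Finset.mul_sum]
      refine Finset.sum_congr rfl fun a ha => ?_
      have h1 := congrArg (algebraMap (Poly K σ) Ω) (hu a ha)
      simp only [Algebra.smul_def, map_mul, map_sum, ← IsScalarTower.algebraMap_apply] at h1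
      rw [mul_left_comm, h1, Finset.mul_sum]
      exact Finset.sum_congr rfl fun j _ => by ring) ⟨j, hj⟩ (Finset.mem_univ _)
  exact key

end UP

end

section

theorem MvPolynomial.isPrime_map_C {R τ : Type*} [CommRing R] {P : Ideal R} [P.IsPrime] :
    (P.map (MvPolynomial.C : R →+* MvPolynomial τ R)).IsPrime := by
  rw [← Ideal.Quotient.isDomain_iff_prime]
  exact (MvPolynomial.quotientEquivQuotientMvPolynomial (σ := τ) P).symm.toMulEquiv.isDomain _

theorem MvPolynomial.isPrime_map_rename {k τ : Type*} [CommRing k] (V : Set τ)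
    {P : Ideal (MvPolynomial V k)} [P.IsPrime] :
    (P.map (MvPolynomial.rename (R := k) (Subtype.val : V → τ)).toRingHom).IsPrime := by
  classical
  let E : MvPolynomial τ k ≃ₐ[k] MvPolynomial {x // x ∉ V} (MvPolynomial V k) :=
    (MvPolynomial.renameEquiv k
      ((Equiv.sumComm _ _).trans (Equiv.sumCompl (· ∈ V))).symm).trans
      (MvPolynomial.sumAlgEquiv k {x // x ∉ V} V)
  have h1 : (MvPolynomial.rename (R := k) (Subtype.val : V → τ)).toRingHom =
      E.symm.toRingEquiv.toRingHom.comp MvPolynomial.C := by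
    refine MvPolynomial.ringHom_ext (fun a => ?_) fun j => ?_
    · refine (AlgEquiv.eq_symm_apply E).2 ?_
      simp [E]
    · refine (AlgEquiv.eq_symm_apply E).2 ?_
      simp [E]
  rw [h1, ← Ideal.map_map]
  have := MvPolynomial.isPrime_map_C (τ := {x // x ∉ V}) (P := P)
  exact Ideal.map_isPrime_of_equiv E.symm.toRingEquiv

/-- In a polynomial ring over a field, finitely many elements of a prime ideal lie in a finitely
generated prime subideal. -/
theorem MvPolynomial.exists_fg_isPrime_le {k τ : Type*} [Field k] (p : Ideal (MvPolynomial τ k))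
    [p.IsPrime] {ι : Type*} [Finite ι] (g : ι → MvPolynomial τ k) (hg : ∀ j, g j ∈ p) :
    ∃ q ≤ p, q.IsPrime ∧ q.FG ∧ ∀ j, g j ∈ q := by
  classical
  have := Fintype.ofFinite ι
  let V : Finset τ := Finset.univ.biUnion fun j => (g j).vars
  let ρ := (MvPolynomial.rename (R := k) (Subtype.val : ↥(V : Set τ) → τ)).toRingHom
  refine ⟨(p.comap ρ).map ρ, Ideal.map_comap_le, MvPolynomial.isPrime_map_rename _,
    Ideal.FG.map (IsNoetherian.noetherian _) _, fun j => ?_⟩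
  have h1 : g j ∈ MvPolynomial.supported k (V : Set τ) := by
    rw [MvPolynomial.mem_supported]
    intro b hb
    exact Finset.mem_biUnion.2 ⟨j, Finset.mem_univ _, hb⟩
  rw [MvPolynomial.supported_eq_range_rename] at h1
  obtain ⟨c, hc⟩ := h1
  have hc' : ρ c = g j := hc
  rw [← hc']
  refine Ideal.mem_map_of_mem _ ?_
  rw [Ideal.mem_comap, hc']
  exact hg j

theorem Ideal.exists_fg_isPrime_le_of_ringEquiv {k τ S : Type*} [Field k] [CommRing S]
    (E : MvPolynomial τ k ≃+* S) (p : Ideal S)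
    [p.IsPrime] {ι : Type*} [Finite ι] (g : ι → S) (hg : ∀ j, g j ∈ p) :
    ∃ q ≤ p, q.IsPrime ∧ q.FG ∧ ∀ j, g j ∈ q := by
  let φ : MvPolynomial τ k →+* S := E
  have hφ : ∀ x, φ (E.symm x) = x := E.apply_symm_apply
  obtain ⟨q, hq, hqp, hfg, hgq⟩ := MvPolynomial.exists_fg_isPrime_le (p.comap φ)
    (fun j => E.symm (g j)) fun j => by
      rw [Ideal.mem_comap, hφ]
      exact hg j
  have h1 : (q.map φ).IsPrime := Ideal.map_isPrime_of_equiv E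
  refine ⟨q.map φ, Ideal.map_le_iff_le_comap.2 hq, h1, hfg.map φ, fun j => ?_⟩
  rw [← hφ (g j)]
  exact Ideal.mem_map_of_mem φ (hgq j)

theorem Ideal.eq_of_le_of_isIntegralElem {A S : Type*} [CommRing A] [Nontrivial A] [CommRing S]
    (φ : A →+* S)
    {p q : Ideal S} [q.IsPrime] (hqp : q ≤ p)
    (hint : ∀ x, ((Ideal.Quotient.mk q).comp φ).IsIntegralElem (Ideal.Quotient.mk q x))
    (hp : ∀ a, φ a ∈ p → a = 0) : q = p := by
  refine le_antisymm hqp fun x hx => ?_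
  by_contra hxq
  let _ : Algebra A (S ⧸ q) := ((Ideal.Quotient.mk q).comp φ).toAlgebra
  refine Ideal.comap_ne_bot_of_integral_mem (R := A) (I := p.map (Ideal.Quotient.mk q))
    (x := Ideal.Quotient.mk q x) (fun h => hxq (Ideal.Quotient.eq_zero_iff_mem.1 h))
    (Ideal.mem_map_of_mem _ hx) (hint x) ?_
  rw [eq_bot_iff]
  intro a ha
  refine hp a ?_
  have h1 : Ideal.Quotient.mk q (φ a) ∈ p.map (Ideal.Quotient.mk q) := ha
  rw [Ideal.mem_map_iff_of_surjective _ Ideal.Quotient.mk_surjective] at h1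
  obtain ⟨y, hy, hya⟩ := h1
  have h2 := hqp (Ideal.Quotient.eq.1 hya)
  have := p.sub_mem hy h2
  simpa using this

end

section

open Filter

theorem MvPolynomial.totalDegree_aeval_le {k σ τ : Type*} [CommRing k]
    {l : τ → MvPolynomial σ k} (hl : ∀ i, (l i).totalDegree ≤ 1) (p : MvPolynomial τ k) :
    (MvPolynomial.aeval l p).totalDegree ≤ p.totalDegree := by
  rw [MvPolynomial.aeval_def, MvPolynomial.eval₂_eq]
  refine (MvPolynomial.totalDegree_finsetSum _ _).trans (Finset.sup_le fun d hd => ?_)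
  refine (MvPolynomial.totalDegree_mul _ _).trans ?_
  rw [MvPolynomial.algebraMap_eq, MvPolynomial.totalDegree_C, zero_add]
  refine (MvPolynomial.totalDegree_finsetProd _ _).trans ?_
  refine le_trans (Finset.sum_le_sum fun i _ => (MvPolynomial.totalDegree_pow _ _).trans
    (Nat.mul_le_mul_left _ (hl i))) ?_
  simp only [mul_one]
  exact MvPolynomial.le_totalDegree hd

namespace UP

section Frame

variable {K : ℕ → Type u} [∀ i, Field (K i)] {σ : ℕ → Type} {s n D : ℕ}
  {G : Fin s → ∀ i, MvPolynomial (σ i) (K i)}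
  (Fr : ∀ i, NoetherFrame (K i) (σ i) (Fin s) (fun j => G j i) n D)

/-- The ultraproduct of the inclusions of the Noether normalizations. -/
noncomputable def lin : Poly K (fun i => (Fr i).Λ) →+* Poly K σ :=
  UP.map fun i => ((Fr i).lin : MvPolynomial (Fr i).Λ (K i) →+* MvPolynomial (σ i) (K i))

theorem lin_mk (f : ∀ i, MvPolynomial (Fr i).Λ (K i)) :
    lin Fr (mk f) = mk fun i => (Fr i).lin (f i) :=
  map_mk _ _

theorem lin_mem_bdd {x : Poly K fun i => (Fr i).Λ} (hx : x ∈ bdd K fun i => (Fr i).Λ) :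
    lin Fr x ∈ bdd K σ := by
  obtain ⟨f, d, rfl, hd⟩ := mem_bdd.1 hx
  rw [lin_mk]
  refine mk_mem_bdd d (Eventually.of_forall fun i => (?_ : _ ≤ _).trans (hd i))
  exact MvPolynomial.totalDegree_aeval_le (fun k => ((Fr i).hℓ k).totalDegree_le) _

/-- The restriction of `lin` to bounded degree elements. -/
noncomputable def linBdd : bdd K (fun i => (Fr i).Λ) →+* bdd K σ :=
  ((lin Fr).comp (algebraMap (bdd K fun i => (Fr i).Λ) _)).codRestrict (bdd K σ)
    fun x => lin_mem_bdd Fr x.2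

theorem isIntegralElem_linBdd {e : Fin s → ℕ} (hG : ∀ j i, (G j i).IsHomogeneous (e j))
    {A : Type*} [CommRing A] (φ : bdd K σ →+* A)
    (hφ : ∀ (j : Fin s) (x : bdd K σ), (x : Poly K σ) = mk (G j) → φ x = 0) (x : bdd K σ) :
    (φ.comp (linBdd Fr)).IsIntegralElem (φ x) := by
  classical
  have key : ∀ e' (x : bdd K σ), comp e' (x : Poly K σ) = x →
      (φ.comp (linBdd Fr)).IsIntegralElem (φ x) := by
    intro e' x hx
    obtain ⟨f, hf, hfe⟩ := exists_homogeneous_rep hx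
    choose q hqn hq hqG using fun i => (Fr i).exists_lin_relation (fun j => hG j i) (hfe i)
    have hqb : ∀ k : ℕ, mk (fun i => if k ≤ n then q i k else 0) ∈ bdd K fun i => (Fr i).Λ := by
      intro k
      refine mk_mem_bdd ((n - k) * e') (Eventually.of_forall fun i => ?_)
      split_ifs with hk
      · exact (hq i k hk).totalDegree_le
      · simp
    let c : ℕ → bdd K fun i => (Fr i).Λ := fun k => ⟨_, hqb k⟩
    have hcn : c n = 1 := by
      refine Subtype.ext ?_
      change mk (fun i => if n ≤ n then q i n else 0) = 1
      simp only [le_refl, if_true, hqn]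
      exact mk_one
    have hGb : ∀ j, mk (G j) ∈ bdd K σ := fun j =>
      mk_mem_bdd (e j) (Eventually.of_forall fun i => (hG j i).totalDegree_le)
    have hmem : ∑ k ∈ Finset.range (n + 1), linBdd Fr (c k) * x ^ k ∈
        Ideal.span (Set.range fun j => (⟨mk (G j), hGb j⟩ : bdd K σ)) := by
      refine mem_span_of_mem_span _ e (fun j => ?_) _ ?_
      · exact comp_mk_eq_self.2 (Eventually.of_forall fun i => hG j i)
      · have : ((∑ k ∈ Finset.range (n + 1), linBdd Fr (c k) * x ^ k : bdd K σ) : Poly K σ) =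
            mk fun i => ∑ k ∈ Finset.range (n + 1), (Fr i).lin (q i k) * f i ^ k := by
          rw [AddSubmonoidClass.coe_finsetSum, mk_sum]
          refine Finset.sum_congr rfl fun k hk => ?_
          have hk' : k ≤ n := Nat.lt_succ_iff.1 (Finset.mem_range.1 hk)
          rw [mk_mul, mk_pow, hf]
          change lin Fr (mk fun i => if k ≤ n then q i k else 0) * (x : Poly K σ) ^ k = _
          rw [lin_mk]
          simp only [if_pos hk']
        rw [this]
        change _ ∈ Ideal.span (Set.range fun j => mk (G j))
        rw [mem_span_range]
        exact Eventually.of_forall hqG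
    have hzero : φ (∑ k ∈ Finset.range (n + 1), linBdd Fr (c k) * x ^ k) = 0 := by
      have : Ideal.span (Set.range fun j => (⟨mk (G j), hGb j⟩ : bdd K σ)) ≤ RingHom.ker φ := by
        rw [Ideal.span_le]
        rintro _ ⟨j, rfl⟩
        exact hφ j _ rfl
      exact this hmem
    refine ⟨Polynomial.X ^ n + ∑ k ∈ Finset.range n, Polynomial.C (c k) * Polynomial.X ^ k,
      Polynomial.monic_X_pow_add ?_, ?_⟩
    · refine (Polynomial.degree_sum_le _ _).trans_lt ?_
      refine (Finset.sup_lt_iff (WithBot.bot_lt_coe n)).2 fun k hk => ?_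
      exact (Polynomial.degree_C_mul_X_pow_le _ _).trans_lt
        (WithBot.coe_lt_coe.2 (Finset.mem_range.1 hk))
    · rw [Finset.sum_range_succ, hcn, map_one, one_mul] at hzero
      rw [Polynomial.eval₂_add, Polynomial.eval₂_finsetSum, ← hzero, add_comm, map_add, map_sum]
      simp
  obtain ⟨N, -, hN⟩ := exists_comp_bound x.2
  have : x = ∑ m ∈ Finset.range N, (⟨comp m (x : Poly K σ), comp_mem_bdd m _⟩ : bdd K σ) := by
    refine Subtype.ext ?_
    rw [AddSubmonoidClass.coe_finsetSum]
    exact hN.symm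
  rw [this, map_sum]
  refine Finset.sum_induction _ (φ.comp (linBdd Fr)).IsIntegralElem
    (fun a b ha hb => RingHom.IsIntegralElem.add _ ha hb) (RingHom.isIntegralElem_zero _)
    fun m _ => key m _ ?_
  rw [comp_comp, if_pos rfl]

end Frame

end UP

end

section

open Filter

namespace UP

section Kernel

variable {K : ℕ → Type u} [∀ i, Field (K i)] {σ : ℕ → Type} {s n D : ℕ}
  {G : Fin s → ∀ i, MvPolynomial (σ i) (K i)}
  (Fr : ∀ i, NoetherFrame (K i) (σ i) (Fin s) (fun j => G j i) n D)

theorem exists_sub_sum_lin_mem_span (h : Poly K σ) :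
    ∃ c : Fin n → Poly K fun i => (Fr i).Λ,
      h - ∑ a, lin Fr (c a) * mk (fun i => (Fr i).m a) ∈
        Ideal.span (Set.range fun j => mk (G j)) := by
  obtain ⟨f, rfl⟩ := mk_surj h
  choose c hc using fun i => (Fr i).span (f i)
  refine ⟨fun a => mk fun i => killLeft (K i) (Fin s) (Fr i).Λ (c i a), ?_⟩
  simp only [lin_mk, ← mk_mul, ← mk_sum, ← mk_sub]
  rw [mem_span_range]
  refine Eventually.of_forall fun i => ?_
  have h1 : f i - ∑ a, (Fr i).lin (killLeft (K i) (Fin s) (Fr i).Λ (c i a)) * (Fr i).m a =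
      ∑ a, ((Fr i).ψ (c i a) - (Fr i).lin (killLeft (K i) (Fin s) (Fr i).Λ (c i a))) *
        (Fr i).m a := by
    simp only [sub_mul, Finset.sum_sub_distrib]
    congr 1
    exact hc i
  rw [h1]
  exact Ideal.sum_mem _ fun a _ => Ideal.mul_mem_right _ _ ((Fr i).ψ_sub_lin_mem _)

/-- A prime of the ultraproduct over the forms `G` which meets the Noether normalization trivially
is finitely generated. -/
theorem fg_ker [∀ i, IsAlgClosed (K i)] {e : Fin s → ℕ} (hG : ∀ j i, (G j i).IsHomogeneous (e j))
    {Ω : Type u} [Field Ω] [IsAlgClosed Ω] (Θ : Poly K σ →+* Ω) (hΘG : ∀ j, Θ (mk (G j)) = 0)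
    (hΘ : ∀ x, Θ (lin Fr x) = 0 → x = 0) : (RingHom.ker Θ).FG := by
  classical
  let φ := algebraMap (bdd K σ) (Poly K σ)
  let p : Ideal (bdd K σ) := (RingHom.ker Θ).comap φ
  have hΘp : (RingHom.ker Θ).IsPrime := RingHom.ker_isPrime Θ
  have hpp : p.IsPrime := Ideal.comap_isPrime φ _
  have hGb : ∀ j, mk (G j) ∈ bdd K σ := fun j =>
    mk_mem_bdd (e j) (Eventually.of_forall fun i => (hG j i).totalDegree_le)
  have hlin0 : ∀ a : bdd K fun i => (Fr i).Λ, linBdd Fr a ∈ p → a = 0 := fun a ha =>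
    Subtype.ext (hΘ _ ha)
  have hpfg : p.FG := by
    obtain ⟨B, hB⟩ := exists_isFrame (K := K) (σ := σ)
    obtain ⟨q, hqp, hq, hfg, hGq⟩ := Ideal.exists_fg_isPrime_le_of_ringEquiv
      hB.equiv.toRingEquiv p (fun j => (⟨mk (G j), hGb j⟩ : bdd K σ)) hΘG
    have : q = p := Ideal.eq_of_le_of_isIntegralElem (linBdd Fr) hqp
      (isIntegralElem_linBdd Fr hG _ fun j x hx => by
        rw [Ideal.Quotient.eq_zero_iff_mem]
        have : x = ⟨mk (G j), hGb j⟩ := Subtype.ext hx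
        rw [this]
        exact hGq j) hlin0
    exact this ▸ hfg
  have hle : p.map φ ≤ RingHom.ker Θ := Ideal.map_comap_le
  have hGmem : Ideal.span (Set.range fun j => mk (G j)) ≤ p.map φ := by
    rw [Ideal.span_le]
    rintro _ ⟨j, rfl⟩
    exact Ideal.mem_map_of_mem φ (show (⟨mk (G j), hGb j⟩ : bdd K σ) ∈ p from hΘG j)
  have hker : RingHom.ker Θ = p.map φ := by
    refine le_antisymm (fun h hh => ?_) hle
    obtain ⟨c, hc⟩ := exists_sub_sum_lin_mem_span Fr h
    have hMb : ∀ a, mk (fun i => (Fr i).m a) ∈ bdd K σ := fun a =>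
      mk_mem_bdd D (Eventually.of_forall fun i =>
        ((Fr i).hm a).totalDegree_le.trans ((Fr i).deg_le a))
    let M : Fin n → bdd K σ := fun a => ⟨_, hMb a⟩
    set h' := ∑ a, lin Fr (c a) * (M a : Poly K σ) with hh'
    have hh'mem : Θ h' = 0 := by
      have h1 : Θ (h - h') = 0 := hle (hGmem hc)
      rw [map_sub, sub_eq_zero] at h1
      rw [← h1]
      exact hh
    suffices hs : h' ∈ p.map φ by
      have := Ideal.add_mem _ (hGmem hc) hs
      rwa [sub_add_cancel] at this
    let _ : Algebra (Poly K fun i => (Fr i).Λ) Ω := (Θ.comp (lin Fr)).toAlgebra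
    have hfaith : FaithfulSMul (Poly K fun i => (Fr i).Λ) Ω :=
      (faithfulSMul_iff_algebraMap_injective _ _).2
        ((injective_iff_map_eq_zero (Θ.comp (lin Fr))).2 hΘ)
    have hint : ∀ a, IsAlgebraic (bdd K fun i => (Fr i).Λ) (Θ (M a)) := fun a => by
      have : IsIntegral (bdd K fun i => (Fr i).Λ) (Θ (M a)) :=
        isIntegralElem_linBdd Fr hG (Θ.comp φ) (fun j x hx => by
          change Θ (x : Poly K σ) = 0
          rw [hx, hΘG]) (M a)
      exact this.isAlgebraic
    obtain ⟨J, b, u, hb, hu, hrel⟩ := exists_bdd_relations Finset.univ c (fun a => Θ (M a)) hint (by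
      rw [← hh'mem, hh', map_sum]
      refine Finset.sum_congr rfl fun a _ => ?_
      rw [map_mul, mul_comm]
      rfl)
    let w : Fin n → bdd K σ := fun j => ∑ a, linBdd Fr (u a j) * M a
    have hw : ∀ j ∈ J, w j ∈ p := fun j hj => by
      change Θ (φ (w j)) = 0
      rw [← hrel j hj, map_sum, map_sum]
      refine Finset.sum_congr rfl fun a _ => ?_
      rw [map_mul, map_mul]
      rfl
    have hbh : φ (linBdd Fr b) * h' = ∑ j : J, φ (w j) * lin Fr (c j) := by
      rw [Finset.sum_coe_sort J fun j => φ (w j) * lin Fr (c j), hh', Finset.mul_sum]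
      simp only [w, map_sum, Finset.sum_mul]
      rw [Finset.sum_comm]
      refine Finset.sum_congr rfl fun a ha => ?_
      have h1 := congrArg (lin Fr) (hu a ha)
      simp only [Algebra.smul_def, map_mul, map_sum] at h1
      rw [← mul_assoc]
      change lin Fr (b : Poly K fun i => (Fr i).Λ) * _ * _ = _
      refine (congrArg (· * (M a : Poly K σ)) h1).trans ?_
      beta_reduce
      rw [Finset.sum_mul]
      refine Finset.sum_congr rfl fun j _ => ?_
      rw [map_mul]
      change lin Fr _ * lin Fr (c j) * (M a : Poly K σ) =
        lin Fr _ * (M a : Poly K σ) * lin Fr (c j)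
      ring
    obtain ⟨k, a, z, hz, ha⟩ := flat_bdd.exists_colon _ _ _ _ hbh
    rw [hz]
    refine Ideal.sum_mem _ fun j _ => Ideal.mul_mem_right _ _ (Ideal.mem_map_of_mem φ ?_)
    have h2 : Ideal.span (Set.range fun j : J => w j) ≤ p := by
      rw [Ideal.span_le]
      rintro _ ⟨j, rfl⟩
      exact hw j j.2
    exact (hpp.mem_or_mem (h2 (ha j))).resolve_left fun hbp => hb (hlin0 b hbp)
  rw [hker]
  exact hpfg.map φ

end Kernel

end UP

end

section

open Filter

section Main

theorem IsRegular.mem_span_image_Iio {R : Type u} [CommRing R] {s : ℕ} {G : Fin s → R}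
    (h : RingTheory.Sequence.IsRegular R (List.ofFn G)) (j : Fin s) (f : R)
    (hf : G j * f ∈ Ideal.span (G '' Set.Iio j)) : f ∈ Ideal.span (G '' Set.Iio j) := by
  have h1 := (RingTheory.Sequence.isWeaklyRegular_iff _ _).1 h.toIsWeaklyRegular j (by simp)
  have hset : Ideal.ofList ((List.ofFn G).take j) • (⊤ : Submodule R R) =
      Ideal.span (G '' Set.Iio j) := by
    rw [smul_eq_mul, Ideal.mul_top]
    refine congrArg Ideal.span (Set.ext fun x => ?_)
    simp only [Set.mem_ofPred_eq, List.mem_take_iff_getElem, List.getElem_ofFn, Set.mem_image,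
      Set.mem_Iio, List.length_ofFn]
    constructor
    · rintro ⟨i, hi, rfl⟩
      exact ⟨⟨i, by omega⟩, by rw [Fin.lt_def]; simp; omega, rfl⟩
    · rintro ⟨i, hi, rfl⟩
      exact ⟨i, by rw [Fin.lt_def] at hi; omega, rfl⟩
  rw [List.getElem_ofFn, hset] at h1
  have h2 := h1.right_eq_zero_of_smul (x := Submodule.Quotient.mk f) (by
    rw [← Submodule.Quotient.mk_smul, Submodule.Quotient.mk_eq_zero]
    exact hf)
  rwa [Submodule.Quotient.mk_eq_zero] at h2

theorem Ideal.exists_fin_span_of_le {R : Type u} [CommRing R] {J : Ideal R} {r n : ℕ} (hrn : r ≤ n)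
    (h : ∃ g : Fin r → R, Ideal.span (Set.range g) = J) :
    ∃ g : Fin n → R, Ideal.span (Set.range g) = J := by
  obtain ⟨g, rfl⟩ := h
  refine ⟨fun i => if hi : (i : ℕ) < r then g ⟨i, hi⟩ else 0, le_antisymm ?_ ?_⟩
  · rw [Ideal.span_le]
    rintro _ ⟨i, rfl⟩
    dsimp only
    split_ifs with hi
    · exact Ideal.subset_span ⟨_, rfl⟩
    · exact Ideal.zero_mem _
  · rw [Ideal.span_le]
    rintro _ ⟨i, rfl⟩
    exact Ideal.subset_span ⟨⟨i, by omega⟩, by simp⟩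

/-- Minimal primes of regular sequences of forms of fixed positive degrees are generated by a
bounded number of elements. -/
theorem exists_generators_bound (s : ℕ) (e : Fin s → ℕ) (he : ∀ j, 1 ≤ e j) :
    ∃ r : ℕ, ∀ (K : Type u) [Field K] [IsAlgClosed K] (N : ℕ)
      (G : Fin s → MvPolynomial (Fin N) K), (∀ j, (G j).IsHomogeneous (e j)) →
      (∀ j f, G j * f ∈ Ideal.span (G '' Set.Iio j) → f ∈ Ideal.span (G '' Set.Iio j)) →
      ∀ J ∈ (Ideal.span (Set.range G)).minimalPrimes,
        ∃ g : Fin r → MvPolynomial (Fin N) K, Ideal.span (Set.range g) = J := by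
  by_contra! hcon
  obtain ⟨n, D, hframe⟩ := exists_noetherFrame.{u} s e he
  choose K hF hA N G hG hreg J hJ hgen using hcon
  have hfr : ∀ i, Nonempty (NoetherFrame (K i) (Fin (N i)) (Fin s) (G i) n D) := fun i =>
    have := IsAlgClosed.instInfinite (K := K i)
    hframe (K i) (Fin (N i)) (G i) (hG i) (hreg i)
  let Fr : ∀ i, NoetherFrame (K i) (Fin (N i)) (Fin s) (fun j => G i j) n D := fun i =>
    (hfr i).some
  have hJp : ∀ i, (J i).IsPrime := fun i => (hJ i).1.1
  let θ : ∀ i, MvPolynomial (Fin (N i)) (K i) →+*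
      AlgebraicClosure (FractionRing (MvPolynomial (Fin (N i)) (K i) ⧸ J i)) := fun i =>
    (algebraMap (FractionRing (MvPolynomial (Fin (N i)) (K i) ⧸ J i)) _).comp
      ((algebraMap (MvPolynomial (Fin (N i)) (K i) ⧸ J i) _).comp (Ideal.Quotient.mk (J i)))
  have hθ : ∀ i f, θ i f = 0 ↔ f ∈ J i := fun i f => by
    rw [← Ideal.Quotient.eq_zero_iff_mem]
    change algebraMap (FractionRing (MvPolynomial (Fin (N i)) (K i) ⧸ J i))
      (AlgebraicClosure (FractionRing (MvPolynomial (Fin (N i)) (K i) ⧸ J i))) (algebraMap _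
        (FractionRing (MvPolynomial (Fin (N i)) (K i) ⧸ J i))
        (Ideal.Quotient.mk (J i) f)) = 0 ↔ _
    rw [FaithfulSMul.algebraMap_eq_zero_iff, FaithfulSMul.algebraMap_eq_zero_iff]
  let Θ := UP.map θ
  have hΘ : ∀ f, Θ (UP.mk f) = 0 ↔ ∀ᶠ i in (hyperfilter ℕ : Filter ℕ), f i ∈ J i := fun f => by
    rw [show Θ (UP.mk f) = UP.mk fun i => θ i (f i) from UP.map_mk θ f, UP.mk_eq_zero]
    simp only [hθ]
  have hfg := UP.fg_ker (σ := fun i => Fin (N i)) (G := fun j i => G i j) Fr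
    (fun j i => hG i j) Θ
    (fun j => (hΘ _).2 (Eventually.of_forall fun i =>
      (hJ i).1.2 (Ideal.subset_span ⟨j, rfl⟩)))
    (fun x hx => by
      obtain ⟨q, rfl⟩ := UP.mk_surj x
      rw [UP.lin_mk, hΘ] at hx
      rw [UP.mk_eq_zero]
      filter_upwards [hx] with i hi
      by_contra hq
      obtain ⟨y, hy, hxy⟩ := Ideal.exists_mul_mem_of_mem_minimalPrimes (hJ i) hi
      exact hy ((Fr i).mem_of_lin_mul_mem hq hxy))
  obtain ⟨r, g, hg⟩ := Submodule.fg_iff_exists_fin_generating_family.1 hfg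
  choose γ hγ using fun t => UP.mk_surj (g t)
  obtain rfl : (fun t => UP.mk (γ t)) = g := funext hγ
  have hle : ∀ᶠ i in (hyperfilter ℕ : Filter ℕ), ∀ t, γ t i ∈ J i := by
    rw [eventually_all]
    intro t
    rw [← hΘ]
    have : UP.mk (γ t) ∈ RingHom.ker Θ := hg ▸ Submodule.subset_span ⟨t, rfl⟩
    exact this
  have hge : ∀ᶠ i in (hyperfilter ℕ : Filter ℕ),
      J i ≤ Ideal.span (Set.range fun t => γ t i) := by
    have : ∀ i, ∃ f, f ∈ J i ∧ (f ∈ Ideal.span (Set.range fun t => γ t i) →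
        J i ≤ Ideal.span (Set.range fun t => γ t i)) := fun i => by
      by_cases h : J i ≤ Ideal.span (Set.range fun t => γ t i)
      · exact ⟨0, Ideal.zero_mem _, fun _ => h⟩
      · obtain ⟨f, hf, hf'⟩ := SetLike.not_le_iff_exists.1 h
        exact ⟨f, hf, fun h => absurd h hf'⟩
    choose f hf hf' using this
    have hfker : UP.mk f ∈ RingHom.ker Θ := (hΘ f).2 (Eventually.of_forall hf)
    rw [← hg] at hfker
    filter_upwards [(UP.mem_span_range γ f).1 hfker] with i hi using hf' i hi
  have hr : ∀ᶠ i in (hyperfilter ℕ : Filter ℕ), r ≤ i := by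
    have h := Nat.hyperfilter_le_atTop
    exact h (eventually_ge_atTop r)
  obtain ⟨i, h1, h2, h3⟩ := (hle.and (hge.and hr)).exists
  obtain ⟨g', hg'⟩ := Ideal.exists_fin_span_of_le (J := J i) h3 ⟨fun t => γ t i,
    le_antisymm (by rw [Ideal.span_le]; rintro _ ⟨t, rfl⟩; exact h1 t) h2⟩
  exact hgen i g' hg'

end Main

end

/-- There is a function `D`, independent of `N` and `K`, such that for every
algebraically closed field `K`, every regular sequence `G_1, …, G_s` (`s ≤ k`) of forms of
degree at most `d` in `K[x_1, …, x_N]`, and every minimal prime `J` of the ideal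
`(G_1, …, G_s)`, the prime `J` can be generated by at most `D k d` elements. -/
theorem statement10 :
    ∃ D : ℕ → ℕ → ℕ,
      ∀ (K : Type u) [Field K] [IsAlgClosed K] (N k d s : ℕ), s ≤ k →
        ∀ G : Fin s → MvPolynomial (Fin N) K,
          (∀ j, ∃ e : ℕ, e ≤ d ∧ (G j).IsHomogeneous e) →
          RingTheory.Sequence.IsRegular (MvPolynomial (Fin N) K) (List.ofFn G) →
          ∀ J ∈ (Ideal.span (Set.range G)).minimalPrimes,
            ∃ g : Fin (D k d) → MvPolynomial (Fin N) K,
              Ideal.span (Set.range g) = J := by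
  choose r hr using exists_generators_bound.{u}
  refine ⟨fun k d => ∑ s : Fin (k + 1), ∑ e : Fin s → Fin (d + 1),
    r s (fun j => e j + 1) (fun j => Nat.le_add_left 1 _), ?_⟩
  intro K _ _ N k d s hs G hG hreg J hJ
  have hdeg : ∀ j, ∃ e : Fin (d + 1), (G j).IsHomogeneous (e + 1) := fun j => by
    obtain ⟨e, hed, he⟩ := hG j
    obtain _ | e := e
    · have hGJ : G j ∈ J := hJ.1.2 (Ideal.subset_span ⟨j, rfl⟩)
      have hC := MvPolynomial.totalDegree_eq_zero_iff_eq_C.1 (Nat.le_zero.1 he.totalDegree_le)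
      have h0 : G j = 0 := by
        by_contra hne
        refine hJ.1.1.ne_top (Ideal.eq_top_of_isUnit_mem _ hGJ ?_)
        rw [hC] at hne ⊢
        exact (isUnit_iff_ne_zero.2 fun h => hne (by rw [h, map_zero])).map MvPolynomial.C
      exact ⟨0, h0 ▸ MvPolynomial.isHomogeneous_zero _ _ _⟩
    · exact ⟨⟨e, by omega⟩, he⟩
  choose e he using hdeg
  refine Ideal.exists_fin_span_of_le ?_
    (hr s (fun j => e j + 1) (fun j => Nat.le_add_left 1 _) K N G he
      (IsRegular.mem_span_image_Iio hreg) J hJ)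
  refine le_trans ?_ (Finset.single_le_sum (fun _ _ => Nat.zero_le _)
    (Finset.mem_univ (⟨s, by omega⟩ : Fin (k + 1))))
  exact Finset.single_le_sum
    (f := fun e : Fin s → Fin (d + 1) =>
      r s (fun j => e j + 1) (fun j => Nat.le_add_left 1 _))
    (fun _ _ => Nat.zero_le _) (Finset.mem_univ e)
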